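/- Under assumptions (A1)-(A3), let ρ²_t = X(t,·;A[f])♯α₀ be the density of the auxiliary system driven by A[f], and let α_t be the solution to the Fokker–Planck equation ∂_t α + div(α(-∇V - ∇log α)) = 0 with α₀ as initial condition and periodic boundary conditions. Then for every t ∈ [0,T], KL(ρ²_t, α_t) ≤ (C₂/2) R(f), where C₂ is the constant of the score-difference lemma (depending only on T, L₀, L_f, L_v). -/

import Mathlib

open MeasureTheory Set
open scoped ENNReal

noncomputable section

abbrev E (d : ℕ) := EuclideanSpace ℝ (Fin d)

def uvec (d : ℕ) (i : Fin d) : E d := EuclideanSpace.single i (1 : ℝ)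

/-- The box `𝒳 = [-l/2, l/2]^d`. -/
def box (d : ℕ) (l : ℝ) : Set (E d) := {x | ∀ i, x i ∈ Icc (-(l / 2)) (l / 2)}

def IsPeriodic {d : ℕ} {β : Type*} (l : ℝ) (g : E d → β) : Prop :=
  ∀ (x : E d) (i : Fin d), g (x + l • uvec d i) = g x

/-- Divergence of a vector field on `ℝ^d`. -/
def diverg {d : ℕ} (F : E d → E d) (x : E d) : ℝ :=
  ∑ i, fderiv ℝ F x (uvec d i) i

/-- Laplacian of a scalar function on `ℝ^d`. -/
def lap {d : ℕ} (φ : E d → ℝ) (x : E d) : ℝ :=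
  diverg (fun y => gradient φ y) x

/-- The score (gradient of the log-density) of a positive density. -/
def score {d : ℕ} (g : E d → ℝ) (x : E d) : E d :=
  gradient (fun y => Real.log (g y)) x

/-- The velocity-consistency transformation `A[f](t,x) = -∇V(t,x) - ∇log ρ¹(t,x;f)`,
expressed through the density trajectory `ρ1` of `f`. -/
def Avf {d : ℕ} (V : ℝ → E d → ℝ) (ρ1 : ℝ → E d → ℝ) (t : ℝ) : E d → E d :=
  fun x => -gradient (V t) x - score (ρ1 t) x

/-- The self-consistency residual `δ(t,x;f) = f(t,x) - A[f](t,x)`. -/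
def deltaF {d : ℕ} (f : ℝ → E d → E d) (V ρ1 : ℝ → E d → ℝ) (t : ℝ) : E d → E d :=
  fun x => f t x - Avf V ρ1 t x

/-- The self-consistency potential
`R(f) = ∫₀ᵀ ∫_𝒳 Σ_{i=0}^{2} ‖δ^{(i)}(t,x;f)‖² ρ¹(t,x;f) dx dt`. -/
def Rloss (d : ℕ) (l T : ℝ) (f : ℝ → E d → E d) (V ρ1 : ℝ → E d → ℝ) : ℝ :=
  ∫ t in (0 : ℝ)..T, ∫ x in box d l,
    (‖deltaF f V ρ1 t x‖ ^ 2 + ‖fderiv ℝ (deltaF f V ρ1 t) x‖ ^ 2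
      + ‖fderiv ℝ (fun y => fderiv ℝ (deltaF f V ρ1 t) y) x‖ ^ 2) * ρ1 t x

/-- The measure on `𝒳` with density `g` w.r.t. Lebesgue measure. -/
def densM {d : ℕ} (l : ℝ) (g : E d → ℝ) : Measure (E d) :=
  (volume.restrict (box d l)).withDensity (fun x => ENNReal.ofReal (g x))

/-- Squared Wasserstein-2 distance, as an infimum over couplings. -/
def W2sq {d : ℕ} (μ ν : Measure (E d)) : ℝ≥0∞ :=
  ⨅ π ∈ {π : Measure (E d × E d) | π.map Prod.fst = μ ∧ π.map Prod.snd = ν},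
    ∫⁻ q, ENNReal.ofReal (‖q.1 - q.2‖ ^ 2) ∂π

/-- (A1): regularity of the initial density `α₀`. -/
def RegInit (d : ℕ) (l L₀ : ℝ) (α₀ : E d → ℝ) : Prop :=
  ∀ x ∈ box d l,
    (∀ i ∈ Finset.Icc 1 3, ‖iteratedFDeriv ℝ i (fun y => Real.log (α₀ y)) x‖ ≤ L₀) ∧
    ‖iteratedFDeriv ℝ 2 (fun y => lap (fun z => Real.log (α₀ z)) y) x‖ ≤ L₀

/-- (A2): regularity of a hypothesis velocity field. -/
def RegVel (d : ℕ) (l T Lf : ℝ) (f : ℝ → E d → E d) : Prop :=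
  ∀ t ∈ Icc (0 : ℝ) T, IsPeriodic l (f t) ∧
    ∀ x ∈ box d l, ∀ i ∈ Finset.Icc 1 4,
      ‖iteratedFDeriv ℝ i (f t) x‖ ≤ Lf ∧
      ‖iteratedFDeriv ℝ i (fun y => diverg (f t) y) x‖ ≤ Lf

/-- (A3): regularity of the drift potential `V`. -/
def RegPot (d : ℕ) (l T Lv : ℝ) (V : ℝ → E d → ℝ) : Prop :=
  ∀ t ∈ Icc (0 : ℝ) T, IsPeriodic l (V t) ∧
    ∀ x ∈ box d l,
      ‖iteratedFDeriv ℝ 2 (V t) x‖ ≤ Lv ∧ ‖iteratedFDeriv ℝ 3 (V t) x‖ ≤ Lv ∧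
      ‖iteratedFDeriv ℝ 2 (fun y => lap (V t) y) x‖ ≤ Lv

/-- `α₀` is a smooth, positive, `l`-periodic probability density on `𝒳`. -/
def InitDensity (d : ℕ) (l : ℝ) (α₀ : E d → ℝ) : Prop :=
  ContDiff ℝ (⊤ : ℕ∞) α₀ ∧ (∀ x, 0 < α₀ x) ∧ IsPeriodic l α₀ ∧ (∫ x in box d l, α₀ x) = 1

/-- `ρ` is the (smooth, positive, periodic) density trajectory transported by the
velocity field `v` from `α₀`, i.e. `ρ(t,·) = X(t,·;v)♯α₀`; equivalently `ρ` solves the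
continuity equation `∂_t ρ + div(ρ v) = 0` with `ρ(0,·) = α₀`. -/
def TransportedBy (d : ℕ) (l : ℝ) (v : ℝ → E d → E d) (α₀ : E d → ℝ)
    (ρ : ℝ → E d → ℝ) : Prop :=
  (∀ t, ContDiff ℝ (⊤ : ℕ∞) (ρ t)) ∧ (∀ t x, 0 < ρ t x) ∧ (∀ t, IsPeriodic l (ρ t)) ∧
  ρ 0 = α₀ ∧
  ∀ t x, HasDerivAt (fun τ => ρ τ x) (-(diverg (fun y => ρ t y • v t y) x)) t

/-- `αs` is the (smooth, positive, periodic) solution of the Fokker–Planck equation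
`∂_t α + div(α(-∇V - ∇log α)) = 0`, i.e. `∂_t α = Δα + div(α ∇V)`, with `α(0,·) = α₀`. -/
def SolvesFPE (d : ℕ) (l : ℝ) (V : ℝ → E d → ℝ) (α₀ : E d → ℝ)
    (αs : ℝ → E d → ℝ) : Prop :=
  (∀ t, ContDiff ℝ (⊤ : ℕ∞) (αs t)) ∧ (∀ t x, 0 < αs t x) ∧ (∀ t, IsPeriodic l (αs t)) ∧
  αs 0 = α₀ ∧
  ∀ t x, HasDerivAt (fun τ => αs τ x)
    (lap (αs t) x + diverg (fun y => αs t y • gradient (V t) y) x) t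

/-- Kullback–Leibler divergence between two densities on `𝒳`. -/
def KLdiv (d : ℕ) (l : ℝ) (p q : E d → ℝ) : ℝ :=
  ∫ x in box d l, p x * Real.log (p x / q x)

open Filter Topology

/-- One-sided Fatou lemma for right difference quotients of a parametric integral. -/
theorem eventually_slope_integral_lt {X : Type*} [MeasurableSpace X] {μ : Measure X}
    [IsFiniteMeasure μ] {F : ℝ → X → ℝ} {q : X → ℝ} {t t₁ K M : ℝ} (ht : t < t₁)
    (hF : ∀ s ∈ Ico t t₁, Integrable (F s) μ) (hq : ∀ x, |q x| ≤ M)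
    (hup : ∀ s ∈ Ioo t t₁, ∀ x, F s x - F t x ≤ K * (s - t))
    (hlim : ∀ x, HasDerivWithinAt (fun s => F s x) (q x) (Ioi t) t)
    {r : ℝ} (hr : ∫ x, q x ∂μ < r) :
    ∀ᶠ s in 𝓝[>] t, (s - t)⁻¹ * ((∫ x, F s x ∂μ) - ∫ x, F t x ∂μ) < r := by
  have hnear : ∀ᶠ s in 𝓝[>] t, s ∈ Ioo t t₁ := Ioo_mem_nhdsGT ht
  have htm : t ∈ Ico t t₁ := ⟨le_rfl, ht⟩
  set G : ℝ → X → ℝ := fun s x => max ((s - t)⁻¹ * (F s x - F t x)) (-M) with hG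
  have hGint : ∀ s ∈ Ioo t t₁, Integrable (G s) μ := fun s hs =>
    (((hF s ⟨hs.1.le, hs.2⟩).sub (hF t htm)).const_mul _).sup (integrable_const _)
  have hlimG : Tendsto (fun s => ∫ x, G s x ∂μ) (𝓝[>] t) (𝓝 (∫ x, q x ∂μ)) := by
    refine tendsto_integral_filter_of_dominated_convergence (fun _ => |K| + |M|) ?_ ?_
      (integrable_const _) ?_
    · filter_upwards [hnear] with s hs using (hGint s hs).aestronglyMeasurable
    · filter_upwards [hnear] with s hs
      refine Eventually.of_forall fun x => ?_
      have hpos : 0 < s - t := sub_pos.2 hs.1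
      have h1 : (s - t)⁻¹ * (F s x - F t x) ≤ K := by
        rw [inv_mul_le_iff₀ hpos, mul_comm]; exact hup s hs x
      rw [Real.norm_eq_abs, abs_le]
      refine ⟨?_, ?_⟩
      · refine le_trans ?_ (le_max_right _ _)
        linarith [abs_nonneg K, le_abs_self M]
      · refine max_le ?_ ?_
        · linarith [abs_nonneg M, le_abs_self K]
        · linarith [abs_nonneg K, neg_abs_le M]
    · refine Eventually.of_forall fun x => ?_
      have h1 := (hasDerivWithinAt_iff_tendsto_slope' (notMem_Ioi.2 le_rfl)).1 (hlim x)
      have h2 : Tendsto (fun s => G s x) (𝓝[>] t) (𝓝 (max (q x) (-M))) := by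
        refine Tendsto.max ?_ tendsto_const_nhds
        refine h1.congr fun s => ?_
        simp [slope, smul_eq_mul]
      rwa [max_eq_left (by linarith [neg_abs_le (q x), hq x])] at h2
  filter_upwards [hlimG.eventually_lt_const hr, hnear] with s hs hs'
  refine lt_of_le_of_lt ?_ hs
  rw [← integral_sub (hF s ⟨hs'.1.le, hs'.2⟩) (hF t htm), ← integral_const_mul]
  exact integral_mono (((hF s ⟨hs'.1.le, hs'.2⟩).sub (hF t htm)).const_mul _) (hGint s hs')
    fun x => le_max_left _ _

/-- Data of a strict-sense barrier `β` (with right time derivative `β'`) for the comparison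
principle with `u` (with time derivative `u'`) on `[t₀, T]`. -/
structure IsBarrier {X : Type*} [TopologicalSpace X] [MeasurableSpace X] (μ : Measure X)
    (T Λ : ℝ) (u u' : ℝ → X → ℝ) (t₀ : ℝ) (β β' : ℝ → X → ℝ) : Prop where
  cont : ∀ t ∈ Icc t₀ T, Continuous (β t)
  deriv : ∀ t ∈ Ico t₀ T, ∀ x, HasDerivWithinAt (fun s => β s x) (β' t x) (Ioi t) t
  lip : ∃ K, ∀ s ∈ Icc t₀ T, ∀ t ∈ Icc t₀ T, ∀ x, |β s x - β t x| ≤ K * |s - t|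
  bdd : ∃ K, ∀ t ∈ Icc t₀ T, ∀ x, |β t x| ≤ K
  bdd' : ∀ t ∈ Ico t₀ T, ∃ K, ∀ x, |β' t x| ≤ K
  ineq : ∀ t ∈ Ico t₀ T, ∫ x, 3 * max (β t x - u t x) 0 ^ 2 * (β' t x - u' t x) ∂μ ≤
    Λ * ∫ x, max (β t x - u t x) 0 ^ 3 ∂μ
  full : ∀ t ∈ Icc t₀ T, ∫ x, max (β t x - u t x) 0 ^ 3 ∂μ = 0 → ∀ x, β t x ≤ u t x

theorem hasDerivAt_max_zero_pow (n : ℕ) (x : ℝ) :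
    HasDerivAt (fun y : ℝ => max y 0 ^ (n + 2)) ((n + 2) * max x 0 ^ (n + 1)) x := by
  rcases lt_trichotomy x 0 with hx | rfl | hx
  · have : (fun y : ℝ => max y 0 ^ (n + 2)) =ᶠ[𝓝 x] fun _ => 0 := by
      filter_upwards [gt_mem_nhds hx] with y hy
      simp [max_eq_right hy.le]
    rw [max_eq_right hx.le]
    simpa using (hasDerivAt_const x (0 : ℝ)).congr_of_eventuallyEq this
  · rw [hasDerivAt_iff_isLittleO]
    simp only [max_self, ne_eq, Nat.add_eq_zero_iff, OfNat.ofNat_ne_zero, and_false,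
      not_false_eq_true, zero_pow, sub_zero, one_ne_zero, mul_zero, smul_zero]
    refine Asymptotics.IsBigO.trans_isLittleO (g := fun y : ℝ => y ^ (n + 2)) ?_ ?_
    · refine Asymptotics.IsBigO.of_bound 1 (Eventually.of_forall fun y => ?_)
      rw [one_mul, norm_pow, norm_pow]
      refine pow_le_pow_left₀ (norm_nonneg _) ?_ _
      rcases le_total y 0 with h | h <;> simp [h]
    · simpa using Asymptotics.isLittleO_pow_pow (𝕜 := ℝ) (show 1 < n + 2 by omega)
  · have : (fun y : ℝ => max y 0 ^ (n + 2)) =ᶠ[𝓝 x] fun y => y ^ (n + 2) := by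
      filter_upwards [lt_mem_nhds hx] with y hy
      simp [max_eq_left hy.le]
    rw [max_eq_left hx.le]
    have h := (hasDerivAt_pow (n + 2) x).congr_of_eventuallyEq this
    simpa using h

theorem max_zero_pow_three_sub_le {a b K : ℝ} (hK : 0 ≤ K) (ha : a ≤ K) (hb : b ≤ K) {c : ℝ}
    (hc : 0 ≤ c) (hab : a - b ≤ c) : max a 0 ^ 3 - max b 0 ^ 3 ≤ 3 * K ^ 2 * c := by
  have h0a : 0 ≤ max a 0 := le_max_right _ _
  have h0b : 0 ≤ max b 0 := le_max_right _ _
  have h1 : max a 0 - max b 0 ≤ c := by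
    rcases le_total a 0 with h | h
    · rw [max_eq_right h]; linarith
    · rw [max_eq_left h]; linarith [le_max_left b 0]
  have h2 : max a 0 ≤ K := max_le ha hK
  have h3 : max b 0 ≤ K := max_le hb hK
  have h4 : max a 0 ^ 3 - max b 0 ^ 3 =
      (max a 0 - max b 0) * (max a 0 ^ 2 + max a 0 * max b 0 + max b 0 ^ 2) := by ring
  rw [h4]
  have h5 : max a 0 ^ 2 + max a 0 * max b 0 + max b 0 ^ 2 ≤ 3 * K ^ 2 := by
    nlinarith [mul_le_mul h2 h3 h0b hK, mul_le_mul h2 h2 h0a hK, mul_le_mul h3 h3 h0b hK]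
  calc _ ≤ c * (max a 0 ^ 2 + max a 0 * max b 0 + max b 0 ^ 2) :=
        mul_le_mul_of_nonneg_right h1 (by positivity)
    _ ≤ c * (3 * K ^ 2) := mul_le_mul_of_nonneg_left h5 hc
    _ = _ := by ring

section Comparison

variable {X : Type*} [TopologicalSpace X] [MeasurableSpace X] [BorelSpace X] {μ : Measure X}
  [IsFiniteMeasure μ] {T Λ : ℝ} {u u' : ℝ → X → ℝ}

theorem IsBarrier.integrable {t₀ : ℝ} {β β' : ℝ → X → ℝ} (hβ : IsBarrier μ T Λ u u' t₀ β β')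
    (hu0 : ∀ t ∈ Icc t₀ T, ∀ x, 0 ≤ u t x) (huc : ∀ t ∈ Icc t₀ T, Continuous (u t)) {t : ℝ}
    (ht : t ∈ Icc t₀ T) : Integrable (fun x => max (β t x - u t x) 0 ^ 3) μ := by
  obtain ⟨K, hK⟩ := hβ.bdd
  refine Integrable.of_bound (C := |K| ^ 3) ?_ (Eventually.of_forall fun x => ?_)
  · exact ((((hβ.cont t ht).sub (huc t ht)).max continuous_const).pow 3).aestronglyMeasurable
  · rw [norm_pow]
    refine pow_le_pow_left₀ (norm_nonneg _) ?_ _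
    rw [Real.norm_eq_abs, abs_of_nonneg (le_max_right _ _)]
    refine max_le ?_ (abs_nonneg _)
    linarith [hu0 t ht x, hK t ht x, le_abs_self (β t x), le_abs_self K]

theorem IsBarrier.continuousOn {t₀ : ℝ} {β β' : ℝ → X → ℝ} (hβ : IsBarrier μ T Λ u u' t₀ β β')
    (hu0 : ∀ t ∈ Icc t₀ T, ∀ x, 0 ≤ u t x) (huc : ∀ t ∈ Icc t₀ T, Continuous (u t))
    (hut : ∀ x, ContinuousOn (fun t => u t x) (Icc t₀ T)) :
    ContinuousOn (fun t => ∫ x, max (β t x - u t x) 0 ^ 3 ∂μ) (Icc t₀ T) := by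
  obtain ⟨K, hK⟩ := hβ.bdd
  obtain ⟨L, hL⟩ := hβ.lip
  refine continuousOn_of_dominated (bound := fun _ => |K| ^ 3)
    (fun t ht => (hβ.integrable hu0 huc ht).aestronglyMeasurable) (fun t ht => ?_)
    (integrable_const _) ?_
  · refine Eventually.of_forall fun x => ?_
    rw [norm_pow]
    refine pow_le_pow_left₀ (norm_nonneg _) ?_ _
    rw [Real.norm_eq_abs, abs_of_nonneg (le_max_right _ _)]
    refine max_le ?_ (abs_nonneg _)
    linarith [hu0 t ht x, hK t ht x, le_abs_self (β t x), le_abs_self K]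
  · refine Eventually.of_forall fun x => ?_
    have hb : ContinuousOn (fun t => β t x) (Icc t₀ T) := by
      refine (LipschitzOnWith.of_dist_le_mul (K := L.toNNReal) fun s hs t ht => ?_).continuousOn
      rw [Real.dist_eq, Real.dist_eq]
      exact (hL s hs t ht x).trans
        (mul_le_mul_of_nonneg_right (Real.le_coe_toNNReal L) (abs_nonneg _))
    exact ((hb.sub (hut x)).sup continuousOn_const).pow 3

/-- The Dini inequality for the defect of a barrier at a time from which `u` is one-sidedly
Lipschitz. -/
theorem IsBarrier.eventually_slope_lt {t₀ : ℝ} {β β' : ℝ → X → ℝ}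
    (hβ : IsBarrier μ T Λ u u' t₀ β β')
    (hu0 : ∀ t ∈ Icc t₀ T, ∀ x, 0 ≤ u t x) (huc : ∀ t ∈ Icc t₀ T, Continuous (u t))
    {t t₁ C : ℝ} (ht : t ∈ Ico t₀ T) (ht₁ : t < t₁)
    (hud : ∀ x, HasDerivAt (fun s => u s x) (u' t x) t) (hub : ∃ K, ∀ x, |u' t x| ≤ K)
    (hlow : ∀ s ∈ Ioo t t₁, s ≤ T → ∀ x, u t x - C * (s - t) ≤ u s x) {r : ℝ}
    (hr : Λ * ∫ x, max (β t x - u t x) 0 ^ 3 ∂μ < r) :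
    ∀ᶠ s in 𝓝[>] t, (s - t)⁻¹ * ((∫ x, max (β s x - u s x) 0 ^ 3 ∂μ) -
      ∫ x, max (β t x - u t x) 0 ^ 3 ∂μ) < r := by
  obtain ⟨K, hK⟩ := hβ.bdd
  obtain ⟨L, hL⟩ := hβ.lip
  obtain ⟨K', hK'⟩ := hβ.bdd' t ht
  obtain ⟨U, hU⟩ := hub
  have hle : ∀ s ∈ Icc t₀ T, ∀ x, β s x - u s x ≤ |K| := fun s hs x => by
    linarith [hu0 s hs x, hK s hs x, le_abs_self (β s x), le_abs_self K]
  have htI : t ∈ Icc t₀ T := ⟨ht.1, ht.2.le⟩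
  refine eventually_slope_integral_lt (F := fun s x => max (β s x - u s x) 0 ^ 3)
    (t₁ := min t₁ T) (M := 3 * |K| ^ 2 * (|K'| + |U|)) (K := 3 * |K| ^ 2 * (|L| + |C|))
    (lt_min ht₁ ht.2) (fun s hs => ?_) (fun x => ?_) (fun s hs x => ?_) (fun x => ?_)
    (lt_of_le_of_lt (hβ.ineq t ht) hr)
  · exact hβ.integrable hu0 huc ⟨ht.1.trans hs.1, (hs.2.trans_le (min_le_right _ _)).le⟩
  · rw [abs_mul, abs_mul, abs_of_nonneg (by norm_num : (0 : ℝ) ≤ 3), abs_pow,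
      abs_of_nonneg (le_max_right _ _)]
    gcongr
    · exact max_le (hle t htI x) (abs_nonneg _)
    · refine (abs_sub _ _).trans ?_
      linarith [hK' x, hU x, le_abs_self K', le_abs_self U]
  · have hs' : s ∈ Icc t₀ T := ⟨ht.1.trans hs.1.le, (hs.2.trans_le (min_le_right _ _)).le⟩
    have hst : 0 < s - t := sub_pos.2 hs.1
    have h1 := hL s hs' t htI x
    rw [abs_of_pos hst] at h1
    have h2 := hlow s ⟨hs.1, hs.2.trans_le (min_le_left _ _)⟩ hs'.2 x
    rw [mul_assoc]
    refine max_zero_pow_three_sub_le (abs_nonneg K) (hle s hs' x) (hle t htI x)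
      (by positivity) ?_
    have h3 : L * (s - t) ≤ |L| * (s - t) := mul_le_mul_of_nonneg_right (le_abs_self _) hst.le
    have h4 : C * (s - t) ≤ |C| * (s - t) := mul_le_mul_of_nonneg_right (le_abs_self _) hst.le
    linarith [le_abs_self (β s x - β t x)]
  · have h1 := (hβ.deriv t ht x).sub (hud x).hasDerivWithinAt
    have h2 := (hasDerivAt_max_zero_pow 1 (β t x - u t x)).comp_hasDerivWithinAt t h1
    have h3 : HasDerivWithinAt (fun s => max (β s x - u s x) 0 ^ 3)
      ((((1 : ℕ) : ℝ) + 2) * max (β t x - u t x) 0 ^ (1 + 1) * (β' t x - u' t x)) (Ioi t) t := h2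
    convert h3 using 1
    norm_num

end Comparison

section BaireComparison

variable {X : Type*} [TopologicalSpace X] [MeasurableSpace X] [BorelSpace X] {μ : Measure X}
  [IsFiniteMeasure μ] {T Λ : ℝ} {u u' : ℝ → X → ℝ}

/-- At the time `t`, the Dini inequality holds for the defect of every barrier. -/
def IsDiniTime (μ : Measure X) (T Λ : ℝ) (u u' : ℝ → X → ℝ) (t : ℝ) : Prop :=
  ∀ t₀ ∈ Icc 0 t, ∀ β β' : ℝ → X → ℝ, IsBarrier μ T Λ u u' t₀ β β' →
    ∀ r, Λ * ∫ x, max (β t x - u t x) 0 ^ 3 ∂μ < r →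
      ∃ᶠ s in 𝓝[>] t, (s - t)⁻¹ * ((∫ x, max (β s x - u s x) 0 ^ 3 ∂μ) -
        ∫ x, max (β t x - u t x) 0 ^ 3 ∂μ) < r

theorem IsBarrier.le_of_isDiniTime (hu0 : ∀ t ∈ Icc 0 T, ∀ x, 0 ≤ u t x)
    (huc : ∀ t ∈ Icc 0 T, Continuous (u t))
    (hut : ∀ x, ContinuousOn (fun t => u t x) (Icc 0 T)) {t₀ : ℝ} (ht₀ : 0 ≤ t₀)
    {β β' : ℝ → X → ℝ} (hβ : IsBarrier μ T Λ u u' t₀ β β') (hle : ∀ x, β t₀ x ≤ u t₀ x)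
    {s : ℝ} (hs : s ∈ Icc t₀ T) (hD : ∀ t ∈ Ioo t₀ s, IsDiniTime μ T Λ u u' t) (x : X) :
    β s x ≤ u s x := by
  rcases hs.1.eq_or_lt with rfl | hlt
  · exact hle x
  refine hβ.full s hs ?_ x
  set J : ℝ → ℝ := fun t => ∫ x, max (β t x - u t x) 0 ^ 3 ∂μ with hJ
  have hsub : Icc t₀ T ⊆ Icc 0 T := Icc_subset_Icc_left ht₀
  have hcont : ContinuousOn J (Icc t₀ T) := hβ.continuousOn (fun t ht => hu0 t (hsub ht))
    (fun t ht => huc t (hsub ht)) fun x => (hut x).mono hsub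
  have h0 : J t₀ = 0 := by
    simp only [hJ]
    rw [integral_eq_zero_of_ae]
    refine Eventually.of_forall fun x => ?_
    simp [max_eq_right (sub_nonpos.2 (hle x))]
  have hgr : ∀ a ∈ Ioo t₀ s, J s ≤ J a * Real.exp (Λ * (s - a)) := by
    intro a ha
    have h1 := le_gronwallBound_of_liminf_deriv_right_le (f := J) (f' := fun t => Λ * J t)
      (δ := J a) (K := Λ) (ε := 0) (a := a) (b := s)
      (hcont.mono (Icc_subset_Icc ha.1.le hs.2)) ?_ le_rfl (fun t _ => by simp) s
      (right_mem_Icc.2 ha.2.le)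
    · rwa [gronwallBound_ε0] at h1
    · intro t ht r hr
      exact hD t ⟨ha.1.trans_le ht.1, ht.2⟩ t₀ ⟨ht₀, (ha.1.trans_le ht.1).le⟩ β β' hβ r hr
  have hlim : Tendsto (fun a => J a * Real.exp (Λ * (s - a))) (𝓝[>] t₀)
      (𝓝 (J t₀ * Real.exp (Λ * (s - t₀)))) := by
    refine Tendsto.mul ?_ ?_
    · have := hcont t₀ ⟨le_rfl, hs.1.trans hs.2⟩
      refine (this.mono_left ?_)
      rw [← nhdsWithin_Ioc_eq_nhdsGT (hlt.trans_le hs.2)]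
      exact nhdsWithin_mono _ Ioc_subset_Icc_self
    · exact ((by fun_prop : Continuous fun a => Real.exp (Λ * (s - a))).tendsto t₀).mono_left
        nhdsWithin_le_nhds
  rw [h0, zero_mul] at hlim
  have h2 : J s ≤ 0 := ge_of_tendsto hlim
    (by filter_upwards [Ioo_mem_nhdsGT hlt] with a ha using hgr a ha)
  exact le_antisymm h2 (integral_nonneg fun x => pow_nonneg (le_max_right _ _) _)

/-- Comparison principle: if, on closed sets of times covering `[0, T]`, the function `u` admits
barriers which are uniformly Lipschitz from below, then every barrier stays below `u`. No
regularity of the time derivative of `u` is needed. -/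
theorem IsBarrier.le_of_cover (hu0 : ∀ t ∈ Icc 0 T, ∀ x, 0 ≤ u t x)
    (huc : ∀ t ∈ Icc 0 T, Continuous (u t))
    (hud : ∀ t ∈ Icc 0 T, ∀ x, HasDerivAt (fun s => u s x) (u' t x) t)
    (hub : ∀ t ∈ Icc 0 T, ∃ K, ∀ x, |u' t x| ≤ K)
    {D : ℕ → Set ℝ} (hDc : ∀ n, IsClosed (D n)) (hcov : Icc 0 T ⊆ ⋃ n, D n) {C : ℕ → ℝ}
    (hD : ∀ n, ∀ m ∈ D n, m ∈ Icc 0 T → (∀ x, -C n ≤ u' m x) ∧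
      ∃ β β' : ℝ → X → ℝ, IsBarrier μ T Λ u u' m β β' ∧ β m = u m ∧
        ∀ t ∈ Icc m T, ∀ x, u m x - C n * (t - m) ≤ β t x)
    {t₀ : ℝ} (ht₀ : 0 ≤ t₀) {β β' : ℝ → X → ℝ} (hβ : IsBarrier μ T Λ u u' t₀ β β')
    (hle : ∀ x, β t₀ x ≤ u t₀ x) {s : ℝ} (hs : s ∈ Icc t₀ T) (x : X) : β s x ≤ u s x := by
  have hut : ∀ x, ContinuousOn (fun t => u t x) (Icc 0 T) := fun x t ht =>
    (hud t ht x).continuousAt.continuousWithinAt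
  suffices hall : ∀ t ∈ Ico 0 T, IsDiniTime μ T Λ u u' t from
    hβ.le_of_isDiniTime hu0 huc hut ht₀ hle hs
      (fun t ht => hall t ⟨ht₀.trans ht.1.le, ht.2.trans_le hs.2⟩) x
  by_contra! hcon
  set B : Set ℝ := {t | t ∈ Ico 0 T ∧ ¬ IsDiniTime μ T Λ u u' t} with hB
  set P := closure B with hP
  have hPcl : IsClosed P := isClosed_closure
  have hPsub : P ⊆ Icc 0 T := closure_minimal (fun t ht => ⟨ht.1.1, ht.1.2.le⟩) isClosed_Icc
  have hBne : B.Nonempty := by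
    obtain ⟨t, ht, hn⟩ := hcon
    exact ⟨t, ht, hn⟩
  have : Nonempty P := hBne.closure.to_subtype
  have : CompleteSpace P := hPcl.completeSpace_coe
  obtain ⟨n, p, hp⟩ := nonempty_interior_of_iUnion_of_closed
    (f := fun n => (Subtype.val : P → ℝ) ⁻¹' D n)
    (fun n => (hDc n).preimage continuous_subtype_val)
    (by
      refine eq_univ_of_forall fun q => ?_
      obtain ⟨n, hn⟩ := mem_iUnion.1 (hcov (hPsub q.2))
      exact mem_iUnion.2 ⟨n, hn⟩)
  rw [mem_interior_iff_mem_nhds, mem_nhds_subtype] at hp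
  obtain ⟨W, hW, hWD⟩ := hp
  obtain ⟨I, hIW, hIo, hpI⟩ := mem_nhds_iff.1 hW
  obtain ⟨b, hbI, hbB⟩ := mem_closure_iff.1 p.2 I hIo hpI
  have hID : ∀ q ∈ P, q ∈ I → q ∈ D n := fun q hq hqI => hWD (a := ⟨q, hq⟩) (hIW hqI)
  obtain ⟨ε, hε, hball⟩ := Metric.isOpen_iff.1 hIo b hbI
  refine hbB.2 fun t₀ ht₀ β β' hβ r hr => ?_
  have hsub : Icc t₀ T ⊆ Icc 0 T := Icc_subset_Icc_left ht₀.1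
  have hbT : b ∈ Icc 0 T := ⟨hbB.1.1, hbB.1.2.le⟩
  refine (hβ.eventually_slope_lt (t₁ := b + ε) (C := C n + 1) (fun t ht => hu0 t (hsub ht))
    (fun t ht => huc t (hsub ht)) ⟨ht₀.2, hbB.1.2⟩ (by linarith) (hud b hbT) (hub b hbT)
    ?_ hr).frequently
  clear hr r hβ β β' hs s hle x
  intro s hs hsT x
  have hIcc : ∀ q ∈ Icc b s, q ∈ I := fun q hq => hball (by
    rw [Metric.mem_ball, Real.dist_eq, abs_of_nonneg (sub_nonneg.2 hq.1)]
    linarith [hq.2, hs.2])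
  have hsub' : Icc b s ⊆ Icc 0 T := Icc_subset_Icc hbT.1 hsT
  have hgap : ∀ m ∈ P ∩ Icc b s, ∀ q ∈ Icc m s, (∀ t ∈ Ioo m q, t ∉ P) →
      u m x - C n * (q - m) ≤ u q x := by
    intro m hm q hq hmq
    obtain ⟨-, β, β', hβ, hβm, hβl⟩ := hD n m (hID m hm.1 (hIcc m hm.2)) (hPsub hm.1)
    refine (hβl q ⟨hq.1, hq.2.trans hsT⟩ x).trans ?_
    refine hβ.le_of_isDiniTime hu0 huc hut (hPsub hm.1).1 (fun x => by rw [hβm])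
      ⟨hq.1, hq.2.trans hsT⟩ (fun t ht => ?_) x
    by_contra hnt
    exact hmq t ht (subset_closure
      ⟨⟨(hPsub hm.1).1.trans ht.1.le, ht.2.trans_le (hq.2.trans hsT)⟩, hnt⟩)
  set S : Set ℝ := P ∩ {m ∈ Icc b s | u b x - (C n + 1) * (m - b) ≤ u m x} with hS
  have hScl : IsClosed S := by
    refine hPcl.inter ?_
    refine isClosed_Icc.isClosed_le (f := fun m => u b x - (C n + 1) * (m - b))
      (g := fun m => u m x) (by fun_prop) ((hut x).mono hsub')
  have hScomp : IsCompact S := isCompact_Icc.of_isClosed_subset hScl fun m hm => hm.2.1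
  have hbs : b ≤ s := hs.1.le
  obtain ⟨m, hmS, hmax⟩ := hScomp.exists_isGreatest
    ⟨b, subset_closure hbB, ⟨le_rfl, hbs⟩, by simp⟩
  have hmI : m ∈ Icc b s := hmS.2.1
  by_contra! hcontra
  have hms : m < s := by
    refine hmI.2.lt_of_ne ?_
    rintro rfl
    exact absurd hmS.2.2 (not_le.2 hcontra)
  have hstep : ∀ q ∈ P, q ∈ Ioc m s → ¬ (u m x - (C n + 1) * (q - m) ≤ u q x) := by
    intro q hq hqI hle
    have : q ∈ S := ⟨hq, ⟨hmI.1.trans hqI.1.le, hqI.2⟩, by linarith [hmS.2.2]⟩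
    exact absurd (hmax this) (not_le.2 hqI.1)
  have hder : ∀ᶠ q in 𝓝[>] m, u m x - (C n + 1) * (q - m) ≤ u q x := by
    have h1 := (hud m (hsub' hmI) x).hasDerivWithinAt (s := Ioi m)
    have h2 := (hasDerivWithinAt_iff_tendsto_slope' (notMem_Ioi.2 le_rfl)).1 h1
    have h3 : -(C n + 1) < u' m x := by
      linarith [(hD n m (hID m hmS.1 (hIcc m hmI)) (hsub' hmI)).1 x]
    filter_upwards [h2.eventually_const_lt h3, self_mem_nhdsWithin] with q hq hqm
    rw [slope_def_field, lt_div_iff₀ (sub_pos.2 hqm)] at hq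
    linarith
  obtain ⟨η, hη, hηsub⟩ := (mem_nhdsGT_iff_exists_Ioo_subset).1 hder
  by_cases hemp : ∀ t ∈ Ioo m s, t ∉ P
  · have := hgap m ⟨hmS.1, hmI⟩ s ⟨hms.le, le_rfl⟩ hemp
    linarith [hmS.2.2]
  · push Not at hemp
    obtain ⟨q, hqI, hqP⟩ := hemp
    have hQ : IsCompact (P ∩ Icc η s) := isCompact_Icc.inter_left hPcl
    have hη' : ∀ t ∈ P, t ∈ Ioc m s → η ≤ t := fun t htP ht => by
      by_contra! hlt
      exact hstep t htP ht (hηsub ⟨ht.1, hlt⟩)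
    obtain ⟨k, hk, hkmin⟩ := hQ.exists_isLeast
      ⟨q, hqP, hη' q hqP ⟨hqI.1, hqI.2.le⟩, hqI.2.le⟩
    have hmk : m < k := hη.trans_le hk.2.1
    refine hstep k hk.1 ⟨hmk, hk.2.2⟩ ?_
    have := hgap m ⟨hmS.1, hmI⟩ k ⟨hmk.le, hk.2.2⟩ fun t ht htP =>
      absurd (hkmin ⟨htP, hη' t htP ⟨ht.1, ht.2.le.trans hk.2.2⟩, ht.2.le.trans hk.2.2⟩)
        (not_le.2 ht.2)
    linarith

end BaireComparison

/-- The mean value theorem for iterated forward differences. -/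
theorem exists_fwdDiff_iter_eq {g : ℝ → ℝ} {n : ℕ} (hg : ContDiff ℝ n g) {h : ℝ} (hh : 0 < h)
    (x : ℝ) : ∃ ξ ∈ Icc x (x + n * h), (fwdDiff h)^[n] g x = h ^ n * iteratedDeriv n g ξ := by
  induction n generalizing g with
  | zero => exact ⟨x, by simp, by simp⟩
  | succ n ih =>
    have hg' : ContDiff ℝ n (fwdDiff h g) := by
      have h1 : ContDiff ℝ n g := hg.of_le (by exact_mod_cast Nat.le_succ n)
      exact (h1.comp (contDiff_id.add contDiff_const)).sub h1
    obtain ⟨ξ, hξ, hξe⟩ := ih hg'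
    have hn : ContDiff ℝ n g := hg.of_le (by exact_mod_cast Nat.le_succ n)
    have h2 : iteratedDeriv n (fwdDiff h g) ξ =
        iteratedDeriv n g (ξ + h) - iteratedDeriv n g ξ := by
      have : fwdDiff h g = (fun z => g (z + h)) - g := rfl
      have hs : ContDiff ℝ n (fun z => g (z + h)) := hn.comp (contDiff_id.add contDiff_const)
      rw [this, iteratedDeriv_sub hs.contDiffAt hn.contDiffAt, iteratedDeriv_comp_add_const]
    have hd : Differentiable ℝ (iteratedDeriv n g) :=
      hg.differentiable_iteratedDeriv n (by exact_mod_cast Nat.lt_succ_self n)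
    obtain ⟨ζ, hζ, hζe⟩ := exists_deriv_eq_slope (iteratedDeriv n g) (a := ξ) (b := ξ + h)
      (by linarith) hd.continuous.continuousOn hd.differentiableOn
    refine ⟨ζ, ⟨hξ.1.trans hζ.1.le, hζ.2.le.trans ?_⟩, ?_⟩
    · push_cast
      linarith [hξ.2]
    · rw [Function.iterate_succ_apply, hξe, h2, iteratedDeriv_succ, hζe, add_sub_cancel_left,
        pow_succ, mul_assoc, mul_div_cancel₀ _ hh.ne']

theorem abs_iteratedDeriv_le_of_fwdDiff {g : ℝ → ℝ} {n : ℕ} (hg : ContDiff ℝ n g) {C : ℝ} {x : ℝ}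
    (hC : ∀ h > 0, |(fwdDiff h)^[n] g x| ≤ C * h ^ n) : |iteratedDeriv n g x| ≤ C := by
  have hc : Continuous (iteratedDeriv n g) := hg.continuous_iteratedDeriv n le_rfl
  choose! ξ hξ hξe using fun (h : ℝ) (hh : 0 < h) => exists_fwdDiff_iter_eq hg hh x
  have hlim : Tendsto ξ (𝓝[>] 0) (𝓝 x) := by
    refine tendsto_of_tendsto_of_tendsto_of_le_of_le' (g := fun _ => x)
      (h := fun h => x + n * h) tendsto_const_nhds ?_ ?_ ?_
    · refine ((by fun_prop : Continuous fun h : ℝ => x + n * h).tendsto' 0 x (by simp)).mono_left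
        nhdsWithin_le_nhds
    · filter_upwards [self_mem_nhdsWithin] with h hh using (hξ h hh).1
    · filter_upwards [self_mem_nhdsWithin] with h hh using (hξ h hh).2
  refine le_of_tendsto ((hc.tendsto x).comp hlim).abs ?_
  filter_upwards [self_mem_nhdsWithin] with h hh
  have hh' : 0 < h := hh
  have h1 := hC h hh
  rw [hξe h hh, abs_mul, abs_of_pos (pow_pos hh' n), mul_comm] at h1
  exact le_of_mul_le_mul_right h1 (pow_pos hh' n)

/-- Periodicity of a function with respect to a set of periods. -/
def HasPeriods {W : Type*} [Add W] (Γ : Set W) {β : Type*} (g : W → β) : Prop :=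
  ∀ γ ∈ Γ, ∀ x, g (x + γ) = g x

theorem HasPeriods.comp {W : Type*} [Add W] {Γ : Set W} {β γ : Type*} {g : W → β} (hg : HasPeriods Γ g) (k : β → γ) :
    HasPeriods Γ (fun x => k (g x)) := fun c hc x => congrArg k (hg c hc x)

theorem HasPeriods.comp₂ {W : Type*} [Add W] {Γ : Set W} {α β γ : Type*} {g : W → α} {h : W → β}
    (hg : HasPeriods Γ g) (hh : HasPeriods Γ h) (k : α → β → γ) :
    HasPeriods Γ (fun x => k (g x) (h x)) := fun c hc x => by
  simp only [hg c hc x, hh c hc x]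

section Periods

variable {W : Type*} [NormedAddCommGroup W] [NormedSpace ℝ W] {ι : Type*}

theorem HasPeriods.fderiv {Γ : Set W} {g : W → ℝ} (hg : HasPeriods Γ g) :
    HasPeriods Γ (fderiv ℝ g) := by
  intro γ hγ x
  rw [← fderiv_comp_add_right]
  congr 1
  funext y
  exact hg γ hγ y

theorem HasPeriods.fderiv_apply {Γ : Set W} {g : W → ℝ} (hg : HasPeriods Γ g) (v : W) :
    HasPeriods Γ (fun x => _root_.fderiv ℝ g x v) := fun γ hγ x => by
  simp only [hg.fderiv γ hγ x]

/-- A finite measure `μ` that behaves as the restriction of Lebesgue measure to a period cell of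
the set of periods `Γ`, with integration by parts in the directions `v i`. -/
structure IsPeriodCell [MeasurableSpace W] (μ : Measure W) (Γ : Set W) (v : ι → W) : Prop where
  ibp : ∀ g : W → ℝ, ContDiff ℝ 1 g → HasPeriods Γ g → ∀ i, ∫ x, fderiv ℝ g x (v i) ∂μ = 0
  bdd : ∀ g : W → ℝ, Continuous g → HasPeriods Γ g → ∃ K, ∀ x, |g x| ≤ K
  full : ∀ g : W → ℝ, Continuous g → HasPeriods Γ g → (∀ x, 0 ≤ g x) → ∫ x, g x ∂μ = 0 →
    ∀ x, g x = 0

theorem IsPeriodCell.integrable [MeasurableSpace W] [BorelSpace W] {μ : Measure W}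
    [IsFiniteMeasure μ] {Γ : Set W} {v : ι → W} (hc : IsPeriodCell μ Γ v) {g : W → ℝ} (hg : Continuous g)
    (hp : HasPeriods Γ g) [SecondCountableTopology W] : Integrable g μ := by
  obtain ⟨K, hK⟩ := hc.bdd g hg hp
  exact Integrable.of_bound (C := K) hg.aestronglyMeasurable (Eventually.of_forall hK)

variable [Fintype ι]

/-- The operator `ν ∑ ∂ᵢ∂ᵢ + ∑ bᵢ ∂ᵢ + q`, with `∂ᵢ` the derivative along `v i`. -/
def linOp (v : ι → W) (ν : ℝ) (b : ι → W → ℝ) (q : W → ℝ) (g : W → ℝ) (x : W) : ℝ :=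
  ν * ∑ i, fderiv ℝ (fun y => fderiv ℝ g y (v i)) x (v i) + ∑ i, b i x * fderiv ℝ g x (v i) +
    q x * g x

/-- Positive periodic solutions of a linear (degenerate) parabolic equation with bounded
coefficients. No regularity in time beyond pointwise differentiability is required. -/
structure IsLinSol [MeasurableSpace W] (μ : Measure W) (Γ : Set W) (v : ι → W) (T ν Λ : ℝ)
    (b : ℝ → ι → W → ℝ) (q u : ℝ → W → ℝ) : Prop where
  cell : IsPeriodCell μ Γ v
  nu : 0 ≤ ν
  lam : 0 ≤ Λ
  smooth : ∀ t ∈ Icc 0 T, ContDiff ℝ 2 (u t)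
  pos : ∀ t ∈ Icc 0 T, ∀ x, 0 < u t x
  per : ∀ t ∈ Icc 0 T, HasPeriods Γ (u t)
  smooth_b : ∀ t ∈ Icc 0 T, ∀ i, ContDiff ℝ 1 (b t i)
  per_b : ∀ t ∈ Icc 0 T, ∀ i, HasPeriods Γ (b t i)
  b_le : ∀ t ∈ Icc 0 T, ∀ i x, |b t i x| ≤ Λ
  div_le : ∀ t ∈ Icc 0 T, ∀ x, |∑ i, fderiv ℝ (b t i) x (v i)| ≤ Λ
  cont_q : ∀ t ∈ Icc 0 T, Continuous (q t)
  per_q : ∀ t ∈ Icc 0 T, HasPeriods Γ (q t)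
  q_le : ∀ t ∈ Icc 0 T, ∀ x, |q t x| ≤ Λ
  deriv : ∀ t ∈ Icc 0 T, ∀ x, HasDerivAt (fun s => u s x) (linOp v ν (b t) (q t) (u t) x) t

/-- Classical periodic subsolutions on `[t₀, T]`. -/
structure IsSubsol (Γ : Set W) (v : ι → W) (T ν : ℝ)
    (b : ℝ → ι → W → ℝ) (q : ℝ → W → ℝ) (t₀ : ℝ) (β β' : ℝ → W → ℝ) : Prop where
  smooth : ∀ t ∈ Icc t₀ T, ContDiff ℝ 2 (β t)
  per : ∀ t ∈ Icc t₀ T, HasPeriods Γ (β t)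
  cont' : ∀ t ∈ Ico t₀ T, Continuous (β' t)
  per' : ∀ t ∈ Ico t₀ T, HasPeriods Γ (β' t)
  deriv : ∀ t ∈ Ico t₀ T, ∀ x, HasDerivWithinAt (fun s => β s x) (β' t x) (Ioi t) t
  lip : ∃ K, ∀ s ∈ Icc t₀ T, ∀ t ∈ Icc t₀ T, ∀ x, |β s x - β t x| ≤ K * |s - t|
  sub : ∀ t ∈ Ico t₀ T, ∀ x, β' t x ≤ linOp v ν (b t) (q t) (β t) x

theorem contDiff_max_zero_pow (n : ℕ) : ContDiff ℝ 1 (fun y : ℝ => max y 0 ^ (n + 2)) := by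
  rw [contDiff_one_iff_deriv]
  refine ⟨fun x => (hasDerivAt_max_zero_pow n x).differentiableAt, ?_⟩
  rw [funext fun x => (hasDerivAt_max_zero_pow n x).deriv]
  fun_prop

theorem continuous_fderiv_apply_const {g : W → ℝ} {n : WithTop ℕ∞} (hg : ContDiff ℝ n g)
    (hn : 1 ≤ n) (v : W) : Continuous fun x => fderiv ℝ g x v :=
  (hg.continuous_fderiv (by positivity)).clm_apply continuous_const

theorem contDiff_fderiv_apply_const {g : W → ℝ} {n : WithTop ℕ∞} (hg : ContDiff ℝ (n + 1) g)
    (v : W) : ContDiff ℝ n fun x => fderiv ℝ g x v :=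
  (hg.fderiv_right le_rfl).clm_apply contDiff_const

theorem linOp_sub {v : ι → W} {ν : ℝ} {b : ι → W → ℝ} {q g₁ g₂ : W → ℝ} (h₁ : ContDiff ℝ 2 g₁)
    (h₂ : ContDiff ℝ 2 g₂) (x : W) :
    linOp v ν b q (fun y => g₁ y - g₂ y) x = linOp v ν b q g₁ x - linOp v ν b q g₂ x := by
  have e1 : ∀ y i, fderiv ℝ (fun y => g₁ y - g₂ y) y (v i) =
      fderiv ℝ g₁ y (v i) - fderiv ℝ g₂ y (v i) := fun y i => by
    rw [fderiv_fun_sub (h₁.differentiable (by norm_num) y) (h₂.differentiable (by norm_num) y)]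
    rfl
  have e2 : ∀ i, fderiv ℝ (fun y => fderiv ℝ (fun y => g₁ y - g₂ y) y (v i)) x (v i) =
      fderiv ℝ (fun y => fderiv ℝ g₁ y (v i)) x (v i) -
      fderiv ℝ (fun y => fderiv ℝ g₂ y (v i)) x (v i) := fun i => by
    simp only [e1]
    have d1 := (contDiff_fderiv_apply_const (n := 1) h₁ (v i)).differentiable (by norm_num) x
    have d2 := (contDiff_fderiv_apply_const (n := 1) h₂ (v i)).differentiable (by norm_num) x
    rw [fderiv_fun_sub d1 d2]
    rfl
  unfold linOp
  simp only [e2]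
  simp only [e1, mul_sub, Finset.sum_sub_distrib]
  ring

theorem linOp_const_mul {v : ι → W} {ν : ℝ} {b : ι → W → ℝ} {q g : W → ℝ} (c : ℝ) (x : W) :
    linOp v ν b q (fun y => c * g y) x = c * linOp v ν b q g x := by
  have e0 : ∀ (k : W → ℝ) y, fderiv ℝ (fun y => c * k y) y = c • fderiv ℝ k y := fun k y =>
    congrFun (fderiv_const_smul_field (𝕜 := ℝ) (f := k) c) y
  unfold linOp
  simp only [e0, _root_.smul_apply, smul_eq_mul]
  simp only [mul_left_comm _ c, ← Finset.mul_sum]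
  ring

theorem continuous_linOp {v : ι → W} {ν : ℝ} {b : ι → W → ℝ} {q g : W → ℝ} (hg : ContDiff ℝ 2 g)
    (hb : ∀ i, Continuous (b i)) (hq : Continuous q) : Continuous (linOp v ν b q g) := by
  unfold linOp
  refine ((continuous_const.mul (continuous_finsetSum _ fun i _ => ?_)).add
    (continuous_finsetSum _ fun i _ => ?_)).add (hq.mul hg.continuous)
  · exact continuous_fderiv_apply_const (n := 1) (contDiff_fderiv_apply_const hg (v i)) le_rfl _
  · exact (hb i).mul (continuous_fderiv_apply_const hg (by norm_num) _)

theorem HasPeriods.linOp {Γ : Set W} {v : ι → W} {ν : ℝ} {b : ι → W → ℝ} {q g : W → ℝ}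
    (hg : HasPeriods Γ g) (hb : ∀ i, HasPeriods Γ (b i)) (hq : HasPeriods Γ q) :
    HasPeriods Γ (linOp v ν b q g) := fun γ hγ x => by
  unfold _root_.linOp
  rw [hg γ hγ, hq γ hγ]
  congr 2
  · congr 1
    exact Finset.sum_congr rfl fun i _ => (hg.fderiv_apply (v i)).fderiv_apply (v i) γ hγ x
  · exact Finset.sum_congr rfl fun i _ => by rw [hb i γ hγ, hg.fderiv γ hγ x]

/-- The pointwise identity behind the energy estimate for the cube of the positive part. -/
theorem three_mul_max_sq_mul_linOp_le {v : ι → W} {ν Λ : ℝ} (hν : 0 ≤ ν) {b : ι → W → ℝ}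
    {q w : W → ℝ} (hw : ContDiff ℝ 2 w) (hb : ∀ i, ContDiff ℝ 1 (b i)) (x : W)
    (hdiv : |∑ i, fderiv ℝ (b i) x (v i)| ≤ Λ) (hq : |q x| ≤ Λ) :
    3 * max (w x) 0 ^ 2 * linOp v ν b q w x ≤
      ∑ i, fderiv ℝ (fun y => 3 * ν * (max (w y) 0 ^ 2 * fderiv ℝ w y (v i)) +
        max (w y) 0 ^ 3 * b i y) x (v i) + 4 * Λ * max (w x) 0 ^ 3 := by
  have hwd : HasFDerivAt w (fderiv ℝ w x) x := (hw.differentiable (by norm_num) x).hasFDerivAt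
  have h2 : HasFDerivAt (fun y => max (w y) 0 ^ 2) ((2 * max (w x) 0) • fderiv ℝ w x) x := by
    have := (hasDerivAt_max_zero_pow 0 (w x)).comp_hasFDerivAt x hwd
    norm_num at this
    exact this
  have h3 : HasFDerivAt (fun y => max (w y) 0 ^ 3) ((3 * max (w x) 0 ^ 2) • fderiv ℝ w x) x := by
    have := (hasDerivAt_max_zero_pow 1 (w x)).comp_hasFDerivAt x hwd
    norm_num at this
    exact this
  have hG : ∀ i, fderiv ℝ (fun y => 3 * ν * (max (w y) 0 ^ 2 * fderiv ℝ w y (v i)) +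
        max (w y) 0 ^ 3 * b i y) x (v i) =
      3 * ν * (max (w x) 0 ^ 2 * fderiv ℝ (fun y => fderiv ℝ w y (v i)) x (v i) +
        2 * max (w x) 0 * fderiv ℝ w x (v i) ^ 2) +
      (max (w x) 0 ^ 3 * fderiv ℝ (b i) x (v i) +
        b i x * (3 * max (w x) 0 ^ 2 * fderiv ℝ w x (v i))) := fun i => by
    have d1 := ((contDiff_fderiv_apply_const (n := 1) hw (v i)).differentiable
      (by norm_num) x).hasFDerivAt
    have d2 := ((hb i).differentiable (by norm_num) x).hasFDerivAt
    have := (((h2.mul d1).const_mul (3 * ν)).add (h3.mul d2)).fderiv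
    have h5 := congrArg (fun L : W →L[ℝ] ℝ => L (v i)) this
    refine Eq.trans ?_ (h5.trans ?_)
    · rfl
    · simp
      ring
  simp only [hG]
  have hm : 0 ≤ max (w x) 0 := le_max_right _ _
  have hmw : max (w x) 0 ^ 2 * w x = max (w x) 0 ^ 3 := by
    rcases le_total (w x) 0 with h | h
    · simp [max_eq_right h]
    · rw [max_eq_left h]; ring
  have e1 : ∑ i, (3 * ν * (max (w x) 0 ^ 2 * fderiv ℝ (fun y => fderiv ℝ w y (v i)) x (v i) +
        2 * max (w x) 0 * fderiv ℝ w x (v i) ^ 2) +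
      (max (w x) 0 ^ 3 * fderiv ℝ (b i) x (v i) +
        b i x * (3 * max (w x) 0 ^ 2 * fderiv ℝ w x (v i)))) =
      3 * max (w x) 0 ^ 2 * (ν * ∑ i, fderiv ℝ (fun y => fderiv ℝ w y (v i)) x (v i) +
        ∑ i, b i x * fderiv ℝ w x (v i)) +
      6 * ν * max (w x) 0 * ∑ i, fderiv ℝ w x (v i) ^ 2 +
      max (w x) 0 ^ 3 * ∑ i, fderiv ℝ (b i) x (v i) := by
    simp only [Finset.mul_sum, ← Finset.sum_add_distrib]
    exact Finset.sum_congr rfl fun i _ => by ring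
  rw [e1]
  unfold linOp
  have hsq : 0 ≤ 6 * ν * max (w x) 0 * ∑ i, fderiv ℝ w x (v i) ^ 2 := by
    have : 0 ≤ ∑ i, fderiv ℝ w x (v i) ^ 2 := Finset.sum_nonneg fun i _ => sq_nonneg _
    positivity
  have hm3 : 0 ≤ max (w x) 0 ^ 3 := by positivity
  have e2 : 3 * max (w x) 0 ^ 2 * (q x * w x) = 3 * q x * max (w x) 0 ^ 3 := by
    rw [← hmw]; ring
  have h6 := mul_le_mul_of_nonneg_right (le_of_abs_le hq) hm3
  have h7 := mul_le_mul_of_nonneg_right (neg_le_of_abs_le hdiv) hm3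
  rw [mul_add _ _ (q x * w x), e2]
  nlinarith [h6, h7, hsq]

section Comparison

variable [MeasurableSpace W] [BorelSpace W] {μ : Measure W} [IsFiniteMeasure μ] {Γ : Set W}
  {v : ι → W} {T ν Λ : ℝ} {b : ℝ → ι → W → ℝ} {q u : ℝ → W → ℝ}

theorem IsSubsol.isBarrier [SecondCountableTopology W] (hu : IsLinSol μ Γ v T ν Λ b q u) {t₀ : ℝ}
    (ht₀ : 0 ≤ t₀) {β β' : ℝ → W → ℝ} (hβ : IsSubsol Γ v T ν b q t₀ β β') :
    IsBarrier μ T (4 * Λ) u (fun t => linOp v ν (b t) (q t) (u t)) t₀ β β' := by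
  have hsub : Icc t₀ T ⊆ Icc 0 T := Icc_subset_Icc_left ht₀
  have hsub' : Ico t₀ T ⊆ Icc t₀ T := Ico_subset_Icc_self
  refine ⟨fun t ht => (hβ.smooth t ht).continuous, hβ.deriv, hβ.lip, ?_, ?_, ?_, ?_⟩
  · rcases lt_or_ge T t₀ with h | h
    · exact ⟨0, fun t ht => absurd (ht.1.trans ht.2) (not_le.2 h)⟩
    obtain ⟨L, hL⟩ := hβ.lip
    have h0 : t₀ ∈ Icc t₀ T := ⟨le_rfl, h⟩
    obtain ⟨K, hK⟩ := hu.cell.bdd (β t₀) (hβ.smooth t₀ h0).continuous (hβ.per t₀ h0)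
    refine ⟨|L| * (T - t₀) + K, fun t ht x => ?_⟩
    have h1 := hL t ht t₀ h0 x
    have h2 : L * |t - t₀| ≤ |L| * (T - t₀) := by
      rw [abs_of_nonneg (sub_nonneg.2 ht.1)]
      exact mul_le_mul (le_abs_self _) (by linarith [ht.2]) (sub_nonneg.2 ht.1) (abs_nonneg _)
    have h3 : |β t x| ≤ |β t x - β t₀ x| + |β t₀ x| := by
      simpa using abs_add_le (β t x - β t₀ x) (β t₀ x)
    linarith [hK x]
  · exact fun t ht => hu.cell.bdd _ (hβ.cont' t ht) (hβ.per' t ht)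
  · intro t ht
    have ht' : t ∈ Icc 0 T := hsub (hsub' ht)
    have sβ := hβ.smooth t (hsub' ht)
    have su := hu.smooth t ht'
    have sw : ContDiff ℝ 2 (fun y => β t y - u t y) := sβ.sub su
    have pw : HasPeriods Γ (fun y => β t y - u t y) :=
      (hβ.per t (hsub' ht)).comp₂ (hu.per t ht') (· - ·)
    have cm : Continuous fun x => max (β t x - u t x) 0 := sw.continuous.max continuous_const
    have cL := continuous_linOp (v := v) (ν := ν) su
      (fun i => (hu.smooth_b t ht' i).continuous) (hu.cont_q t ht')
    have pL := HasPeriods.linOp (v := v) (ν := ν) (hu.per t ht') (hu.per_b t ht') (hu.per_q t ht')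
    set G : ι → W → ℝ := fun i y => 3 * ν * (max (β t y - u t y) 0 ^ 2 *
      fderiv ℝ (fun y => β t y - u t y) y (v i)) + max (β t y - u t y) 0 ^ 3 * b t i y with hG
    have sG : ∀ i, ContDiff ℝ 1 (G i) := fun i => by
      have s1 : ContDiff ℝ 1 (fun y => β t y - u t y) := sw.of_le (by norm_num)
      exact (contDiff_const.mul (((contDiff_max_zero_pow 0).comp s1).mul
        (contDiff_fderiv_apply_const sw (v i)))).add
        (((contDiff_max_zero_pow 1).comp s1).mul (hu.smooth_b t ht' i))
    have pG : ∀ i, HasPeriods Γ (G i) := fun i =>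
      (pw.comp₂ (pw.fderiv_apply (v i)) fun a c => 3 * ν * (max a 0 ^ 2 * c)).comp₂
        (pw.comp₂ (hu.per_b t ht' i) fun a c => max a 0 ^ 3 * c) (· + ·)
    have i3 : Integrable (fun x => max (β t x - u t x) 0 ^ 3) μ :=
      hu.cell.integrable (cm.pow 3) (pw.comp fun a => max a 0 ^ 3)
    have iG : ∀ i ∈ Finset.univ, Integrable (fun x => fderiv ℝ (G i) x (v i)) μ := fun i _ =>
      hu.cell.integrable (continuous_fderiv_apply_const (sG i) le_rfl _)
        ((pG i).fderiv_apply _)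
    calc ∫ x, 3 * max (β t x - u t x) 0 ^ 2 * (β' t x - linOp v ν (b t) (q t) (u t) x) ∂μ
        ≤ ∫ x, (∑ i, fderiv ℝ (G i) x (v i) + 4 * Λ * max (β t x - u t x) 0 ^ 3) ∂μ := by
          refine integral_mono (hu.cell.integrable ?_ ?_)
            ((integrable_finsetSum _ iG).add (i3.const_mul _)) fun x => ?_
          · exact (continuous_const.mul (cm.pow 2)).mul ((hβ.cont' t ht).sub cL)
          · exact pw.comp₂ ((hβ.per' t ht).comp₂ pL (· - ·)) fun a c => 3 * max a 0 ^ 2 * c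
          · refine le_trans ?_ (three_mul_max_sq_mul_linOp_le (v := v) hu.nu sw
              (hu.smooth_b t ht') x (hu.div_le t ht' x) (hu.q_le t ht' x))
            rw [linOp_sub sβ su]
            exact mul_le_mul_of_nonneg_left (by linarith [hβ.sub t ht x]) (by positivity)
      _ = 4 * Λ * ∫ x, max (β t x - u t x) 0 ^ 3 ∂μ := by
          rw [integral_add (integrable_finsetSum _ iG) (i3.const_mul _),
            integral_finsetSum _ iG, integral_const_mul,
            Finset.sum_eq_zero fun i _ => hu.cell.ibp (G i) (sG i) (pG i) i, zero_add]
  · intro t ht h0 x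
    have pw : HasPeriods Γ (fun y => β t y - u t y) :=
      (hβ.per t ht).comp₂ (hu.per t (hsub ht)) (· - ·)
    have cm : Continuous fun x => max (β t x - u t x) 0 :=
      ((hβ.smooth t ht).continuous.sub (hu.smooth t (hsub ht)).continuous).max continuous_const
    have := hu.cell.full _ (cm.pow 3) (pw.comp fun a => max a 0 ^ 3)
      (fun x => pow_nonneg (le_max_right _ _) _) h0 x
    have h1 : max (β t x - u t x) 0 = 0 := by simpa using this
    linarith [max_eq_right_iff.1 h1]

end Comparison

end Periods

section Periods

variable {W : Type*} [NormedAddCommGroup W] [NormedSpace ℝ W] {ι : Type*}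

theorem iteratedDeriv_succ_line {g : W → ℝ} (hg : Differentiable ℝ g) (n : ℕ) (x v : W) :
    iteratedDeriv (n + 1) (fun τ : ℝ => g (x + τ • v)) =
      iteratedDeriv n (fun τ : ℝ => fderiv ℝ g (x + τ • v) v) := by
  rw [iteratedDeriv_succ']
  congr 1
  funext τ
  have h1 : HasDerivAt (fun τ : ℝ => x + τ • v) v τ := by
    simpa using ((hasDerivAt_id τ).smul_const v).const_add x
  exact ((hg _).hasFDerivAt.comp_hasDerivAt τ h1).deriv

theorem contDiff_line {g : W → ℝ} {n : WithTop ℕ∞} (hg : ContDiff ℝ n g) (x v : W) :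
    ContDiff ℝ n (fun τ : ℝ => g (x + τ • v)) := by
  fun_prop

variable [Fintype ι] [MeasurableSpace W] {μ : Measure W} {Γ : Set W}
  {v : ι → W} {T ν Λ : ℝ} {b : ℝ → ι → W → ℝ} {q u : ℝ → W → ℝ}

/-- Times at which `u`, `1 / u` and the first two derivatives of `u` are bounded by `n + 1`. -/
def goodTimes (v : ι → W) (T : ℝ) (u : ℝ → W → ℝ) (n : ℕ) : Set ℝ :=
  {t | t ∈ Icc 0 T ∧ ∀ x, 1 / ((n : ℝ) + 1) ≤ u t x ∧ u t x ≤ n + 1 ∧ ∀ i, ∀ h > 0,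
    |u t (x + h • v i) - u t x| ≤ (n + 1) * h ∧
    |u t (x + (2 * h) • v i) - 2 * u t (x + h • v i) + u t x| ≤ (n + 1) * h ^ 2}

theorem fwdDiff_iter_one (h : ℝ) (g : ℝ → ℝ) (x : ℝ) :
    (fwdDiff h)^[1] g x = g (x + h) - g x := rfl

theorem fwdDiff_iter_two (h : ℝ) (g : ℝ → ℝ) (x : ℝ) :
    (fwdDiff h)^[2] g x = g (x + 2 * h) - 2 * g (x + h) + g x := by
  have : (fwdDiff h)^[2] g x = (g (x + h + h) - g (x + h)) - (g (x + h) - g x) := rfl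
  rw [this, add_assoc, ← two_mul]
  ring

theorem IsLinSol.isClosed_goodTimes (hu : IsLinSol μ Γ v T ν Λ b q u) (n : ℕ) :
    IsClosed (goodTimes v T u n) := by
  refine IsSeqClosed.isClosed fun s t hs hst => ?_
  have ht : t ∈ Icc 0 T := isClosed_Icc.isSeqClosed (fun k => (hs k).1) hst
  have hc : ∀ x, Tendsto (fun k => u (s k) x) atTop (𝓝 (u t x)) := fun x =>
    (hu.deriv t ht x).continuousAt.tendsto.comp hst
  refine ⟨ht, fun x => ⟨ge_of_tendsto' (hc x) fun k => ((hs k).2 x).1,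
    le_of_tendsto' (hc x) fun k => ((hs k).2 x).2.1, fun i h hh => ⟨?_, ?_⟩⟩⟩
  · exact le_of_tendsto' ((hc _).sub (hc _)).abs fun k => (((hs k).2 x).2.2 i h hh).1
  · exact le_of_tendsto' (((hc _).sub ((hc _).const_mul 2)).add (hc _)).abs
      fun k => (((hs k).2 x).2.2 i h hh).2

theorem IsLinSol.subset_iUnion_goodTimes (hu : IsLinSol μ Γ v T ν Λ b q u) :
    Icc 0 T ⊆ ⋃ n, goodTimes v T u n := by
  intro t ht
  have su := hu.smooth t ht
  have pu := hu.per t ht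
  obtain ⟨K₁, hK₁⟩ := hu.cell.bdd _ su.continuous pu
  obtain ⟨K₂, hK₂⟩ := hu.cell.bdd (fun x => (u t x)⁻¹)
    (su.continuous.inv₀ fun x => (hu.pos t ht x).ne') (pu.comp _)
  choose K₃ hK₃ using fun i => hu.cell.bdd (fun x => fderiv ℝ (u t) x (v i))
    (continuous_fderiv_apply_const su (by norm_num) _) (pu.fderiv_apply _)
  choose K₄ hK₄ using fun i => hu.cell.bdd
    (fun x => fderiv ℝ (fun y => fderiv ℝ (u t) y (v i)) x (v i))
    (continuous_fderiv_apply_const (n := 1) (contDiff_fderiv_apply_const su _) le_rfl _)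
    ((pu.fderiv_apply _).fderiv_apply _)
  obtain ⟨n, hn⟩ := exists_nat_ge (|K₁| + |K₂| + ∑ i, |K₃ i| + ∑ i, |K₄ i|)
  have h3 : ∀ i, |K₃ i| ≤ ∑ i, |K₃ i| := fun i =>
    Finset.single_le_sum (f := fun i => |K₃ i|) (fun i _ => abs_nonneg _) (Finset.mem_univ i)
  have h4 : ∀ i, |K₄ i| ≤ ∑ i, |K₄ i| := fun i =>
    Finset.single_le_sum (f := fun i => |K₄ i|) (fun i _ => abs_nonneg _) (Finset.mem_univ i)
  have s3 : 0 ≤ ∑ i, |K₃ i| := Finset.sum_nonneg fun i _ => abs_nonneg _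
  have s4 : 0 ≤ ∑ i, |K₄ i| := Finset.sum_nonneg fun i _ => abs_nonneg _
  have a1 := abs_nonneg K₁
  have a2 := abs_nonneg K₂
  refine mem_iUnion.2 ⟨n, ht, fun x => ⟨?_, ?_, fun i h hh => ⟨?_, ?_⟩⟩⟩
  · rw [one_div_le (by positivity) (hu.pos t ht x), one_div]
    linarith [le_abs_self (u t x)⁻¹, hK₂ x, le_abs_self K₂]
  · linarith [le_abs_self (u t x), hK₁ x, le_abs_self K₁]
  · obtain ⟨ξ, -, hξ⟩ := exists_fwdDiff_iter_eq (n := 1)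
      ((contDiff_line su x (v i)).of_le (by norm_num)) hh 0
    rw [fwdDiff_iter_one, iteratedDeriv_succ_line (su.differentiable (by norm_num))] at hξ
    simp only [zero_add, zero_smul, add_zero, pow_one, iteratedDeriv_zero] at hξ
    rw [hξ, abs_mul, abs_of_pos hh, mul_comm]
    refine mul_le_mul_of_nonneg_right ?_ hh.le
    linarith [hK₃ i (x + ξ • v i), h3 i, le_abs_self (K₃ i)]
  · obtain ⟨ξ, -, hξ⟩ := exists_fwdDiff_iter_eq (n := 2) (contDiff_line su x (v i)) hh 0
    rw [fwdDiff_iter_two, iteratedDeriv_succ_line (su.differentiable (by norm_num)),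
      iteratedDeriv_succ_line (g := fun y => fderiv ℝ (u t) y (v i))
        ((contDiff_fderiv_apply_const (n := 1) su _).differentiable (by norm_num))] at hξ
    simp only [zero_add, zero_smul, add_zero, iteratedDeriv_zero] at hξ
    rw [hξ, abs_mul, abs_of_pos (pow_pos hh 2), mul_comm]
    refine mul_le_mul_of_nonneg_right ?_ (pow_pos hh 2).le
    linarith [hK₄ i (x + ξ • v i), h4 i, le_abs_self (K₄ i)]

theorem IsLinSol.neg_le_linOp (hu : IsLinSol μ Γ v T ν Λ b q u) {n : ℕ} {m : ℝ}
    (hm : m ∈ goodTimes v T u n) {t : ℝ} (ht : t ∈ Icc 0 T) (x : W) :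
    -((ν * Fintype.card ι + Λ * Fintype.card ι + Λ) * (n + 1) ^ 2) * u m x ≤
      linOp v ν (b t) (q t) (u m) x := by
  have su := hu.smooth m hm.1
  have hn : (0 : ℝ) < n + 1 := by positivity
  have e1 : ∀ i, |fderiv ℝ (u m) x (v i)| ≤ n + 1 := fun i => by
    have := abs_iteratedDeriv_le_of_fwdDiff (n := 1) (C := n + 1) (x := 0)
      ((contDiff_line su x (v i)).of_le (by norm_num)) fun h hh => by
        rw [fwdDiff_iter_one]
        simpa using ((hm.2 x).2.2 i h hh).1
    rw [iteratedDeriv_succ_line (su.differentiable (by norm_num))] at this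
    simpa using this
  have e2 : ∀ i, |fderiv ℝ (fun y => fderiv ℝ (u m) y (v i)) x (v i)| ≤ n + 1 := fun i => by
    have := abs_iteratedDeriv_le_of_fwdDiff (n := 2) (C := n + 1) (x := 0)
      (contDiff_line su x (v i)) fun h hh => by
        rw [fwdDiff_iter_two]
        simpa using ((hm.2 x).2.2 i h hh).2
    rw [iteratedDeriv_succ_line (su.differentiable (by norm_num)),
      iteratedDeriv_succ_line (g := fun y => fderiv ℝ (u m) y (v i))
        ((contDiff_fderiv_apply_const (n := 1) su _).differentiable (by norm_num))] at this
    simpa using this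
  have s2 : |∑ i, fderiv ℝ (fun y => fderiv ℝ (u m) y (v i)) x (v i)| ≤
      Fintype.card ι * ((n : ℝ) + 1) := by
    refine (Finset.abs_sum_le_sum_abs _ _).trans ?_
    refine (Finset.sum_le_card_nsmul _ _ _ fun i _ => e2 i).trans ?_
    rw [Finset.card_univ, nsmul_eq_mul]
  have s1 : |∑ i, b t i x * fderiv ℝ (u m) x (v i)| ≤ Fintype.card ι * (Λ * ((n : ℝ) + 1)) := by
    refine (Finset.abs_sum_le_sum_abs _ _).trans ?_
    refine (Finset.sum_le_card_nsmul _ _ (Λ * ((n : ℝ) + 1)) fun i _ => ?_).trans ?_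
    · rw [abs_mul]
      exact mul_le_mul (hu.b_le t ht i x) (e1 i) (abs_nonneg _) hu.lam
    · simp
  have h0 := (hm.2 x).1
  have hun : 1 ≤ ((n : ℝ) + 1) * u m x := by
    rwa [div_le_iff₀' hn] at h0
  have hup := hu.pos m hm.1 x
  have s3 : -(Λ * ((n : ℝ) + 1)) ≤ q t x * u m x := by
    have h1 : |q t x * u m x| ≤ Λ * ((n : ℝ) + 1) := by
      rw [abs_mul, abs_of_pos hup]
      exact mul_le_mul (hu.q_le t ht x) (hm.2 x).2.1 hup.le hu.lam
    exact neg_le_of_abs_le h1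
  have h2 := mul_le_mul_of_nonneg_left (neg_le_of_abs_le s2) hu.nu
  have h1 := neg_le_of_abs_le s1
  have hA : 0 ≤ (ν * Fintype.card ι + Λ * Fintype.card ι + Λ) := by
    have := hu.nu
    have := hu.lam
    positivity
  have h4 : (ν * Fintype.card ι + Λ * Fintype.card ι + Λ) * (n + 1) ≤
      (ν * Fintype.card ι + Λ * Fintype.card ι + Λ) * (n + 1) ^ 2 * u m x := by
    have := mul_le_mul_of_nonneg_left hun (mul_nonneg hA hn.le)
    calc _ = (ν * Fintype.card ι + Λ * Fintype.card ι + Λ) * (n + 1) * 1 := by ring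
      _ ≤ _ := this
      _ = _ := by ring
  unfold linOp
  linarith

/-- The exponentially decaying barrier issued from a good time. -/
theorem IsLinSol.isSubsol_exp (hu : IsLinSol μ Γ v T ν Λ b q u) {n : ℕ} {m : ℝ}
    (hm : m ∈ goodTimes v T u n) {κ : ℝ}
    (hκ : κ = (ν * Fintype.card ι + Λ * Fintype.card ι + Λ) * (n + 1) ^ 2) :
    IsSubsol Γ v T ν b q m (fun t x => Real.exp (-κ * (t - m)) * u m x)
      (fun t x => Real.exp (-κ * (t - m)) * (-κ * u m x)) := by
  have su := hu.smooth m hm.1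
  have hκ0 : 0 ≤ κ := by
    have := hu.nu
    have := hu.lam
    rw [hκ]
    positivity
  have hder : ∀ t x, HasDerivAt (fun t => Real.exp (-κ * (t - m)) * u m x)
      (Real.exp (-κ * (t - m)) * (-κ * u m x)) t := fun t x => by
    have := (((((hasDerivAt_id t).sub_const m).const_mul (-κ))).exp).mul_const (u m x)
    refine this.congr_deriv ?_
    simp only [id]
    ring
  refine ⟨fun t _ => contDiff_const.mul su, fun t _ => (hu.per m hm.1).comp _,
    fun t _ => continuous_const.mul (continuous_const.mul su.continuous),
    fun t _ => (hu.per m hm.1).comp fun a => Real.exp (-κ * (t - m)) * (-κ * a),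
    fun t _ x => (hder t x).hasDerivWithinAt, ⟨κ * (n + 1), fun s hs t ht x => ?_⟩,
    fun t ht x => ?_⟩
  · have := (convex_Icc m T).norm_image_sub_le_of_norm_hasDerivWithin_le
      (f := fun t => Real.exp (-κ * (t - m)) * u m x) (C := κ * (n + 1))
      (fun r hr => (hder r x).hasDerivWithinAt) (fun r hr => ?_) ht hs
    · simpa [Real.norm_eq_abs] using this
    · have he : Real.exp (-κ * (r - m)) ≤ 1 := Real.exp_le_one_iff.2 (by
        have := mul_nonneg hκ0 (sub_nonneg.2 hr.1)
        linarith)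
      have hup := hu.pos m hm.1 x
      rw [Real.norm_eq_abs, abs_mul, abs_mul, abs_neg, abs_of_pos hup, abs_of_nonneg hκ0, abs_of_pos (Real.exp_pos _)]
      calc _ ≤ 1 * (κ * (n + 1)) := by
            gcongr
            exact (hm.2 x).2.1
        _ = _ := one_mul _
  · have h1 := hu.neg_le_linOp hm (t := t) ⟨hm.1.1.trans ht.1, ht.2.le⟩ x
    rw [← hκ] at h1
    rw [linOp_const_mul]
    exact mul_le_mul_of_nonneg_left h1 (Real.exp_pos _).le

theorem exp_neg_mul_ge {κ a U N : ℝ} (hκ : 0 ≤ κ) (ha : 0 ≤ a) (hU : 0 ≤ U) (hN : U ≤ N) :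
    U - κ * N * a ≤ Real.exp (-κ * a) * U := by
  have h1 := Real.add_one_le_exp (-κ * a)
  have h2 := mul_le_mul_of_nonneg_right h1 hU
  have h3 := mul_le_mul_of_nonneg_left hN (mul_nonneg hκ ha)
  nlinarith

variable [BorelSpace W] [IsFiniteMeasure μ] [SecondCountableTopology W]

/-- Comparison principle for positive solutions of linear parabolic equations, without
regularity in time. -/
theorem IsLinSol.le_of_isSubsol (hu : IsLinSol μ Γ v T ν Λ b q u)
    {t₀ : ℝ} (ht₀ : 0 ≤ t₀) {β β' : ℝ → W → ℝ} (hβ : IsSubsol Γ v T ν b q t₀ β β')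
    (hle : ∀ x, β t₀ x ≤ u t₀ x) {t : ℝ} (ht : t ∈ Icc t₀ T) (x : W) : β t x ≤ u t x := by
  have hA : 0 ≤ (ν * Fintype.card ι + Λ * Fintype.card ι + Λ) := by
    have := hu.nu
    have := hu.lam
    positivity
  refine (hβ.isBarrier hu ht₀).le_of_cover (fun t ht x => (hu.pos t ht x).le)
    (fun t ht => (hu.smooth t ht).continuous) hu.deriv (fun t ht => ?_) hu.isClosed_goodTimes
    hu.subset_iUnion_goodTimes
    (C := fun n => (ν * Fintype.card ι + Λ * Fintype.card ι + Λ) * (n + 1) ^ 2 * (n + 1))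
    (fun n m hm hmT => ⟨fun x => ?_, _, _,
      ((hu.isSubsol_exp hm rfl).isBarrier hu hmT.1), ?_, fun t ht x => ?_⟩) ht₀ hle ht x
  · exact hu.cell.bdd _ (continuous_linOp (hu.smooth t ht)
      (fun i => (hu.smooth_b t ht i).continuous) (hu.cont_q t ht))
      (HasPeriods.linOp (hu.per t ht) (hu.per_b t ht) (hu.per_q t ht))
  · refine le_trans ?_ (hu.neg_le_linOp hm hmT x)
    rw [neg_mul, neg_le_neg_iff]
    exact mul_le_mul_of_nonneg_left (hm.2 x).2.1 (by positivity)
  · funext x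
    simp
  · exact exp_neg_mul_ge (by positivity) (sub_nonneg.2 ht.1) (hu.pos m hmT x).le (hm.2 x).2.1

/-- A positive solution is one-sidedly Lipschitz in time. -/
theorem IsLinSol.exists_sub_le (hu : IsLinSol μ Γ v T ν Λ b q u)
    {t₀ : ℝ} (ht₀ : t₀ ∈ Icc 0 T) : ∃ C, 0 ≤ C ∧ ∀ t ∈ Icc t₀ T, ∀ x,
      u t₀ x - C * (t - t₀) ≤ u t x := by
  obtain ⟨n, hn⟩ := mem_iUnion.1 (hu.subset_iUnion_goodTimes ht₀)
  have hA : 0 ≤ (ν * Fintype.card ι + Λ * Fintype.card ι + Λ) := by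
    have := hu.nu
    have := hu.lam
    positivity
  refine ⟨(ν * Fintype.card ι + Λ * Fintype.card ι + Λ) * (n + 1) ^ 2 * (n + 1), by positivity,
    fun t ht x => ?_⟩
  refine le_trans ?_ (hu.le_of_isSubsol ht₀.1 (hu.isSubsol_exp hn rfl) (fun x => by simp) ht x)
  exact exp_neg_mul_ge (by positivity) (sub_nonneg.2 ht.1) (hu.pos t₀ ht₀ x).le (hn.2 x).2.1

end Periods

section CellInstances

theorem HasPeriods.closure {W β : Type*} [AddGroup W] {Γ : Set W} {g : W → β}
    (hg : HasPeriods Γ g) : HasPeriods (AddSubgroup.closure Γ : Set W) g := by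
  intro γ hγ
  induction hγ using AddSubgroup.closure_induction with
  | mem γ h => exact hg γ h
  | zero => simp
  | add a c _ _ ha hc => intro x; rw [← add_assoc, hc, ha]
  | neg a _ ha => intro x; rw [← ha (x + -a), neg_add_cancel_right]

/-- A compact convex cell `S` for the set of periods `Γ`. -/
structure IsCompactCell {W : Type*} [NormedAddCommGroup W] [NormedSpace ℝ W] [MeasureSpace W]
    {ι : Type*} (S Γ : Set W) (v : ι → W) : Prop where
  compact : IsCompact S
  convex : Convex ℝ S
  interior_nonempty : (interior S).Nonempty
  reduce : ∀ x, ∃ y ∈ S, ∀ g : W → ℝ, HasPeriods Γ g → g x = g y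
  ibp : ∀ g : W → ℝ, ContDiff ℝ 1 g → HasPeriods Γ g → ∀ i, ∫ x in S, fderiv ℝ g x (v i) = 0

theorem IsCompactCell.isPeriodCell {W : Type*} [NormedAddCommGroup W] [NormedSpace ℝ W]
    [MeasureSpace W] [BorelSpace W] [(volume : Measure W).IsOpenPosMeasure] {S : Set W}
    [IsFiniteMeasureOnCompacts (volume : Measure W)]
    {ι : Type*} {Γ : Set W} {v : ι → W} (hS : IsCompactCell S Γ v) :
    IsPeriodCell (volume.restrict S) Γ v := by
  refine ⟨hS.ibp, fun g hg hp => ?_, fun g hg hp h0 hi x => ?_⟩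
  · obtain ⟨K, hK⟩ := hS.compact.exists_bound_of_continuousOn hg.continuousOn
    refine ⟨K, fun x => ?_⟩
    obtain ⟨y, hy, he⟩ := hS.reduce x
    rw [he g hp]
    exact hK y hy
  · obtain ⟨y, hy, he⟩ := hS.reduce x
    rw [he g hp]
    have hae : g =ᵐ[volume.restrict S] fun _ => (0 : ℝ) :=
      (integral_eq_zero_iff_of_nonneg (fun x => h0 x)
        (hg.continuousOn.integrableOn_compact hS.compact)).1 hi
    refine Measure.eqOn_of_ae_eq hae hg.continuousOn continuousOn_const ?_ hy
    rw [hS.convex.closure_interior_eq_closure_of_nonempty_interior hS.interior_nonempty]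
    exact subset_closure

/-- The periods of the box. -/
def boxPeriods (d : ℕ) (l : ℝ) : Set (E d) := range fun i => l • uvec d i

theorem hasPeriods_boxPeriods {d : ℕ} {l : ℝ} {β : Type*} {g : E d → β} :
    HasPeriods (boxPeriods d l) g ↔ IsPeriodic l g :=
  ⟨fun h x i => h _ ⟨i, rfl⟩ x, by rintro h _ ⟨i, rfl⟩ x; exact h x i⟩

variable {d : ℕ} {l : ℝ}

theorem box_eq_preimage : box d l =
    WithLp.ofLp ⁻¹' Icc (fun _ : Fin d => -(l / 2)) (fun _ => l / 2) := by
  ext x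
  simp only [box, mem_ofPred_eq, mem_preimage, mem_Icc, Pi.le_def]
  exact forall_and

theorem isCompact_box : IsCompact (box d l) := by
  rw [box_eq_preimage]
  exact (EuclideanSpace.equiv (Fin d) ℝ).toHomeomorph.isCompact_preimage.2 isCompact_Icc

theorem convex_box : Convex ℝ (box d l) := by
  rw [box_eq_preimage]
  exact (convex_Icc _ _).linear_preimage (EuclideanSpace.equiv (Fin d) ℝ).toLinearMap

theorem zero_mem_interior_box (hl : 0 < l) : (0 : E d) ∈ interior (box d l) := by
  rw [mem_interior_iff_mem_nhds]
  have : ∀ i, ∀ᶠ x : E d in 𝓝 0, x i ∈ Icc (-(l / 2)) (l / 2) := fun i => by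
    have hc : Continuous fun x : E d => x i := by fun_prop
    exact hc.tendsto' 0 0 rfl (Icc_mem_nhds (by linarith) (by linarith))
  exact eventually_all.2 this

theorem exists_sub_mem_box (hl : 0 < l) (x : E d) :
    ∃ γ ∈ AddSubgroup.closure (boxPeriods d l), x - γ ∈ box d l := by
  set γ : E d := ∑ i, (toIcoDiv hl (-(l / 2)) (x i)) • (l • uvec d i) with hγ
  have hmem : γ ∈ AddSubgroup.closure (boxPeriods d l) :=
    AddSubgroup.sum_mem _ fun i _ => AddSubgroup.zsmul_mem _
      (AddSubgroup.subset_closure (mem_range_self i)) _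
  have hγi : ∀ i, γ i = toIcoDiv hl (-(l / 2)) (x i) • l := fun i => by
    simp [hγ, uvec, Finset.sum_apply, Pi.single_apply, mul_comm]
  refine ⟨γ, hmem, fun i => ?_⟩
  have h1 := sub_toIcoDiv_zsmul_mem_Ico hl (-(l / 2)) (x i)
  rw [PiLp.sub_apply, hγi]
  exact ⟨h1.1, by linarith [h1.2]⟩

theorem exists_mem_box (hl : 0 < l) (x : E d) : ∃ y ∈ box d l, ∀ {β : Type} (g : E d → β),
    HasPeriods (boxPeriods d l) g → g x = g y := by
  obtain ⟨γ, hγ, hm⟩ := exists_sub_mem_box hl x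
  refine ⟨x - γ, hm, fun g hg => ?_⟩
  rw [← hg.closure γ hγ (x - γ), sub_add_cancel]

theorem setIntegral_box_fderiv {g : E d → ℝ} (hg : ContDiff ℝ 1 g) (hl : 0 < l)
    (hp : IsPeriodic l g) (i : Fin d) : ∫ x in box d l, fderiv ℝ g x (uvec d i) = 0 := by
  obtain ⟨n, rfl⟩ : ∃ n, d = n + 1 := ⟨d - 1, by have := i.pos; omega⟩
  have hvp := PiLp.volume_preserving_ofLp (Fin (n + 1))
  have hme : MeasurableEmbedding (WithLp.ofLp : E (n + 1) → (Fin (n + 1) → ℝ)) :=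
    (EuclideanSpace.equiv (Fin (n + 1)) ℝ).toHomeomorph.measurableEmbedding
  set L : (Fin (n + 1) → ℝ) →L[ℝ] E (n + 1) :=
    (EuclideanSpace.equiv (Fin (n + 1)) ℝ).symm.toContinuousLinearMap with hL
  have hLs : ∀ i, L (Pi.single i 1) = uvec (n + 1) i := fun i => rfl
  set k : (Fin (n + 1) → ℝ) → ℝ := fun y => g (L y) with hk
  have hkc : ContDiff ℝ 1 k := hg.comp L.contDiff
  have hkd : ∀ y, HasFDerivAt k ((fderiv ℝ g (L y)).comp L) y := fun y =>
    (hg.differentiable (by norm_num) _).hasFDerivAt.comp y L.hasFDerivAt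
  rw [box_eq_preimage]
  have h1 := hvp.setIntegral_preimage_emb hme (fun y => fderiv ℝ g (L y) (uvec (n + 1) i))
    (Icc (fun _ => -(l / 2)) (fun _ => l / 2))
  refine Eq.trans h1 ?_
  have h2 := integral_divergence_of_hasFDerivAt_off_countable' (n := n)
    (fun _ => -(l / 2)) (fun _ => l / 2) (fun _ => by simp only; linarith)
    (fun j => if j = i then k else fun _ => 0)
    (fun j y => if j = i then (fderiv ℝ g (L y)).comp L else 0) ∅ countable_empty
    (fun j => by
      split_ifs
      · exact hkc.continuous.continuousOn
      · exact continuousOn_const)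
    (fun y _ j => by
      split_ifs
      · exact hkd y
      · exact hasFDerivAt_const _ _)
  have h3 : ∀ y, ∑ j, (if j = i then (fderiv ℝ g (L y)).comp L else 0) (Pi.single j 1) =
      fderiv ℝ g (L y) (uvec (n + 1) i) := fun y => by
    rw [Finset.sum_eq_single i]
    · simp [hLs]
    · intro j _ hj; simp [hj]
    · simp
  simp only [h3] at h2
  rw [h2]
  · refine Finset.sum_eq_zero fun j _ => ?_
    split_ifs with hj
    · subst hj
      rw [sub_eq_zero]
      refine integral_congr_ae (Eventually.of_forall fun y => ?_)
      simp only [hk]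
      have : L (Fin.insertNth j (l / 2) y) =
          L (Fin.insertNth j (-(l / 2)) y) + l • uvec (n + 1) j := by
        rw [← hLs, ← map_smul, ← map_add]
        congr 1
        funext m
        rcases Fin.eq_self_or_eq_succAbove j m with rfl | ⟨m, rfl⟩
        · simp; ring
        · simp
      rw [this]
      exact hp _ _
    · simp
  · refine Continuous.integrableOn_Icc ?_
    exact ((hg.continuous_fderiv (by norm_num)).comp L.continuous).clm_apply continuous_const

theorem isCompactCell_box (hl : 0 < l) : IsCompactCell (box d l) (boxPeriods d l) (uvec d) :=
  ⟨isCompact_box, convex_box, ⟨0, zero_mem_interior_box hl⟩,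
    fun x => by
      obtain ⟨y, hy, h⟩ := exists_mem_box hl x
      exact ⟨y, hy, fun g hg => h g hg⟩,
    fun _ hg hp i => setIntegral_box_fderiv hg hl (hasPeriods_boxPeriods.1 hp) i⟩

end CellInstances

section ProdCell

variable {W₁ W₂ : Type*} [NormedAddCommGroup W₁] [NormedAddCommGroup W₂] {ι₁ ι₂ : Type*} {S₁ Γ₁ : Set W₁} {S₂ Γ₂ : Set W₂} {v₁ : ι₁ → W₁}
  {v₂ : ι₂ → W₂}

/-- Periods of functions on a product. -/
def prodPeriods (Γ₁ : Set W₁) (Γ₂ : Set W₂) : Set (W₁ × W₂) :=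
  {γ | (γ.1 ∈ Γ₁ ∧ γ.2 = 0) ∨ (γ.1 = 0 ∧ γ.2 ∈ Γ₂)}

/-- Coordinate directions of a product. -/
def prodVec (v₁ : ι₁ → W₁) (v₂ : ι₂ → W₂) : ι₁ ⊕ ι₂ → W₁ × W₂ :=
  Sum.elim (fun i => (v₁ i, 0)) (fun i => (0, v₂ i))

theorem HasPeriods.fst {β : Type*} {g : W₁ × W₂ → β} (hg : HasPeriods (prodPeriods Γ₁ Γ₂) g)
    (y : W₂) : HasPeriods Γ₁ (fun x => g (x, y)) := fun γ hγ x => by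
  simpa using hg (γ, 0) (Or.inl ⟨hγ, rfl⟩) (x, y)

theorem HasPeriods.snd {β : Type*} {g : W₁ × W₂ → β} (hg : HasPeriods (prodPeriods Γ₁ Γ₂) g)
    (x : W₁) : HasPeriods Γ₂ (fun y => g (x, y)) := fun γ hγ y => by
  simpa using hg (0, γ) (Or.inr ⟨rfl, hγ⟩) (x, y)

theorem HasPeriods.prod {α β γ : Type*} {g : W₁ → α} {h : W₂ → β} (hg : HasPeriods Γ₁ g)
    (hh : HasPeriods Γ₂ h) (k : α → β → γ) :
    HasPeriods (prodPeriods Γ₁ Γ₂) (fun z => k (g z.1) (h z.2)) := by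
  rintro ⟨c₁, c₂⟩ (⟨h1, h2⟩ | ⟨h1, h2⟩) z
  · simp only at h1 h2
    simp [h2, hg c₁ h1]
  · simp only at h1 h2
    simp [h1, hh c₂ h2]

variable [NormedSpace ℝ W₁] [NormedSpace ℝ W₂]

theorem fderiv_prodMk_left_apply {g : W₁ × W₂ → ℝ} (hg : Differentiable ℝ g) (x : W₁) (y : W₂)
    (v : W₁) : fderiv ℝ (fun x => g (x, y)) x v = fderiv ℝ g (x, y) (v, 0) := by
  have := HasFDerivAt.comp (g := g) x (hg (x, y)).hasFDerivAt
    (hasFDerivAt_prodMk_left (𝕜 := ℝ) x y)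
  exact congrArg (fun L : W₁ →L[ℝ] ℝ => L v) this.fderiv

theorem fderiv_prodMk_right_apply {g : W₁ × W₂ → ℝ} (hg : Differentiable ℝ g) (x : W₁) (y v : W₂) :
    fderiv ℝ (fun y => g (x, y)) y v = fderiv ℝ g (x, y) (0, v) := by
  have := HasFDerivAt.comp (g := g) y (hg (x, y)).hasFDerivAt
    (hasFDerivAt_prodMk_right (𝕜 := ℝ) x y)
  exact congrArg (fun L : W₂ →L[ℝ] ℝ => L v) this.fderiv

theorem IsCompactCell.prod [MeasureSpace W₁] [BorelSpace W₁] [MeasureSpace W₂] [BorelSpace W₂]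
    [SigmaFinite (volume : Measure W₁)] [SigmaFinite (volume : Measure W₂)]
    [IsFiniteMeasureOnCompacts (volume : Measure W₁)]
    [IsFiniteMeasureOnCompacts (volume : Measure W₂)]
    [SecondCountableTopology W₁] [SecondCountableTopology W₂]
    (h₁ : IsCompactCell S₁ Γ₁ v₁) (h₂ : IsCompactCell S₂ Γ₂ v₂) :
    IsCompactCell (S₁ ×ˢ S₂) (prodPeriods Γ₁ Γ₂) (prodVec v₁ v₂) := by
  have hK := h₁.compact.prod h₂.compact
  refine ⟨hK, h₁.convex.prod h₂.convex, ?_, fun x => ?_, fun g hg hp i => ?_⟩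
  · rw [interior_prod_eq]
    exact h₁.interior_nonempty.prod h₂.interior_nonempty
  · obtain ⟨y₁, hy₁, e₁⟩ := h₁.reduce x.1
    obtain ⟨y₂, hy₂, e₂⟩ := h₂.reduce x.2
    exact ⟨(y₁, y₂), ⟨hy₁, hy₂⟩, fun g hg => (e₁ _ (hg.fst x.2)).trans (e₂ _ (hg.snd y₁))⟩
  · have hd := hg.differentiable (by norm_num)
    have hcont : Continuous fun x => fderiv ℝ g x (prodVec v₁ v₂ i) :=
      continuous_fderiv_apply_const hg le_rfl _
    have hi : IntegrableOn (fun x => fderiv ℝ g x (prodVec v₁ v₂ i)) (S₁ ×ˢ S₂)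
        (volume.prod volume) := hcont.continuousOn.integrableOn_compact hK
    rw [Measure.volume_eq_prod]
    rcases i with i | i
    · rw [← Measure.prod_restrict, integral_prod_symm _ (by rwa [Measure.prod_restrict])]
      refine integral_eq_zero_of_ae (Eventually.of_forall fun y => ?_)
      have := h₁.ibp (fun x => g (x, y)) (hg.comp (contDiff_id.prodMk contDiff_const))
        (hp.fst y) i
      simp only [fderiv_prodMk_left_apply hd] at this
      exact this
    · rw [setIntegral_prod _ hi]
      refine integral_eq_zero_of_ae (Eventually.of_forall fun x => ?_)
      have := h₂.ibp (fun y => g (x, y)) (hg.comp (contDiff_const.prodMk contDiff_id))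
        (hp.snd x) i
      simp only [fderiv_prodMk_right_apply hd] at this
      exact this

end ProdCell

section ExpBarrier

variable {W : Type*} [NormedAddCommGroup W] [NormedSpace ℝ W] {ι : Type*} [Fintype ι]
  {Γ : Set W} {v : ι → W} {T Λ : ℝ} {b : ℝ → ι → W → ℝ} {q u : ℝ → W → ℝ}

theorem isSubsol_exp_neg {Φ : W → ℝ} (hΦ : ContDiff ℝ 2 Φ) (hp : HasPeriods Γ Φ)
    (h0 : ∀ x, 0 ≤ Φ x) {κ M : ℝ} (hκ : 0 ≤ κ) (hM : 1 ≤ M)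
    (hb : ∀ t ∈ Icc 0 T, ∀ x, |∑ i, b t i x * fderiv ℝ Φ x (v i)| ≤ κ * Φ x)
    (hq : ∀ t ∈ Icc 0 T, ∀ x, |q t x| ≤ κ * Φ x) :
    IsSubsol Γ v T 0 b q 0 (fun t x => Real.exp (-(M * Real.exp (2 * κ * t) * Φ x)))
      (fun t x => -(M * Real.exp (2 * κ * t) * (2 * κ) * Φ x) *
        Real.exp (-(M * Real.exp (2 * κ * t) * Φ x))) := by
  have hder : ∀ t x, HasDerivAt (fun t => Real.exp (-(M * Real.exp (2 * κ * t) * Φ x)))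
      (-(M * Real.exp (2 * κ * t) * (2 * κ) * Φ x) *
        Real.exp (-(M * Real.exp (2 * κ * t) * Φ x))) t := fun t x => by
    have h1 : HasDerivAt (fun t : ℝ => 2 * κ * t) (2 * κ) t := by
      simpa using (hasDerivAt_id t).const_mul (2 * κ)
    have h2 := (((h1.exp.const_mul M).mul_const (Φ x)).neg).exp
    refine h2.congr_deriv ?_
    simp only [Pi.neg_apply]
    ring
  refine ⟨fun t _ => by fun_prop, fun t _ => hp.comp fun r =>
    Real.exp (-(M * Real.exp (2 * κ * t) * r)), fun t _ => ?_, fun t _ => hp.comp fun r =>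
    -(M * Real.exp (2 * κ * t) * (2 * κ) * r) * Real.exp (-(M * Real.exp (2 * κ * t) * r)),
    fun t _ x => (hder t x).hasDerivWithinAt, ⟨2 * κ, fun s _ t _ x => ?_⟩, fun t ht x => ?_⟩
  · have := hΦ.continuous
    fun_prop
  · have := Convex.norm_image_sub_le_of_norm_hasDerivWithin_le (C := 2 * κ) (s := univ)
      (fun t _ => (hder t x).hasDerivWithinAt) (fun t _ => ?_) convex_univ (mem_univ t)
      (mem_univ s)
    · exact this
    · set y := M * Real.exp (2 * κ * t) * Φ x with hy
      have hy0 : 0 ≤ y := by have := h0 x; positivity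
      have e : -(M * Real.exp (2 * κ * t) * (2 * κ) * Φ x) = -(2 * κ * y) := by rw [hy]; ring
      rw [e, norm_mul, norm_neg, Real.norm_of_nonneg (by positivity),
        Real.norm_of_nonneg (Real.exp_pos _).le, mul_assoc]
      refine mul_le_of_le_one_right (by positivity) ?_
      rw [Real.exp_neg, ← div_eq_mul_inv, div_le_one (Real.exp_pos _)]
      linarith [Real.add_one_le_exp y]
  · have ht' : t ∈ Icc 0 T := ⟨ht.1, ht.2.le⟩
    set m := M * Real.exp (2 * κ * t) with hm
    have hm1 : 1 ≤ m := by
      have := Real.one_le_exp (x := 2 * κ * t) (by have := ht.1; positivity)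
      nlinarith
    have hfd : ∀ i, fderiv ℝ (fun x => Real.exp (-(m * Φ x))) x (v i) =
        -(m * Real.exp (-(m * Φ x))) * fderiv ℝ Φ x (v i) := fun i => by
      have h1 : HasFDerivAt (fun x => Real.exp (-(m * Φ x))) _ x :=
        (((hΦ.differentiable (by norm_num) x).hasFDerivAt.const_mul m).neg).exp
      rw [h1.fderiv]
      simp only [Pi.neg_apply, _root_.smul_apply, _root_.neg_apply, smul_eq_mul]
      ring
    have hlin : linOp v 0 (b t) (q t) (fun x => Real.exp (-(m * Φ x))) x =
        (-(m * ∑ i, b t i x * fderiv ℝ Φ x (v i)) + q t x) * Real.exp (-(m * Φ x)) := by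
      unfold linOp
      simp only [hfd]
      rw [zero_mul, zero_add, add_mul, Finset.mul_sum, ← Finset.sum_neg_distrib, Finset.sum_mul]
      congr 1
      exact Finset.sum_congr rfl fun i _ => by ring
    rw [hlin]
    refine mul_le_mul_of_nonneg_right ?_ (Real.exp_pos _).le
    have h1 := (abs_le.1 (hb t ht' x)).2
    have h2 := (abs_le.1 (hq t ht' x)).1
    have h3 := mul_le_mul_of_nonneg_left h1 (by linarith : 0 ≤ m)
    have h4 : κ * Φ x ≤ m * (κ * Φ x) := le_mul_of_one_le_left (mul_nonneg hκ (h0 x)) hm1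
    linarith

variable [MeasurableSpace W] {μ : Measure W}

theorem IsLinSol.exp_neg_le [BorelSpace W] [IsFiniteMeasure μ] [SecondCountableTopology W]
    (hu : IsLinSol μ Γ v T 0 Λ b q u) {Φ : W → ℝ} (hΦ : ContDiff ℝ 2 Φ) (hp : HasPeriods Γ Φ)
    (h0 : ∀ x, 0 ≤ Φ x) {κ M : ℝ} (hκ : 0 ≤ κ) (hM : 1 ≤ M)
    (hb : ∀ t ∈ Icc 0 T, ∀ x, |∑ i, b t i x * fderiv ℝ Φ x (v i)| ≤ κ * Φ x)
    (hq : ∀ t ∈ Icc 0 T, ∀ x, |q t x| ≤ κ * Φ x)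
    (hini : ∀ x, Real.exp (-(M * Φ x)) ≤ u 0 x) {t : ℝ} (ht : t ∈ Icc 0 T) (x : W) :
    Real.exp (-(M * Real.exp (2 * κ * t) * Φ x)) ≤ u t x :=
  hu.le_of_isSubsol le_rfl (isSubsol_exp_neg hΦ hp h0 hκ hM hb hq)
    (fun x => by simpa using hini x) ht x

end ExpBarrier

section ProdSol

variable {W₁ W₂ : Type*} [NormedAddCommGroup W₁] [NormedSpace ℝ W₁] [NormedAddCommGroup W₂]
  [NormedSpace ℝ W₂] {ι₁ ι₂ : Type*} [Fintype ι₁] [Fintype ι₂] {S₁ Γ₁ : Set W₁} {S₂ Γ₂ : Set W₂}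
  {v₁ : ι₁ → W₁} {v₂ : ι₂ → W₂} {T Λ₁ Λ₂ : ℝ} {b₁ : ℝ → ι₁ → W₁ → ℝ} {b₂ : ℝ → ι₂ → W₂ → ℝ}
  {q₁ u₁ : ℝ → W₁ → ℝ} {q₂ u₂ : ℝ → W₂ → ℝ}

/-- The coefficient field on a product. -/
def prodField (b₁ : ι₁ → W₁ → ℝ) (b₂ : ι₂ → W₂ → ℝ) : ι₁ ⊕ ι₂ → W₁ × W₂ → ℝ :=
  Sum.elim (fun i z => b₁ i z.1) (fun i z => b₂ i z.2)

theorem fderiv_comp_fst_apply {g : W₁ → ℝ} (hg : Differentiable ℝ g) (z w : W₁ × W₂) :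
    fderiv ℝ (fun z : W₁ × W₂ => g z.1) z w = fderiv ℝ g z.1 w.1 := by
  have := (hg z.1).hasFDerivAt.comp z (hasFDerivAt_fst (𝕜 := ℝ) (E := W₁) (F := W₂))
  exact congrArg (fun L : W₁ × W₂ →L[ℝ] ℝ => L w) this.fderiv

theorem fderiv_comp_snd_apply {g : W₂ → ℝ} (hg : Differentiable ℝ g) (z w : W₁ × W₂) :
    fderiv ℝ (fun z : W₁ × W₂ => g z.2) z w = fderiv ℝ g z.2 w.2 := by
  have := (hg z.2).hasFDerivAt.comp z (hasFDerivAt_snd (𝕜 := ℝ) (E := W₁) (F := W₂))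
  exact congrArg (fun L : W₁ × W₂ →L[ℝ] ℝ => L w) this.fderiv

theorem IsLinSol.prod [MeasureSpace W₁] [MeasureSpace W₂] {μ₁ : Measure W₁} {μ₂ : Measure W₂}
    {μ : Measure (W₁ × W₂)} (h₁ : IsLinSol μ₁ Γ₁ v₁ T 0 Λ₁ b₁ q₁ u₁)
    (h₂ : IsLinSol μ₂ Γ₂ v₂ T 0 Λ₂ b₂ q₂ u₂)
    (hcell : IsPeriodCell μ (prodPeriods Γ₁ Γ₂) (prodVec v₁ v₂)) :
    IsLinSol μ (prodPeriods Γ₁ Γ₂) (prodVec v₁ v₂) T 0 (Λ₁ + Λ₂)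
      (fun t => prodField (b₁ t) (b₂ t)) (fun t z => q₁ t z.1 + q₂ t z.2)
      (fun t z => u₁ t z.1 * u₂ t z.2) := by
  have hconst₁ : HasPeriods Γ₁ (fun _ => (0 : ℝ)) := fun _ _ _ => rfl
  have hconst₂ : HasPeriods Γ₂ (fun _ => (0 : ℝ)) := fun _ _ _ => rfl
  have := h₁.lam
  have := h₂.lam
  refine ⟨hcell, le_rfl, by positivity, fun t ht => ?_, fun t ht z => ?_, fun t ht => ?_,
    fun t ht i => ?_, fun t ht i => ?_, fun t ht i z => ?_, fun t ht z => ?_, fun t ht => ?_,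
    fun t ht => ?_, fun t ht z => ?_, fun t ht z => ?_⟩
  · exact ((h₁.smooth t ht).comp contDiff_fst).mul ((h₂.smooth t ht).comp contDiff_snd)
  · exact mul_pos (h₁.pos t ht _) (h₂.pos t ht _)
  · exact (h₁.per t ht).prod (h₂.per t ht) fun a c => a * c
  · rcases i with i | i
    · exact (h₁.smooth_b t ht i).comp contDiff_fst
    · exact (h₂.smooth_b t ht i).comp contDiff_snd
  · rcases i with i | i
    · exact (h₁.per_b t ht i).prod hconst₂ fun a _ => a
    · exact hconst₁.prod (h₂.per_b t ht i) fun _ c => c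
  · rcases i with i | i
    · exact (h₁.b_le t ht i _).trans (by linarith)
    · exact (h₂.b_le t ht i _).trans (by linarith)
  · rw [Fintype.sum_sum_type]
    simp only [prodField, prodVec, Sum.elim_inl, Sum.elim_inr]
    simp only [fun i => fderiv_comp_fst_apply (W₂ := W₂)
        ((h₁.smooth_b t ht i).differentiable (by norm_num)),
      fun i => fderiv_comp_snd_apply (W₁ := W₁)
        ((h₂.smooth_b t ht i).differentiable (by norm_num))]
    exact (abs_add_le _ _).trans (add_le_add (h₁.div_le t ht _) (h₂.div_le t ht _))
  · exact ((h₁.cont_q t ht).comp continuous_fst).add ((h₂.cont_q t ht).comp continuous_snd)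
  · exact (h₁.per_q t ht).prod (h₂.per_q t ht) fun a c => a + c
  · exact (abs_add_le _ _).trans (add_le_add (h₁.q_le t ht _) (h₂.q_le t ht _))
  · refine ((h₁.deriv t ht z.1).mul (h₂.deriv t ht z.2)).congr_deriv ?_
    have hd₁ := (h₁.smooth t ht).differentiable (by norm_num)
    have hd₂ := (h₂.smooth t ht).differentiable (by norm_num)
    have hfd : ∀ w, fderiv ℝ (fun z : W₁ × W₂ => u₁ t z.1 * u₂ t z.2) z w =
        u₂ t z.2 * fderiv ℝ (u₁ t) z.1 w.1 + u₁ t z.1 * fderiv ℝ (u₂ t) z.2 w.2 := fun w => by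
      have h1 : DifferentiableAt ℝ (fun z : W₁ × W₂ => u₁ t z.1) z :=
        (hd₁ _).comp z differentiableAt_fst
      have h2 : DifferentiableAt ℝ (fun z : W₁ × W₂ => u₂ t z.2) z :=
        (hd₂ _).comp z differentiableAt_snd
      rw [fderiv_fun_mul h1 h2]
      simp only [_root_.add_apply, _root_.smul_apply, smul_eq_mul,
        fderiv_comp_fst_apply hd₁, fderiv_comp_snd_apply hd₂]
      ring
    unfold linOp
    rw [zero_mul, zero_mul, zero_mul, zero_add, zero_add, zero_add, Fintype.sum_sum_type]
    simp only [hfd, prodField, prodVec, Sum.elim_inl, Sum.elim_inr, map_zero, mul_zero, add_zero,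
      zero_add]
    rw [add_mul, mul_add, Finset.sum_mul, Finset.mul_sum,
      Finset.sum_congr rfl fun i _ => (by ring : b₁ t i z.1 * fderiv ℝ (u₁ t) z.1 (v₁ i) *
        u₂ t z.2 = b₁ t i z.1 * (u₂ t z.2 * fderiv ℝ (u₁ t) z.1 (v₁ i))),
      Finset.sum_congr rfl fun i _ => (by ring : u₁ t z.1 * (b₂ t i z.2 *
        fderiv ℝ (u₂ t) z.2 (v₂ i)) = b₂ t i z.2 * (u₁ t z.1 * fderiv ℝ (u₂ t) z.2 (v₂ i)))]
    ring

end ProdSol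

section TorusNorm

variable {d : ℕ} {l ε : ℝ}

/-- A smooth periodic function comparable to the squared distance to the period lattice. -/
def torusSq (l : ℝ) (z : E d) : ℝ := ∑ i, (1 - Real.cos (2 * Real.pi / l * z i))

/-- A regularised periodic distance to the period lattice. -/
def torusN (l ε : ℝ) (z : E d) : ℝ := √(torusSq l z + ε)

theorem torusSq_nonneg (z : E d) : 0 ≤ torusSq l z :=
  Finset.sum_nonneg fun i _ => by linarith [Real.cos_le_one (2 * Real.pi / l * z i)]

theorem torusN_nonneg (z : E d) : 0 ≤ torusN l ε z := Real.sqrt_nonneg _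

theorem torusN_pos (hε : 0 < ε) (z : E d) : 0 < torusN l ε z :=
  Real.sqrt_pos.2 (by linarith [torusSq_nonneg (l := l) z])

theorem hasPeriods_torusSq (hl : 0 < l) : HasPeriods (boxPeriods d l) (torusSq l) := by
  rintro _ ⟨j, rfl⟩ x
  refine Finset.sum_congr rfl fun i _ => ?_
  have : (x + l • uvec d j) i = x i + l * (if i = j then 1 else 0) := by
    simp [uvec]
  rw [this]
  split_ifs
  · rw [mul_one, mul_add, div_mul_cancel₀ _ hl.ne', Real.cos_add_two_pi]
  · simp

theorem hasPeriods_torusN (hl : 0 < l) : HasPeriods (boxPeriods d l) (torusN l ε) :=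
  (hasPeriods_torusSq hl).comp fun r => √(r + ε)

theorem torusN_le (hl : 0 < l) (hε : 0 ≤ ε) (z : E d) :
    torusN l ε z ≤ √ε + 2 * Real.pi / l * ‖z‖ := by
  have hc : 0 ≤ 2 * Real.pi / l := by positivity
  have h : torusSq l z ≤ (2 * Real.pi / l * ‖z‖) ^ 2 := by
    rw [mul_pow, EuclideanSpace.norm_sq_eq, Finset.mul_sum]
    refine Finset.sum_le_sum fun i _ => ?_
    have := Real.one_sub_sq_div_two_le_cos (x := 2 * Real.pi / l * z i)
    rw [Real.norm_eq_abs, sq_abs]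
    nlinarith [sq_nonneg (2 * Real.pi / l * z i)]
  refine Real.sqrt_le_iff.2 ⟨by positivity, ?_⟩
  have h2 := Real.sq_sqrt hε
  have h3 : 0 ≤ √ε * (2 * Real.pi / l * ‖z‖) := by positivity
  nlinarith

theorem torusN_le_const (hε : ε ≤ 1) (z : E d) : torusN l ε z ≤ 2 * d + 1 := by
  have h : torusSq l z ≤ 2 * d := by
    have : ∀ i ∈ (Finset.univ : Finset (Fin d)), 1 - Real.cos (2 * Real.pi / l * z i) ≤ 2 :=
      fun i _ => by linarith [Real.neg_one_le_cos (2 * Real.pi / l * z i)]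
    refine (Finset.sum_le_card_nsmul _ _ _ this).trans_eq ?_
    rw [Finset.card_univ, Fintype.card_fin, nsmul_eq_mul, mul_comm]
  have hd : (0 : ℝ) ≤ d := Nat.cast_nonneg d
  exact Real.sqrt_le_iff.2 ⟨by positivity, by nlinarith⟩

theorem exists_norm_sub_le_torusN (hl : 0 < l) (hε : 0 ≤ ε) (z : E d) :
    ∃ γ ∈ AddSubgroup.closure (boxPeriods d l), ‖z - γ‖ ≤ l * torusN l ε z := by
  obtain ⟨γ, hγ, hm⟩ := exists_sub_mem_box hl z
  refine ⟨γ, hγ, ?_⟩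
  have hP : torusSq l z = torusSq l (z - γ) := by
    rw [← (hasPeriods_torusSq hl).closure γ hγ (z - γ), sub_add_cancel]
  unfold torusN
  rw [hP]
  set w := z - γ
  refine abs_le_of_sq_le_sq' ?_ (by positivity) |>.2
  rw [mul_pow, Real.sq_sqrt (by linarith [torusSq_nonneg (l := l) w]), EuclideanSpace.norm_sq_eq]
  have : ∑ i, ‖w i‖ ^ 2 ≤ l ^ 2 * torusSq l w := by
    unfold torusSq
    rw [Finset.mul_sum]
    refine Finset.sum_le_sum fun i _ => ?_
    have hi := hm i
    have hpi := Real.pi_pos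
    have hab : |2 * Real.pi / l * w i| ≤ Real.pi := by
      rw [abs_mul, abs_of_pos (by positivity), div_mul_eq_mul_div, div_le_iff₀ hl]
      have : |w i| ≤ l / 2 := abs_le.2 hi
      nlinarith
    have h1 := Real.cos_le_one_sub_mul_cos_sq hab
    have h2 : 2 / Real.pi ^ 2 * (2 * Real.pi / l * w i) ^ 2 = 8 * (w i ^ 2 / l ^ 2) := by
      field_simp
      ring
    rw [Real.norm_eq_abs, sq_abs]
    have h3 : l ^ 2 * (w i ^ 2 / l ^ 2) = w i ^ 2 := by field_simp
    have h4 : l ^ 2 * (8 * (w i ^ 2 / l ^ 2)) ≤ l ^ 2 * (1 - Real.cos (2 * Real.pi / l * w i)) :=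
      mul_le_mul_of_nonneg_left (by linarith) (by positivity)
    nlinarith [sq_nonneg (w i)]
  nlinarith [sq_nonneg l]

theorem contDiff_torusSq {n : WithTop ℕ∞} : ContDiff ℝ n (torusSq l : E d → ℝ) := by
  unfold torusSq
  refine ContDiff.sum fun i _ => contDiff_const.sub (Real.contDiff_cos.comp ?_)
  fun_prop

theorem contDiff_torusN (hε : 0 < ε) {n : WithTop ℕ∞} : ContDiff ℝ n (torusN l ε : E d → ℝ) :=
  (contDiff_torusSq.add contDiff_const).sqrt fun z => by
    have := torusSq_nonneg (l := l) z
    positivity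

theorem hasFDerivAt_torusSq (z : E d) : HasFDerivAt (torusSq l)
    (∑ i, (2 * Real.pi / l * Real.sin (2 * Real.pi / l * z i)) • EuclideanSpace.proj (𝕜 := ℝ) i) z := by
  unfold torusSq
  refine HasFDerivAt.fun_sum fun i _ => ?_
  have h1 : HasFDerivAt (fun z : E d => 2 * Real.pi / l * z i)
      ((2 * Real.pi / l) • EuclideanSpace.proj (𝕜 := ℝ) i) z :=
    (EuclideanSpace.proj (𝕜 := ℝ) i).hasFDerivAt.const_mul _
  refine (h1.cos.const_sub 1).congr_fderiv ?_
  module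

theorem abs_fderiv_torusN_le (hl : 0 < l) (hε : 0 < ε) (z v : E d) :
    |fderiv ℝ (torusN l ε) z v| ≤ 2 * Real.pi / l * ‖v‖ := by
  have hP := torusSq_nonneg (l := l) z
  have hN := torusN_pos (l := l) hε z
  have h1 : HasFDerivAt (torusN l ε) _ z :=
    ((hasFDerivAt_torusSq (l := l) z).add_const ε).sqrt (by positivity)
  have hS : |∑ i, Real.sin (2 * Real.pi / l * z i) * v i| ≤ 2 * torusN l ε z * ‖v‖ := by
    refine abs_le_of_sq_le_sq ?_ (by positivity)
    refine (Finset.sum_mul_sq_le_sq_mul_sq _ _ _).trans ?_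
    rw [mul_pow, EuclideanSpace.norm_sq_eq]
    simp only [Real.norm_eq_abs, sq_abs]
    refine mul_le_mul_of_nonneg_right ?_ (Finset.sum_nonneg fun i _ => sq_nonneg _)
    rw [mul_pow, torusN, Real.sq_sqrt (by positivity)]
    have : ∑ i, Real.sin (2 * Real.pi / l * z i) ^ 2 ≤ 2 * torusSq l z := by
      unfold torusSq
      rw [Finset.mul_sum]
      refine Finset.sum_le_sum fun i _ => ?_
      rw [Real.sin_sq]
      nlinarith [Real.cos_le_one (2 * Real.pi / l * z i),
        Real.neg_one_le_cos (2 * Real.pi / l * z i), sq_nonneg (1 - Real.cos (2 * Real.pi / l * z i))]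
    linarith
  have e : fderiv ℝ (torusN l ε) z v = (2 * Real.pi / l) / (2 * torusN l ε z) *
      ∑ i, Real.sin (2 * Real.pi / l * z i) * v i := by
    rw [h1.fderiv]
    have hproj : ∀ i, EuclideanSpace.proj (𝕜 := ℝ) i v = v i := fun i => rfl
    simp only [smul_apply, _root_.sum_apply, smul_eq_mul, hproj,
      torusN, Finset.mul_sum]
    refine Finset.sum_congr rfl fun i _ => by ring
  rw [e, abs_mul, abs_of_pos (by positivity), div_mul_eq_mul_div, div_le_iff₀ (by positivity)]
  have : 0 ≤ 2 * Real.pi / l := by positivity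
  nlinarith [mul_le_mul_of_nonneg_left hS this]

end TorusNorm

section Differences

variable {F : Type*} [NormedAddCommGroup F] [NormedSpace ℝ F] {φ : F → ℝ} {L : ℝ}

theorem fwdDiff_iter_three (h : ℝ) (g : ℝ → ℝ) (x : ℝ) :
    (fwdDiff h)^[3] g x = g (x + 3 * h) - 3 * g (x + 2 * h) + 3 * g (x + h) - g x := by
  simp only [Function.iterate_succ, Function.iterate_zero, Function.comp, fwdDiff, id]
  ring_nf

theorem iteratedDeriv_line_eq {n : ℕ} (hφ : ContDiff ℝ n φ) (x v : F) (s : ℝ) :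
    iteratedDeriv n (fun τ => φ (x + τ • v)) s = iteratedFDeriv ℝ n φ (x + s • v) fun _ => v := by
  set Λ : ℝ →L[ℝ] F := ContinuousLinearMap.toSpanSingleton ℝ v
  have h1 : (fun τ : ℝ => φ (x + τ • v)) = (fun y => φ (x + y)) ∘ Λ := by
    funext τ
    simp [Λ]
  have h2 : ContDiff ℝ n (fun y => φ (x + y)) := hφ.comp (contDiff_const.add contDiff_id)
  rw [iteratedDeriv_eq_iteratedFDeriv, h1, Λ.iteratedFDeriv_comp_right h2 s le_rfl,
    iteratedFDeriv_comp_add_left]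
  simp [Λ]

theorem abs_iteratedDeriv_line_le {n : ℕ} (hφ : ContDiff ℝ n φ)
    (hb : ∀ x, ‖iteratedFDeriv ℝ n φ x‖ ≤ L) (x v : F) (s : ℝ) :
    |iteratedDeriv n (fun τ => φ (x + τ • v)) s| ≤ L * ‖v‖ ^ n := by
  rw [iteratedDeriv_line_eq hφ, ← Real.norm_eq_abs]
  refine (ContinuousMultilinearMap.le_opNorm _ _).trans ?_
  simpa using mul_le_mul_of_nonneg_right (hb (x + s • v)) (by positivity)

theorem abs_fwdDiff_line_le {n : ℕ} (hφ : ContDiff ℝ n φ)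
    (hb : ∀ x, ‖iteratedFDeriv ℝ n φ x‖ ≤ L) (x v : F) :
    |(fwdDiff 1)^[n] (fun τ : ℝ => φ (x + τ • v)) 0| ≤ L * ‖v‖ ^ n := by
  obtain ⟨ξ, -, h⟩ := exists_fwdDiff_iter_eq (contDiff_line hφ x v) one_pos 0
  rw [h, one_pow, one_mul]
  exact abs_iteratedDeriv_line_le hφ hb x v ξ

theorem abs_sub_le_of_iteratedFDeriv (hφ : ContDiff ℝ 1 φ)
    (hb : ∀ x, ‖iteratedFDeriv ℝ 1 φ x‖ ≤ L) (x v : F) : |φ (x + v) - φ x| ≤ L * ‖v‖ := by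
  have := abs_fwdDiff_line_le (n := 1) hφ hb x v
  simpa [fwdDiff] using this

theorem abs_second_diff_le (hφ : ContDiff ℝ 2 φ)
    (hb : ∀ x, ‖iteratedFDeriv ℝ 2 φ x‖ ≤ L) (x v : F) :
    |φ (x + (2 : ℝ) • v) - 2 * φ (x + v) + φ x| ≤ L * ‖v‖ ^ 2 := by
  have := abs_fwdDiff_line_le (n := 2) hφ hb x v
  simpa [fwdDiff_iter_two] using this

theorem abs_third_diff_le (hφ : ContDiff ℝ 3 φ)
    (hb : ∀ x, ‖iteratedFDeriv ℝ 3 φ x‖ ≤ L) (x v : F) :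
    |φ (x + (3 : ℝ) • v) - 3 * φ (x + (2 : ℝ) • v) + 3 * φ (x + v) - φ x| ≤ L * ‖v‖ ^ 3 := by
  have := abs_fwdDiff_line_le (n := 3) hφ hb x v
  simpa [fwdDiff_iter_three] using this

theorem abs_mixed_diff_le (hφ : ContDiff ℝ 2 φ)
    (hb : ∀ x, ‖iteratedFDeriv ℝ 2 φ x‖ ≤ L) (x a b : F) :
    |φ (x + a + b) - φ (x + a) - φ (x + b) + φ x| ≤ L * ‖a‖ * ‖b‖ := by
  have hd := hφ.differentiable (by norm_num)
  have hd2 : Differentiable ℝ (fderiv ℝ φ) :=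
    (hφ.fderiv_right (m := 1) (by norm_num)).differentiable (by norm_num)
  have hlip : ∀ y, ‖fderiv ℝ φ (y + a) - fderiv ℝ φ y‖ ≤ L * ‖a‖ := fun y => by
    have := Convex.norm_image_sub_le_of_norm_fderiv_le (𝕜 := ℝ) (f := fderiv ℝ φ) (C := L)
      (fun z _ => hd2 z) (fun z _ => ?_) convex_univ (mem_univ y) (mem_univ (y + a))
    · simpa using this
    · rw [← norm_iteratedFDeriv_one, norm_iteratedFDeriv_fderiv]
      exact hb z
  have hda : Differentiable ℝ fun y => φ (y + a) := hd.comp (differentiable_id.add_const a)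
  have := Convex.norm_image_sub_le_of_norm_fderiv_le (𝕜 := ℝ) (f := fun y => φ (y + a) - φ y)
      (C := L * ‖a‖) (fun z _ => (hda z).sub (hd z))
      (fun z _ => ?_) convex_univ (mem_univ x) (mem_univ (x + b))
  · rw [Real.norm_eq_abs, add_sub_cancel_left] at this
    convert this using 2
    rw [add_right_comm]
    ring
  · have e : fderiv ℝ (fun y => φ (y + a) - φ y) z = fderiv ℝ φ (z + a) - fderiv ℝ φ z := by
      rw [fderiv_fun_sub (hda z) (hd z),
        fderiv_comp_add_right]
    rw [e]
    exact hlip z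

theorem abs_second_diff_curve_le (h1 : ContDiff ℝ 2 φ)
    (hb1 : ∀ x, ‖iteratedFDeriv ℝ 1 φ x‖ ≤ L) (hb2 : ∀ x, ‖iteratedFDeriv ℝ 2 φ x‖ ≤ L)
    (x a b : F) :
    |φ (x + (2 : ℝ) • a + b) - 2 * φ (x + a) + φ x| ≤ L * (‖b‖ + ‖a‖ ^ 2) := by
  have e1 := abs_le.1 (abs_sub_le_of_iteratedFDeriv (h1.of_le (by norm_num)) hb1 (x + (2 : ℝ) • a) b)
  have e2 := abs_le.1 (abs_second_diff_le h1 hb2 x a)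
  rw [abs_le]
  constructor <;> linarith

theorem abs_third_diff_curve_le (h1 : ContDiff ℝ 3 φ)
    (hb1 : ∀ x, ‖iteratedFDeriv ℝ 1 φ x‖ ≤ L) (hb2 : ∀ x, ‖iteratedFDeriv ℝ 2 φ x‖ ≤ L)
    (hb3 : ∀ x, ‖iteratedFDeriv ℝ 3 φ x‖ ≤ L) (x a b c : F) :
    |φ (x + (3 : ℝ) • a + (3 : ℝ) • b + c) - 3 * φ (x + (2 : ℝ) • a + b) + 3 * φ (x + a) - φ x| ≤
      3 * L * (‖c‖ + (‖a‖ + ‖b‖) * ‖b‖ + ‖a‖ ^ 3) := by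
  have h2 : ContDiff ℝ 2 φ := h1.of_le (by norm_num)
  have hL : 0 ≤ L := (norm_nonneg _).trans (hb1 x)
  have e1 := abs_le.1 (abs_sub_le_of_iteratedFDeriv (h1.of_le (by norm_num)) hb1
    (x + (3 : ℝ) • a + (3 : ℝ) • b) c)
  have e2 := abs_le.1 (abs_third_diff_le h1 hb3 x a)
  have e3 := abs_le.1 (abs_second_diff_le h2 hb2 (x + (3 : ℝ) • a) b)
  have e4 := abs_le.1 (abs_second_diff_le h2 hb2 (x + (3 : ℝ) • a + b) b)
  have e5 := abs_le.1 (abs_mixed_diff_le h2 hb2 (x + (2 : ℝ) • a) a b)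
  have v1 : x + (3 : ℝ) • a + b + (2 : ℝ) • b = x + (3 : ℝ) • a + (3 : ℝ) • b := by module
  have v2 : x + (3 : ℝ) • a + b + b = x + (3 : ℝ) • a + (2 : ℝ) • b := by module
  have v3 : x + (2 : ℝ) • a + a = x + (3 : ℝ) • a := by module
  rw [v1, v2] at e4
  rw [v3] at e5
  have := mul_nonneg hL (norm_nonneg c)
  have := mul_nonneg hL (pow_nonneg (norm_nonneg a) 3)
  rw [abs_le]
  constructor <;> linarith

end Differences

section TorusDifferences

variable {d : ℕ} {l L : ℝ} {φ : E d → ℝ}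

/-- Periodic functions with bounded derivatives up to order three. -/
structure IsTorusBdd (l L : ℝ) (φ : E d → ℝ) : Prop where
  smooth : ContDiff ℝ 3 φ
  per : HasPeriods (boxPeriods d l) φ
  bdd : ∀ i ∈ Finset.Icc 1 3, ∀ x, ‖iteratedFDeriv ℝ i φ x‖ ≤ L

theorem IsTorusBdd.nonneg (hφ : IsTorusBdd l L φ) : 0 ≤ L :=
  (norm_nonneg _).trans (hφ.bdd 1 (by decide) 0)

theorem abs_sub_le_torusN (hl : 0 < l) (hp : HasPeriods (boxPeriods d l) φ) (hL : 0 ≤ L)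
    (hφ : ∀ x y, |φ x - φ y| ≤ L * ‖x - y‖) {ε : ℝ} (hε : 0 ≤ ε) (x y : E d) :
    |φ x - φ y| ≤ L * l * torusN l ε (x - y) := by
  obtain ⟨γ, hγ, h⟩ := exists_norm_sub_le_torusN hl hε (x - y)
  have e : φ x = φ (x - γ) := by rw [← hp.closure γ hγ (x - γ), sub_add_cancel]
  rw [e, mul_assoc]
  refine (hφ _ _).trans (mul_le_mul_of_nonneg_left ?_ hL)
  rwa [sub_right_comm] at h

theorem IsTorusBdd.abs_sub_le (hφ : IsTorusBdd l L φ) (x y : E d) :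
    |φ x - φ y| ≤ L * ‖x - y‖ := by
  have := abs_sub_le_of_iteratedFDeriv (hφ.smooth.of_le (by norm_num)) (hφ.bdd 1 (by decide))
    y (x - y)
  rwa [add_sub_cancel] at this

/-- The homogeneous weight controlling third differences. -/
def cubicWeight (a b c : ℝ) : ℝ := c + (a + b) * b + a ^ 3

theorem cubicWeight_mono {a b c a' b' c' : ℝ} (ha : 0 ≤ a) (hb : 0 ≤ b) (haa : a ≤ a')
    (hbb : b ≤ b') (hcc : c ≤ c') : cubicWeight a b c ≤ cubicWeight a' b' c' := by
  have h1 : 0 ≤ a' + b' := by linarith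
  unfold cubicWeight
  gcongr

variable {ε : ℝ}

theorem IsTorusBdd.abs_second_diff_le (hφ : IsTorusBdd l L φ) (hl : 0 < l) (hε : 0 ≤ ε)
    (x₀ x₁ x₂ : E d) : |φ x₂ - 2 * φ x₁ + φ x₀| ≤ L * (l + l ^ 2) *
      (torusN l ε (x₂ - (2 : ℝ) • x₁ + x₀) + torusN l ε (x₁ - x₀) ^ 2) := by
  obtain ⟨α, hα, ha⟩ := exists_norm_sub_le_torusN hl hε (x₁ - x₀)
  obtain ⟨β, hβ, hb⟩ := exists_norm_sub_le_torusN hl hε (x₂ - (2 : ℝ) • x₁ + x₀)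
  have hL := hφ.nonneg
  have h := abs_second_diff_curve_le (hφ.smooth.of_le (by norm_num)) (hφ.bdd 1 (by decide))
    (hφ.bdd 2 (by decide)) x₀ (x₁ - x₀ - α) (x₂ - (2 : ℝ) • x₁ + x₀ - β)
  have e1 : φ (x₀ + (x₁ - x₀ - α)) = φ x₁ := by
    rw [← hφ.per.closure α hα]; congr 1; module
  have e2 : φ (x₀ + (2 : ℝ) • (x₁ - x₀ - α) + (x₂ - (2 : ℝ) • x₁ + x₀ - β)) = φ x₂ := by
    rw [← hφ.per.closure (2 • α + β) (add_mem (nsmul_mem hα 2) hβ)]; congr 1; module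
  rw [e1, e2] at h
  refine h.trans ?_
  rw [mul_assoc]
  refine mul_le_mul_of_nonneg_left ?_ hL
  have h3 : ‖x₁ - x₀ - α‖ ^ 2 ≤ (l * torusN l ε (x₁ - x₀)) ^ 2 := by gcongr
  have := torusN_nonneg (l := l) (ε := ε) (x₂ - (2 : ℝ) • x₁ + x₀)
  nlinarith [mul_nonneg (sq_nonneg l) this,
    mul_nonneg hl.le (sq_nonneg (torusN l ε (x₁ - x₀)))]

theorem IsTorusBdd.abs_third_diff_le (hφ : IsTorusBdd l L φ) (hl : 0 < l) (hε : 0 ≤ ε)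
    (x₀ x₁ x₂ x₃ : E d) : |φ x₃ - 3 * φ x₂ + 3 * φ x₁ - φ x₀| ≤ 3 * L * (l + l ^ 2 + l ^ 3) *
      cubicWeight (torusN l ε (x₁ - x₀)) (torusN l ε (x₂ - (2 : ℝ) • x₁ + x₀))
        (torusN l ε (x₃ - (3 : ℝ) • x₂ + (3 : ℝ) • x₁ - x₀)) := by
  obtain ⟨α, hα, ha⟩ := exists_norm_sub_le_torusN hl hε (x₁ - x₀)
  obtain ⟨β, hβ, hb⟩ := exists_norm_sub_le_torusN hl hε (x₂ - (2 : ℝ) • x₁ + x₀)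
  obtain ⟨γ, hγ, hc⟩ := exists_norm_sub_le_torusN hl hε (x₃ - (3 : ℝ) • x₂ + (3 : ℝ) • x₁ - x₀)
  have hL := hφ.nonneg
  have h := abs_third_diff_curve_le hφ.smooth (hφ.bdd 1 (by decide))
    (hφ.bdd 2 (by decide)) (hφ.bdd 3 (by decide)) x₀ (x₁ - x₀ - α)
    (x₂ - (2 : ℝ) • x₁ + x₀ - β) (x₃ - (3 : ℝ) • x₂ + (3 : ℝ) • x₁ - x₀ - γ)
  have e1 : φ (x₀ + (x₁ - x₀ - α)) = φ x₁ := by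
    rw [← hφ.per.closure α hα]; congr 1; module
  have e2 : φ (x₀ + (2 : ℝ) • (x₁ - x₀ - α) + (x₂ - (2 : ℝ) • x₁ + x₀ - β)) = φ x₂ := by
    rw [← hφ.per.closure (2 • α + β) (add_mem (nsmul_mem hα 2) hβ)]; congr 1; module
  have e3 : φ (x₀ + (3 : ℝ) • (x₁ - x₀ - α) + (3 : ℝ) • (x₂ - (2 : ℝ) • x₁ + x₀ - β) +
      (x₃ - (3 : ℝ) • x₂ + (3 : ℝ) • x₁ - x₀ - γ)) = φ x₃ := by
    rw [← hφ.per.closure (3 • α + 3 • β + γ) (add_mem (add_mem (nsmul_mem hα 3)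
      (nsmul_mem hβ 3)) hγ)]
    congr 1; module
  rw [e1, e2, e3] at h
  refine h.trans ?_
  rw [mul_assoc (3 * L)]
  refine mul_le_mul_of_nonneg_left ?_ (by positivity)
  set A := torusN l ε (x₁ - x₀)
  set B := torusN l ε (x₂ - (2 : ℝ) • x₁ + x₀)
  set C := torusN l ε (x₃ - (3 : ℝ) • x₂ + (3 : ℝ) • x₁ - x₀)
  have hA : 0 ≤ A := torusN_nonneg _
  have hB : 0 ≤ B := torusN_nonneg _
  have hC : 0 ≤ C := torusN_nonneg _
  refine (cubicWeight_mono (norm_nonneg _) (norm_nonneg _) ha hb hc).trans ?_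
  unfold cubicWeight
  have h1 : (l * A + l * B) * (l * B) = l ^ 2 * ((A + B) * B) := by ring
  rw [h1, mul_pow]
  have p1 : 0 ≤ (A + B) * B := by positivity
  have p2 : 0 ≤ A ^ 3 := by positivity
  have l1 : l ≤ l + l ^ 2 + l ^ 3 := by nlinarith [pow_pos hl 3]
  have l2 : l ^ 2 ≤ l + l ^ 2 + l ^ 3 := by nlinarith [pow_pos hl 3]
  have l3 : l ^ 3 ≤ l + l ^ 2 + l ^ 3 := by nlinarith [pow_pos hl 3]
  have := mul_le_mul_of_nonneg_right l1 hC
  have := mul_le_mul_of_nonneg_right l2 p1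
  have := mul_le_mul_of_nonneg_right l3 p2
  linarith

end TorusDifferences

section LogSol

variable {d : ℕ} {l T Λ : ℝ} {w : ℝ → Fin d → E d → ℝ} {r : ℝ → E d → ℝ}

/-- Logarithms of periodic densities transported by the bounded velocity field `w`. -/
structure IsLogSol (l T Λ : ℝ) (w : ℝ → Fin d → E d → ℝ) (r : ℝ → E d → ℝ) : Prop where
  nonneg : 0 ≤ Λ
  smooth : ∀ t, ContDiff ℝ (⊤ : ℕ∞) (r t)
  per : ∀ t, HasPeriods (boxPeriods d l) (r t)
  smooth_w : ∀ t i, ContDiff ℝ (⊤ : ℕ∞) (w t i)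
  per_w : ∀ t ∈ Icc 0 T, ∀ i, HasPeriods (boxPeriods d l) (w t i)
  w_le : ∀ t ∈ Icc 0 T, ∀ i x, |w t i x| ≤ Λ
  div_le : ∀ t ∈ Icc 0 T, ∀ x, |∑ i, fderiv ℝ (w t i) x (uvec d i)| ≤ Λ
  deriv : ∀ t x, HasDerivAt (fun s => r s x) (-(∑ i, w t i x * fderiv ℝ (r t) x (uvec d i)) -
    ∑ i, fderiv ℝ (w t i) x (uvec d i)) t

theorem HasPeriods.sum {ι W : Type*} [Add W] [Fintype ι] {Γ : Set W} {g : ι → W → ℝ}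
    (hg : ∀ i, HasPeriods Γ (g i)) : HasPeriods Γ fun x => ∑ i, g i x := fun γ hγ x =>
  Finset.sum_congr rfl fun i _ => hg i γ hγ x

theorem IsLogSol.isLinSol (h : IsLogSol l T Λ w r) (hl : 0 < l) (c : ℝ) :
    IsLinSol (volume.restrict (box d l)) (boxPeriods d l) (uvec d) T 0 ((1 + |c|) * Λ)
      (fun t i x => -w t i x) (fun t x => -c * ∑ i, fderiv ℝ (w t i) x (uvec d i))
      (fun t x => Real.exp (c * r t x)) := by
  have hΛ := h.nonneg
  have hc := mul_nonneg (abs_nonneg c) hΛ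
  have hdw : ∀ t i, Differentiable ℝ (w t i) := fun t i => (h.smooth_w t i).differentiable (by simp)
  refine ⟨(isCompactCell_box hl).isPeriodCell, le_rfl, by positivity, fun t _ => ?_,
    fun t _ x => Real.exp_pos _, fun t _ => (h.per t).comp fun y => Real.exp (c * y),
    fun t ht i => ?_, fun t ht i => (h.per_w t ht i).comp fun y => -y, fun t ht i x => ?_,
    fun t ht x => ?_, fun t ht => ?_, fun t ht => ?_, fun t ht x => ?_, fun t ht x => ?_⟩
  · exact Real.contDiff_exp.comp (contDiff_const.mul (contDiff_infty.1 (h.smooth t) 2))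
  · exact (contDiff_infty.1 (h.smooth_w t i) 1).neg
  · rw [abs_neg]
    linarith [h.w_le t ht i x]
  · simp only [fderiv_fun_neg, neg_apply, Finset.sum_neg_distrib, abs_neg]
    linarith [h.div_le t ht x]
  · refine continuous_const.mul (continuous_finsetSum _ fun i _ => ?_)
    exact continuous_fderiv_apply_const (h.smooth_w t i) (by simp) _
  · exact (HasPeriods.sum fun i => (h.per_w t ht i).fderiv_apply _).comp fun y => -c * y
  · rw [abs_mul, abs_neg]
    nlinarith [mul_le_mul_of_nonneg_left (h.div_le t ht x) (abs_nonneg c)]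
  · have hd : DifferentiableAt ℝ (r t) x := (h.smooth t).differentiable (by simp) x
    have hf : HasFDerivAt (fun x => Real.exp (c * r t x)) _ x := (hd.hasFDerivAt.const_mul c).exp
    refine ((h.deriv t x).const_mul c).exp.congr_deriv ?_
    unfold linOp
    rw [hf.fderiv]
    simp only [smul_apply, smul_eq_mul, zero_mul, zero_add]
    rw [Finset.sum_congr rfl fun i _ => (by ring : -w t i x * (Real.exp (c * r t x) *
      (c * fderiv ℝ (r t) x (uvec d i))) = (-(Real.exp (c * r t x) * c)) *
        (w t i x * fderiv ℝ (r t) x (uvec d i))), ← Finset.mul_sum]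
    ring

end LogSol

section Doubling

theorem le_apply_zero_of_forall_small {a : ℝ} {F : ℝ → ℝ} (hF : Continuous F)
    (h : ∀ s, 0 < s → s ≤ 1 → a ≤ F s) : a ≤ F 0 := by
  refine ge_of_tendsto ((hF.tendsto 0).mono_left nhdsWithin_le_nhds : Tendsto F (𝓝[>] 0) _) ?_
  filter_upwards [Ioc_mem_nhdsGT (zero_lt_one (α := ℝ))] with s hs using h s hs.1 hs.2

theorem sum_mul_apply_eq {W ι : Type*} [NormedAddCommGroup W] [NormedSpace ℝ W] [Fintype ι]
    (L : W →L[ℝ] ℝ) (b : ι → ℝ) (v : ι → W) : ∑ i, b i * L (v i) = L (∑ i, b i • v i) := by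
  simp only [map_sum, map_smul, smul_eq_mul]

theorem fderiv_comp_clm_apply {W W' : Type*} [NormedAddCommGroup W] [NormedSpace ℝ W]
    [NormedAddCommGroup W'] [NormedSpace ℝ W'] {g : W' → ℝ} (hg : Differentiable ℝ g)
    (A : W →L[ℝ] W') (z V : W) : fderiv ℝ (fun z => g (A z)) z V = fderiv ℝ g (A z) (A V) := by
  have := ((hg (A z)).hasFDerivAt.comp z A.hasFDerivAt).fderiv
  rw [show (fun z => g (A z)) = g ∘ A from rfl, this]
  rfl

theorem sum_prodField_smul {W₁ W₂ ι₁ ι₂ : Type*} [NormedAddCommGroup W₁] [NormedSpace ℝ W₁]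
    [NormedAddCommGroup W₂] [NormedSpace ℝ W₂] [Fintype ι₁] [Fintype ι₂] {v₁ : ι₁ → W₁}
    {v₂ : ι₂ → W₂} {b₁ : ι₁ → W₁ → ℝ} {b₂ : ι₂ → W₂ → ℝ} (z : W₁ × W₂) :
    ∑ i, prodField b₁ b₂ i z • prodVec v₁ v₂ i =
      (∑ i, b₁ i z.1 • v₁ i, ∑ i, b₂ i z.2 • v₂ i) := by
  rw [Fintype.sum_sum_type]
  ext <;> simp [Prod.fst_sum, Prod.snd_sum, prodField, prodVec]

variable {d : ℕ} {l T Λ : ℝ} {w : ℝ → Fin d → E d → ℝ} {r : ℝ → E d → ℝ}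

theorem norm_sum_smul_uvec_le {c : Fin d → ℝ} {B : ℝ} (hc : ∀ i, |c i| ≤ B) :
    ‖∑ i, c i • uvec d i‖ ≤ d * B := by
  refine (norm_sum_le _ _).trans ?_
  have : ∀ i ∈ (Finset.univ : Finset (Fin d)), ‖c i • uvec d i‖ ≤ B := fun i _ => by
    simpa [norm_smul, uvec] using hc i
  refine (Finset.sum_le_card_nsmul _ _ _ this).trans_eq ?_
  rw [Finset.card_univ, Fintype.card_fin, nsmul_eq_mul]

theorem hasPeriods_prodPeriods_comp {W₁ W₂ W β : Type*} [NormedAddCommGroup W₁]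
    [NormedAddCommGroup W₂] [AddCommGroup W] {Γ₁ : Set W₁} {Γ₂ : Set W₂} {Γ : Set W} {g : W → β}
    (hg : HasPeriods (AddSubgroup.closure Γ : Set W) g) (A : W₁ × W₂ →+ W)
    (h₁ : ∀ γ ∈ Γ₁, A (γ, 0) ∈ AddSubgroup.closure Γ)
    (h₂ : ∀ γ ∈ Γ₂, A (0, γ) ∈ AddSubgroup.closure Γ) :
    HasPeriods (prodPeriods Γ₁ Γ₂) fun z => g (A z) := by
  rintro ⟨c₁, c₂⟩ (⟨h1, h2⟩ | ⟨h1, h2⟩) z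
  · simp only at h1 h2
    change g (A (z + (c₁, c₂))) = g (A z)
    rw [map_add, h2]
    exact hg _ (h₁ _ h1) _
  · simp only at h1 h2
    change g (A (z + (c₁, c₂))) = g (A z)
    rw [map_add, h1]
    exact hg _ (h₂ _ h2) _

theorem isFiniteMeasure_restrict {W : Type*} [TopologicalSpace W] [MeasureSpace W]
    [IsFiniteMeasureOnCompacts (volume : Measure W)] {S : Set W} (hS : IsCompact S) :
    IsFiniteMeasure (volume.restrict S) :=
  ⟨by rw [Measure.restrict_apply_univ]; exact hS.measure_lt_top⟩

/-- Propagation of Lipschitz bounds along a transport equation, by doubling of variables. -/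
theorem IsLogSol.exists_lipschitz (h : IsLogSol l T Λ w r) (hl : 0 < l) {L M₀ : ℝ} (hL : 0 ≤ L)
    (hM : 0 ≤ M₀) (hw : ∀ t ∈ Icc 0 T, ∀ i x y, |w t i x - w t i y| ≤ L * ‖x - y‖)
    (hdiv : ∀ t ∈ Icc 0 T, ∀ x y, |∑ i, fderiv ℝ (w t i) x (uvec d i) -
      ∑ i, fderiv ℝ (w t i) y (uvec d i)| ≤ L * ‖x - y‖)
    (h0 : ∀ x y, |r 0 x - r 0 y| ≤ M₀ * ‖x - y‖) :
    ∃ C, 0 ≤ C ∧ ∀ t ∈ Icc 0 T, ∀ x y, |r t x - r t y| ≤ C * ‖x - y‖ := by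
  set κ := 2 * Real.pi / l * (d * (L * l)) + L * l with hκ
  have hκ0 : 0 ≤ κ := by positivity
  set M := 1 + M₀ * l with hMdef
  have hM1 : 1 ≤ M := by have : 0 ≤ M₀ * l := by positivity
                         linarith
  have hcell := (isCompactCell_box (d := d) hl).prod (isCompactCell_box (d := d) hl)
  have key : ∀ t ∈ Icc 0 T, ∀ x y, r t y - r t x ≤
      M * Real.exp (2 * κ * t) * (2 * Real.pi / l * ‖x - y‖) := by
    intro t ht x y
    have := le_apply_zero_of_forall_small (a := r t y - r t x)
      (F := fun s => M * Real.exp (2 * κ * t) * (s + 2 * Real.pi / l * ‖x - y‖)) (by fun_prop)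
      (fun s hs _ => ?_)
    · simpa using this
    have hε : 0 < s ^ 2 := by positivity
    have := isFiniteMeasure_restrict hcell.compact
    have hu := (h.isLinSol hl 1).prod (h.isLinSol hl (-1)) hcell.isPeriodCell
    have hper : HasPeriods (prodPeriods (boxPeriods d l) (boxPeriods d l))
        fun z : E d × E d => torusN l (s ^ 2) (z.1 - z.2) :=
      hasPeriods_prodPeriods_comp (hasPeriods_torusN hl).closure
        (AddMonoidHom.fst (E d) (E d) - AddMonoidHom.snd (E d) (E d))
        (fun γ hγ => by simpa using AddSubgroup.subset_closure hγ)
        (fun γ hγ => by simpa using AddSubgroup.subset_closure hγ)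
    have hsm : ContDiff ℝ 2 fun z : E d × E d => torusN l (s ^ 2) (z.1 - z.2) :=
      (contDiff_torusN hε).comp (contDiff_fst.sub contDiff_snd)
    have hfd : ∀ z V : E d × E d, fderiv ℝ (fun z : E d × E d => torusN l (s ^ 2) (z.1 - z.2)) z V =
        fderiv ℝ (torusN l (s ^ 2)) (z.1 - z.2) (V.1 - V.2) := fun z V => by
      exact fderiv_comp_clm_apply ((contDiff_torusN hε (n := 1)).differentiable (by norm_num))
        (ContinuousLinearMap.fst ℝ (E d) (E d) - ContinuousLinearMap.snd ℝ (E d) (E d)) z V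
    have h1 := hu.exp_neg_le hsm hper (fun z => torusN_nonneg _) hκ0 hM1
      (fun t ht z => ?_) (fun t ht z => ?_) (fun z => ?_) ht (x, y)
    · rw [← Real.exp_add, Real.exp_le_exp] at h1
      have h2 := torusN_le hl hε.le (x - y)
      rw [Real.sqrt_sq hs.le] at h2
      have h3 := mul_le_mul_of_nonneg_left h2 (by positivity : 0 ≤ M * Real.exp (2 * κ * t))
      simp only at h1
      linarith
    · rw [sum_mul_apply_eq, sum_prodField_smul, hfd]
      refine (abs_fderiv_torusN_le hl hε _ _).trans ?_
      have e : ∑ i, -w t i z.1 • uvec d i - ∑ i, -w t i z.2 • uvec d i =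
          ∑ i, (-w t i z.1 - -w t i z.2) • uvec d i := by
        rw [← Finset.sum_sub_distrib]
        exact Finset.sum_congr rfl fun i _ => (sub_smul _ _ _).symm
      simp only
      rw [e]
      have h2 := norm_sum_smul_uvec_le (c := fun i => -w t i z.1 - -w t i z.2)
        (B := L * l * torusN l (s ^ 2) (z.1 - z.2)) (fun i => by
          rw [neg_sub_neg, abs_sub_comm]
          exact abs_sub_le_torusN hl (h.per_w t ht i) hL (hw t ht i) hε.le z.1 z.2)
      have h3 := mul_le_mul_of_nonneg_left h2 (by positivity : 0 ≤ 2 * Real.pi / l)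
      have h4 := mul_nonneg (mul_nonneg hL hl.le) (torusN_nonneg (l := l) (ε := s ^ 2) (z.1 - z.2))
      rw [hκ]
      linarith
    · have h2 := abs_sub_le_torusN hl (HasPeriods.sum fun i =>
        (h.per_w t ht i).fderiv_apply (uvec d i)) hL (hdiv t ht) hε.le z.1 z.2
      have e : -1 * ∑ i, fderiv ℝ (w t i) z.1 (uvec d i) + -(-1) *
          ∑ i, fderiv ℝ (w t i) z.2 (uvec d i) = -(∑ i, fderiv ℝ (w t i) z.1 (uvec d i) -
          ∑ i, fderiv ℝ (w t i) z.2 (uvec d i)) := by ring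
      rw [e, abs_neg]
      refine h2.trans (mul_le_mul_of_nonneg_right ?_ (torusN_nonneg _))
      rw [hκ]
      have : 0 ≤ 2 * Real.pi / l * (d * (L * l)) := by positivity
      linarith
    · rw [← Real.exp_add, Real.exp_le_exp]
      have h2 := (abs_le.1 (abs_sub_le_torusN hl (h.per 0) hM h0 hε.le z.1 z.2)).1
      have h3 := torusN_nonneg (l := l) (ε := s ^ 2) (z.1 - z.2)
      rw [hMdef]
      linarith
  refine ⟨M * Real.exp (2 * κ * T) * (2 * Real.pi / l), by positivity, fun t ht x y => ?_⟩
  have hmono : M * Real.exp (2 * κ * t) * (2 * Real.pi / l * ‖x - y‖) ≤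
      M * Real.exp (2 * κ * T) * (2 * Real.pi / l) * ‖x - y‖ := by
    rw [mul_assoc _ _ ‖x - y‖]
    have := ht.2
    gcongr
  have h1 := key t ht x y
  have h2 := key t ht y x
  rw [norm_sub_rev] at h2
  rw [abs_le]
  constructor <;> linarith

end Doubling

section Tripling

variable {d : ℕ} {l T Λ : ℝ} {w : ℝ → Fin d → E d → ℝ} {r : ℝ → E d → ℝ}

theorem abs_cubicWeight_deriv_le {a b c a' b' c' P B : ℝ} (ha : 0 ≤ a) (hb : 0 ≤ b) (hc : 0 ≤ c)
    (hP : 0 ≤ P) (haB : a ≤ B) (ha' : |a'| ≤ P * a) (hb' : |b'| ≤ P * (b + a ^ 2))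
    (hc' : |c'| ≤ P * cubicWeight a b c) :
    |c' + ((a' + b') * b + (a + b) * b') + 3 * a ^ 2 * a'| ≤
      P * (7 + 2 * B) * cubicWeight a b c := by
  have h1 : |(a' + b') * b| ≤ P * (a + (b + a ^ 2)) * b := by
    rw [abs_mul, abs_of_nonneg hb]
    refine mul_le_mul_of_nonneg_right ((abs_add_le _ _).trans ?_) hb
    linarith
  have h2 : |(a + b) * b'| ≤ (a + b) * (P * (b + a ^ 2)) := by
    rw [abs_mul, abs_of_nonneg (add_nonneg ha hb)]
    exact mul_le_mul_of_nonneg_left hb' (add_nonneg ha hb)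
  have h3 : |3 * a ^ 2 * a'| ≤ 3 * a ^ 2 * (P * a) := by
    rw [abs_mul, abs_of_nonneg (by positivity : 0 ≤ 3 * a ^ 2)]
    exact mul_le_mul_of_nonneg_left ha' (by positivity)
  have h4 : a ^ 2 * b ≤ B * ((a + b) * b) := by
    have : a * (a * b) ≤ B * (a * b) := mul_le_mul_of_nonneg_right haB (by positivity)
    have h5 : 0 ≤ B * b ^ 2 := mul_nonneg (ha.trans haB) (sq_nonneg b)
    nlinarith
  have h5 : (a + (b + a ^ 2)) * b + (a + b) * (b + a ^ 2) + 3 * a ^ 2 * a + cubicWeight a b c ≤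
      (7 + 2 * B) * cubicWeight a b c := by
    unfold cubicWeight
    have h6 : 0 ≤ B * c := mul_nonneg (ha.trans haB) hc
    have h7 : 0 ≤ B * a ^ 3 := mul_nonneg (ha.trans haB) (by positivity)
    have h8 : 0 ≤ (a + b) * b := by positivity
    have h9 : 0 ≤ a ^ 3 := by positivity
    nlinarith
  have h6 := mul_le_mul_of_nonneg_left h5 hP
  have h7 := abs_add_le (c' + ((a' + b') * b + (a + b) * b')) (3 * a ^ 2 * a')
  have h8 := abs_add_le c' ((a' + b') * b + (a + b) * b')
  have h9 := abs_add_le ((a' + b') * b) ((a + b) * b')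
  linarith

theorem cubicWeight_nonneg {a b c : ℝ} (ha : 0 ≤ a) (hb : 0 ≤ b) (hc : 0 ≤ c) :
    0 ≤ cubicWeight a b c := by
  unfold cubicWeight
  positivity

theorem IsTorusBdd.norm_sum_smul_le {L l ε : ℝ} {w : Fin d → E d → ℝ}
    (hw : ∀ i, IsTorusBdd l L (w i)) (hL : 0 ≤ L) (hl : 0 < l) (hε : 0 ≤ ε) {P : ℝ}
    (hP : P = 2 * Real.pi / l * (d * (3 * L * (l + l ^ 2 + l ^ 3)))) (x₀ x₁ x₂ x₃ : E d) :
    2 * Real.pi / l * ‖∑ i, (w i x₁ - w i x₀) • uvec d i‖ ≤ P * torusN l ε (x₁ - x₀) ∧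
    2 * Real.pi / l * ‖∑ i, (w i x₂ - 2 * w i x₁ + w i x₀) • uvec d i‖ ≤
      P * (torusN l ε (x₂ - (2 : ℝ) • x₁ + x₀) + torusN l ε (x₁ - x₀) ^ 2) ∧
    2 * Real.pi / l * ‖∑ i, (w i x₃ - 3 * w i x₂ + 3 * w i x₁ - w i x₀) • uvec d i‖ ≤
      P * cubicWeight (torusN l ε (x₁ - x₀)) (torusN l ε (x₂ - (2 : ℝ) • x₁ + x₀))
        (torusN l ε (x₃ - (3 : ℝ) • x₂ + (3 : ℝ) • x₁ - x₀)) := by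
  have hπ : 0 ≤ 2 * Real.pi / l := by positivity
  have ha := torusN_nonneg (l := l) (ε := ε) (x₁ - x₀)
  have hb := torusN_nonneg (l := l) (ε := ε) (x₂ - (2 : ℝ) • x₁ + x₀)
  have l1 : L * l ≤ 3 * L * (l + l ^ 2 + l ^ 3) := by
    nlinarith [mul_nonneg hL hl.le, mul_nonneg hL (pow_pos hl 2).le, mul_nonneg hL (pow_pos hl 3).le]
  have l2 : L * (l + l ^ 2) ≤ 3 * L * (l + l ^ 2 + l ^ 3) := by
    nlinarith [mul_nonneg hL hl.le, mul_nonneg hL (pow_pos hl 2).le, mul_nonneg hL (pow_pos hl 3).le]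
  have aux : ∀ {c : Fin d → ℝ} {D Q : ℝ}, 0 ≤ Q → D ≤ 3 * L * (l + l ^ 2 + l ^ 3) →
      (∀ i, |c i| ≤ D * Q) → 2 * Real.pi / l * ‖∑ i, c i • uvec d i‖ ≤ P * Q := by
    intro c D Q hQ hD hc
    have h1 := norm_sum_smul_uvec_le fun i => (hc i).trans (mul_le_mul_of_nonneg_right hD hQ)
    have h2 := mul_le_mul_of_nonneg_left h1 hπ
    rw [hP]
    linarith
  refine ⟨aux ha l1 fun i => ?_, aux (by positivity) l2 fun i => ?_,
    aux (cubicWeight_nonneg ha hb (torusN_nonneg _)) le_rfl fun i => ?_⟩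
  · exact abs_sub_le_torusN hl (hw i).per hL (hw i).abs_sub_le hε x₁ x₀
  · exact (hw i).abs_second_diff_le hl hε _ _ _
  · exact (hw i).abs_third_diff_le hl hε _ _ _ _

/-- Propagation of third order bounds along a transport equation. -/
theorem IsLogSol.exists_third_diff_ge (h : IsLogSol l T Λ w r) (hl : 0 < l) {L M₀ : ℝ}
    (hL : 0 ≤ L) (hw : ∀ t ∈ Icc 0 T, ∀ i, IsTorusBdd l L (w t i))
    (hdiv : ∀ t ∈ Icc 0 T, IsTorusBdd l L fun x => ∑ i, fderiv ℝ (w t i) x (uvec d i))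
    (h0 : IsTorusBdd l M₀ (r 0)) :
    ∃ C, 0 ≤ C ∧ ∀ t ∈ Icc 0 T, ∀ x v, -(C * ‖v‖ ^ 3) ≤ r t (x + (3 : ℝ) • v) -
      3 * r t (x + (2 : ℝ) • v) + 3 * r t (x + v) - r t x := by
  have hM₀ := h0.nonneg
  set P := 2 * Real.pi / l * (d * (3 * L * (l + l ^ 2 + l ^ 3))) with hP
  have hP0 : 0 ≤ P := by positivity
  set Q := 3 * L * (l + l ^ 2 + l ^ 3) with hQ
  have hQ0 : 0 ≤ Q := by positivity
  set κ := P * (7 + 2 * (2 * d + 1)) + Q with hκ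
  have hκ0 : 0 ≤ κ := by positivity
  set M := 1 + 3 * M₀ * (l + l ^ 2 + l ^ 3) with hMdef
  have hM1 : 1 ≤ M := by have : 0 ≤ 3 * M₀ * (l + l ^ 2 + l ^ 3) := by positivity
                         linarith
  have hbox := isCompactCell_box (d := d) hl
  have hcell2 := hbox.prod hbox
  have hcell := hcell2.prod hcell2
  have : (volume : Measure ((E d × E d) × (E d × E d))).IsOpenPosMeasure :=
    Measure.prod.instIsOpenPosMeasure
  let p0 : (E d × E d) × (E d × E d) →L[ℝ] E d :=
    (ContinuousLinearMap.fst ℝ _ _).comp (ContinuousLinearMap.fst ℝ _ _)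
  let p1 : (E d × E d) × (E d × E d) →L[ℝ] E d :=
    (ContinuousLinearMap.snd ℝ _ _).comp (ContinuousLinearMap.fst ℝ _ _)
  let p2 : (E d × E d) × (E d × E d) →L[ℝ] E d :=
    (ContinuousLinearMap.fst ℝ _ _).comp (ContinuousLinearMap.snd ℝ _ _)
  let p3 : (E d × E d) × (E d × E d) →L[ℝ] E d :=
    (ContinuousLinearMap.snd ℝ _ _).comp (ContinuousLinearMap.snd ℝ _ _)
  let La := p1 - p0
  let Lb := p2 - (2 : ℝ) • p1 + p0
  let Lc := p3 - (3 : ℝ) • p2 + (3 : ℝ) • p1 - p0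
  set Γ := prodPeriods (prodPeriods (boxPeriods d l) (boxPeriods d l))
    (prodPeriods (boxPeriods d l) (boxPeriods d l)) with hΓ
  set H := AddSubgroup.closure (boxPeriods d l) with hH
  have hp : ∀ γ ∈ Γ, p0 γ ∈ H ∧ p1 γ ∈ H ∧ p2 γ ∈ H ∧ p3 γ ∈ H := by
    have hcl : ∀ γ ∈ prodPeriods (boxPeriods d l) (boxPeriods d l), γ.1 ∈ H ∧ γ.2 ∈ H := by
      rintro γ (⟨h1, h2⟩ | ⟨h1, h2⟩)
      · exact ⟨AddSubgroup.subset_closure h1, h2 ▸ zero_mem _⟩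
      · exact ⟨h1 ▸ zero_mem _, AddSubgroup.subset_closure h2⟩
    rintro ⟨γ₁, γ₂⟩ (⟨h1, h2⟩ | ⟨h1, h2⟩) <;> simp only at h1 h2
    · subst h2
      exact ⟨(hcl _ h1).1, (hcl _ h1).2, zero_mem _, zero_mem _⟩
    · subst h1
      exact ⟨zero_mem _, zero_mem _, (hcl _ h2).1, (hcl _ h2).2⟩
  have h2s : ∀ y ∈ H, (2 : ℝ) • y ∈ H := fun y hy => by
    rw [ofNat_smul_eq_nsmul ℝ 2 y]; exact nsmul_mem hy _
  have h3s : ∀ y ∈ H, (3 : ℝ) • y ∈ H := fun y hy => by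
    rw [ofNat_smul_eq_nsmul ℝ 3 y]; exact nsmul_mem hy _
  have hLper : ∀ (ε : ℝ) (A : (E d × E d) × (E d × E d) →L[ℝ] E d), (∀ γ ∈ Γ, A γ ∈ H) →
      HasPeriods Γ fun z => torusN l ε (A z) := fun ε A hA γ hγ z => by
    simp only [map_add]
    exact (hasPeriods_torusN hl).closure _ (hA γ hγ) _
  have hperA : ∀ ε, HasPeriods Γ fun z => torusN l ε (La z) := fun ε =>
    hLper ε La fun γ hγ => sub_mem (hp γ hγ).2.1 (hp γ hγ).1
  have hperB : ∀ ε, HasPeriods Γ fun z => torusN l ε (Lb z) := fun ε =>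
    hLper ε Lb fun γ hγ => add_mem (sub_mem (hp γ hγ).2.2.1 (h2s _ (hp γ hγ).2.1)) (hp γ hγ).1
  have hperC : ∀ ε, HasPeriods Γ fun z => torusN l ε (Lc z) := fun ε =>
    hLper ε Lc fun γ hγ => sub_mem (add_mem (sub_mem (hp γ hγ).2.2.2 (h3s _ (hp γ hγ).2.2.1))
      (h3s _ (hp γ hγ).2.1)) (hp γ hγ).1
  refine ⟨M * Real.exp (2 * κ * T) * (2 * Real.pi / l) ^ 3, by positivity, fun t ht x v => ?_⟩
  have hkey := le_apply_zero_of_forall_small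
    (a := -(r t (x + (3 : ℝ) • v) - 3 * r t (x + (2 : ℝ) • v) + 3 * r t (x + v) - r t x))
    (F := fun s => M * Real.exp (2 * κ * t) * cubicWeight (s + 2 * Real.pi / l * ‖v‖) s s)
    (by unfold cubicWeight; fun_prop) (fun s hs hs1 => ?_)
  · have h1 : Real.exp (2 * κ * t) ≤ Real.exp (2 * κ * T) := by
      have := ht.2
      gcongr
    have h2 := mul_le_mul_of_nonneg_left (mul_le_mul_of_nonneg_right h1
      (by positivity : 0 ≤ (2 * Real.pi / l * ‖v‖) ^ 3)) (zero_le_one.trans hM1)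
    simp only [cubicWeight] at hkey
    rw [mul_pow] at h2
    ring_nf at hkey h2 ⊢
    linarith
  have hε : 0 < s ^ 2 := by positivity
  have hε1 : s ^ 2 ≤ 1 := by nlinarith
  have := isFiniteMeasure_restrict hcell.compact
  have hu := ((h.isLinSol hl (-1)).prod (h.isLinSol hl 3) hcell2.isPeriodCell).prod
    ((h.isLinSol hl (-3)).prod (h.isLinSol hl 1) hcell2.isPeriodCell) hcell.isPeriodCell
  have hN : ∀ A : (E d × E d) × (E d × E d) →L[ℝ] E d,
      ContDiff ℝ 2 fun z => torusN l (s ^ 2) (A z) := fun A => (contDiff_torusN hε).comp A.contDiff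
  have hNd : ∀ (A : (E d × E d) × (E d × E d) →L[ℝ] E d) z, HasFDerivAt
      (fun z => torusN l (s ^ 2) (A z)) (fderiv ℝ (fun z => torusN l (s ^ 2) (A z)) z) z :=
    fun A z => (((hN A).differentiable (by norm_num)) z).hasFDerivAt
  have hNfd : ∀ (A : (E d × E d) × (E d × E d) →L[ℝ] E d) z V,
      |fderiv ℝ (fun z => torusN l (s ^ 2) (A z)) z V| ≤ 2 * Real.pi / l * ‖A V‖ := fun A z V => by
    rw [fderiv_comp_clm_apply ((contDiff_torusN hε (n := 1)).differentiable (by norm_num))]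
    exact abs_fderiv_torusN_le hl hε _ _
  set Φ : (E d × E d) × (E d × E d) → ℝ := fun z => cubicWeight (torusN l (s ^ 2) (La z))
    (torusN l (s ^ 2) (Lb z)) (torusN l (s ^ 2) (Lc z)) with hΦ
  have hΦ0 : ∀ z, 0 ≤ Φ z := fun z =>
    cubicWeight_nonneg (torusN_nonneg _) (torusN_nonneg _) (torusN_nonneg _)
  have hΦs : ContDiff ℝ 2 Φ :=
    ((hN Lc).add (((hN La).add (hN Lb)).mul (hN Lb))).add ((hN La).pow 3)
  have hΦp : HasPeriods Γ Φ := fun γ hγ z => by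
    simp only [hΦ]
    rw [show torusN l (s ^ 2) (La (z + γ)) = _ from hperA _ γ hγ z,
      show torusN l (s ^ 2) (Lb (z + γ)) = _ from hperB _ γ hγ z,
      show torusN l (s ^ 2) (Lc (z + γ)) = _ from hperC _ γ hγ z]
  have hΦd : ∀ z V, fderiv ℝ Φ z V = fderiv ℝ (fun z => torusN l (s ^ 2) (Lc z)) z V +
      ((fderiv ℝ (fun z => torusN l (s ^ 2) (La z)) z V +
        fderiv ℝ (fun z => torusN l (s ^ 2) (Lb z)) z V) * torusN l (s ^ 2) (Lb z) +
      (torusN l (s ^ 2) (La z) + torusN l (s ^ 2) (Lb z)) *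
        fderiv ℝ (fun z => torusN l (s ^ 2) (Lb z)) z V) +
      3 * torusN l (s ^ 2) (La z) ^ 2 * fderiv ℝ (fun z => torusN l (s ^ 2) (La z)) z V :=
    fun z V => by
      have := (((hNd Lc z).add (((hNd La z).add (hNd Lb z)).mul (hNd Lb z))).add
        ((hNd La z).pow 3)).fderiv
      rw [show Φ = _ from rfl]
      refine (DFunLike.congr_fun this V).trans ?_
      simp
      ring
  have h1 := hu.exp_neg_le hΦs hΦp hΦ0 hκ0 hM1
      (fun t ht z => ?_) (fun t ht z => ?_) (fun z => ?_) ht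
      ((x, x + v), (x + (2 : ℝ) • v, x + (3 : ℝ) • v))
  · rw [← Real.exp_add, ← Real.exp_add, ← Real.exp_add, Real.exp_le_exp] at h1
    have hΦle : Φ ((x, x + v), (x + (2 : ℝ) • v, x + (3 : ℝ) • v)) ≤
        cubicWeight (s + 2 * Real.pi / l * ‖v‖) s s := by
      have ea : La ((x, x + v), (x + (2 : ℝ) • v, x + (3 : ℝ) • v)) = v := by
        change x + v - x = v
        abel
      have eb : Lb ((x, x + v), (x + (2 : ℝ) • v, x + (3 : ℝ) • v)) = 0 := by
        change x + (2 : ℝ) • v - (2 : ℝ) • (x + v) + x = 0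
        module
      have ec : Lc ((x, x + v), (x + (2 : ℝ) • v, x + (3 : ℝ) • v)) = 0 := by
        change x + (3 : ℝ) • v - (3 : ℝ) • (x + (2 : ℝ) • v) + (3 : ℝ) • (x + v) - x = 0
        module
      have h2 := torusN_le hl hε.le v
      have h3 := torusN_le hl hε.le (0 : E d)
      rw [Real.sqrt_sq hs.le] at h2 h3
      rw [norm_zero, mul_zero, add_zero] at h3
      simp only [hΦ, ea, eb, ec]
      exact cubicWeight_mono (torusN_nonneg _) (torusN_nonneg _) h2 h3 h3
    have h3 := mul_le_mul_of_nonneg_left hΦle (by positivity : 0 ≤ M * Real.exp (2 * κ * t))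
    simp only at h1
    linarith
  · rw [sum_mul_apply_eq, sum_prodField_smul, sum_prodField_smul, sum_prodField_smul, hΦd]
    obtain ⟨ha, hb, hc⟩ := IsTorusBdd.norm_sum_smul_le (hw t ht) hL hl hε.le hP (p0 z) (p1 z)
      (p2 z) (p3 z)
    have hκP : P * (7 + 2 * (2 * d + 1)) * Φ z ≤ κ * Φ z :=
      mul_le_mul_of_nonneg_right (by rw [hκ]; linarith) (hΦ0 z)
    refine le_trans ?_ hκP
    refine abs_cubicWeight_deriv_le (torusN_nonneg _) (torusN_nonneg _) (torusN_nonneg _) hP0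
      (torusN_le_const hε1 _) ((hNfd _ _ _).trans (le_trans (le_of_eq ?_) ha))
      ((hNfd _ _ _).trans (le_trans (le_of_eq ?_) hb))
      ((hNfd _ _ _).trans (le_trans (le_of_eq ?_) hc))
    · rw [← norm_neg]
      congr 2
      change -((∑ i, -w t i (p1 z) • uvec d i) - ∑ i, -w t i (p0 z) • uvec d i) = _
      simp only [sub_smul, neg_smul, Finset.sum_sub_distrib, Finset.sum_neg_distrib]
      module
    · rw [← norm_neg]
      congr 2
      change -((∑ i, -w t i (p2 z) • uvec d i) - (2 : ℝ) • (∑ i, -w t i (p1 z) • uvec d i) +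
        ∑ i, -w t i (p0 z) • uvec d i) = _
      simp only [sub_smul, add_smul, mul_smul, neg_smul, Finset.sum_add_distrib,
        Finset.sum_sub_distrib, Finset.sum_neg_distrib, ← Finset.smul_sum]
      module
    · rw [← norm_neg]
      congr 2
      change -((∑ i, -w t i (p3 z) • uvec d i) - (3 : ℝ) • (∑ i, -w t i (p2 z) • uvec d i) +
        (3 : ℝ) • (∑ i, -w t i (p1 z) • uvec d i) - ∑ i, -w t i (p0 z) • uvec d i) = _
      simp only [sub_smul, add_smul, mul_smul, neg_smul, Finset.sum_add_distrib,
        Finset.sum_sub_distrib, Finset.sum_neg_distrib, ← Finset.smul_sum]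
      module
  · have h2 := (hdiv t ht).abs_third_diff_le hl hε.le (p0 z) (p1 z) (p2 z) (p3 z)
    have hκQ : Q * Φ z ≤ κ * Φ z :=
      mul_le_mul_of_nonneg_right (by rw [hκ]; have : 0 ≤ P * (7 + 2 * (2 * d + 1)) := by positivity
                                     linarith) (hΦ0 z)
    refine le_trans (le_of_eq ?_) (h2.trans hκQ)
    rw [← abs_neg]
    congr 1
    change -(-(-1) * ∑ i, fderiv ℝ (w t i) (p0 z) (uvec d i) + -3 *
      ∑ i, fderiv ℝ (w t i) (p1 z) (uvec d i) + (-(-3) * ∑ i, fderiv ℝ (w t i) (p2 z) (uvec d i) +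
      -1 * ∑ i, fderiv ℝ (w t i) (p3 z) (uvec d i))) = _
    ring
  · rw [← Real.exp_add, ← Real.exp_add, ← Real.exp_add, Real.exp_le_exp]
    have h2 := (abs_le.1 (h0.abs_third_diff_le hl hε.le (p0 z) (p1 z) (p2 z) (p3 z))).1
    have h3 := hΦ0 z
    have h4 : -(M * Φ z) ≤ -(3 * M₀ * (l + l ^ 2 + l ^ 3) * Φ z) := by
      rw [hMdef]
      linarith
    refine (h4.trans h2).trans (le_of_eq ?_)
    change _ = -1 * r 0 (p0 z) + 3 * r 0 (p1 z) + (-3 * r 0 (p2 z) + 1 * r 0 (p3 z))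
    ring

end Tripling

section DirDeriv

variable {W : Type*} [NormedAddCommGroup W] [NormedSpace ℝ W]

/-- Directional derivative. -/
def dirDeriv (v : W) (g : W → ℝ) (x : W) : ℝ := fderiv ℝ g x v

theorem contDiff_dirDeriv {g : W → ℝ} (hg : ContDiff ℝ (⊤ : ℕ∞) g) (v : W) :
    ContDiff ℝ (⊤ : ℕ∞) (dirDeriv v g) :=
  contDiff_fderiv_apply_const (n := (⊤ : ℕ∞)) hg v

theorem fderiv_apply_const {W' : Type*} [NormedAddCommGroup W'] [NormedSpace ℝ W']
    {F : W → W →L[ℝ] W'} {x : W} (hF : DifferentiableAt ℝ F x) (b c : W) :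
    fderiv ℝ (fun y => F y c) x b = fderiv ℝ F x b c := by
  have h := (ContinuousLinearMap.apply ℝ W' c).hasFDerivAt.comp x hF.hasFDerivAt
  exact DFunLike.congr_fun h.fderiv b

theorem dirDeriv_dirDeriv {g : W → ℝ} (hg : ContDiff ℝ (⊤ : ℕ∞) g) (b c x : W) :
    dirDeriv b (dirDeriv c g) x = fderiv ℝ (fderiv ℝ g) x b c :=
  fderiv_apply_const (((contDiff_infty.1 hg 2).fderiv_right (m := 1) (by norm_num)).differentiable
    (by norm_num) x) b c

theorem dirDeriv_comm {g : W → ℝ} (hg : ContDiff ℝ (⊤ : ℕ∞) g) (b c : W) :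
    dirDeriv b (dirDeriv c g) = dirDeriv c (dirDeriv b g) := by
  funext x
  rw [dirDeriv_dirDeriv hg, dirDeriv_dirDeriv hg]
  exact ((contDiff_infty.1 hg 2).contDiffAt.isSymmSndFDerivAt (by simp)) b c

theorem dirDeriv_add {g h : W → ℝ} (hg : ContDiff ℝ (⊤ : ℕ∞) g) (hh : ContDiff ℝ (⊤ : ℕ∞) h)
    (v : W) : dirDeriv v (fun x => g x + h x) = fun x => dirDeriv v g x + dirDeriv v h x := by
  funext x
  simp only [dirDeriv]
  rw [fderiv_fun_add (hg.differentiable (by simp) x) (hh.differentiable (by simp) x)]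
  rfl

theorem dirDeriv_dirDeriv_dirDeriv {g : W → ℝ} (hg : ContDiff ℝ (⊤ : ℕ∞) g) (a b c x : W) :
    dirDeriv a (dirDeriv b (dirDeriv c g)) x =
      fderiv ℝ (fderiv ℝ (fderiv ℝ g)) x a b c := by
  have h1 : ContDiff ℝ 1 (fderiv ℝ (fderiv ℝ g)) :=
    ((contDiff_infty.1 hg 3).fderiv_right (m := 2) (by norm_num)).fderiv_right (by norm_num)
  have h2 : ContDiff ℝ 1 fun y => fderiv ℝ (fderiv ℝ g) y b := h1.clm_apply contDiff_const
  rw [funext (dirDeriv_dirDeriv hg b c), dirDeriv,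
    fderiv_apply_const (h2.differentiable (by norm_num) x),
    fderiv_apply_const (h1.differentiable (by norm_num) x)]

theorem iteratedDeriv_three_line {g : W → ℝ} (hg : ContDiff ℝ (⊤ : ℕ∞) g) (x v : W) :
    iteratedDeriv 3 (fun τ : ℝ => g (x + τ • v)) 0 = dirDeriv v (dirDeriv v (dirDeriv v g)) x := by
  have h1 := contDiff_dirDeriv hg v
  have h2 := contDiff_dirDeriv h1 v
  have e0 := iteratedDeriv_succ_line (hg.differentiable (by simp)) 2 x v
  have e1 := iteratedDeriv_succ_line (h1.differentiable (by simp)) 1 x v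
  have e2 := iteratedDeriv_succ_line (h2.differentiable (by simp)) 0 x v
  rw [e0, show (fun τ : ℝ => fderiv ℝ g (x + τ • v) v) = fun τ => dirDeriv v g (x + τ • v) from rfl,
    e1, show (fun τ : ℝ => fderiv ℝ (dirDeriv v g) (x + τ • v) v) =
      fun τ => dirDeriv v (dirDeriv v g) (x + τ • v) from rfl,
    e2, iteratedDeriv_zero, zero_smul, add_zero]
  rfl

/-- Polarization of third derivatives. -/
theorem dirDeriv_polarization {g : W → ℝ} (hg : ContDiff ℝ (⊤ : ℕ∞) g) (b c x : W) :
    6 * dirDeriv b (dirDeriv b (dirDeriv c g)) x =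
      dirDeriv (b + c) (dirDeriv (b + c) (dirDeriv (b + c) g)) x -
      dirDeriv (b - c) (dirDeriv (b - c) (dirDeriv (b - c) g)) x -
      2 * dirDeriv c (dirDeriv c (dirDeriv c g)) x := by
  have s1 := contDiff_dirDeriv hg b
  have e1 : dirDeriv b (dirDeriv c (dirDeriv b g)) x = dirDeriv b (dirDeriv b (dirDeriv c g)) x := by
    rw [dirDeriv_comm hg c b]
  have e2 : dirDeriv c (dirDeriv b (dirDeriv b g)) x = dirDeriv b (dirDeriv b (dirDeriv c g)) x := by
    rw [dirDeriv_comm s1 c b, e1]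
  simp only [dirDeriv_dirDeriv_dirDeriv hg, map_add, map_sub, add_apply, sub_apply] at e1 e2 ⊢
  linarith

end DirDeriv

section ThirdOrder

variable {d : ℕ} {l T Λ : ℝ}

theorem IsLogSol.exists_third_deriv_le {w : ℝ → Fin d → E d → ℝ} {r : ℝ → E d → ℝ}
    (h : IsLogSol l T Λ w r) (hl : 0 < l) {L M₀ : ℝ}
    (hL : 0 ≤ L) (hw : ∀ t ∈ Icc 0 T, ∀ i, IsTorusBdd l L (w t i))
    (hdiv : ∀ t ∈ Icc 0 T, IsTorusBdd l L fun x => ∑ i, fderiv ℝ (w t i) x (uvec d i))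
    (h0 : IsTorusBdd l M₀ (r 0)) :
    ∃ C, 0 ≤ C ∧ ∀ t ∈ Icc 0 T, ∀ x v,
      |dirDeriv v (dirDeriv v (dirDeriv v (r t))) x| ≤ C * ‖v‖ ^ 3 := by
  obtain ⟨C, hC, hb⟩ := h.exists_third_diff_ge hl hL hw hdiv h0
  refine ⟨C, hC, fun t ht x v => ?_⟩
  rw [← iteratedDeriv_three_line (h.smooth t)]
  refine abs_iteratedDeriv_le_of_fwdDiff (contDiff_line (contDiff_infty.1 (h.smooth t) 3) x v)
    fun τ hτ => ?_
  rw [fwdDiff_iter_three]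
  have h1 := hb t ht x (τ • v)
  have h2 := hb t ht (x + (3 * τ) • v) (-(τ • v))
  rw [norm_neg] at h2
  rw [norm_smul, Real.norm_of_nonneg hτ.le, mul_pow] at h1 h2
  have e1 : x + (3 : ℝ) • τ • v = x + (0 + 3 * τ) • v := by module
  have e2 : x + (2 : ℝ) • τ • v = x + (0 + 2 * τ) • v := by module
  have e3 : x + τ • v = x + (0 + τ) • v := by module
  have e4 : x + (3 * τ) • v + (3 : ℝ) • -(τ • v) = x + (0 : ℝ) • v := by module
  have e5 : x + (3 * τ) • v + (2 : ℝ) • -(τ • v) = x + (0 + τ) • v := by module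
  have e6 : x + (3 * τ) • v + -(τ • v) = x + (0 + 2 * τ) • v := by module
  have e7 : x + (3 * τ) • v = x + (0 + 3 * τ) • v := by module
  rw [e1, e2, e3] at h1
  rw [e4, e5, e6, e7] at h2
  rw [zero_smul, add_zero] at h2
  rw [abs_le]
  simp only [zero_smul, add_zero]
  constructor <;> linarith

theorem norm_uvec (i : Fin d) : ‖uvec d i‖ = 1 := by simp [uvec]

theorem abs_dirDeriv_dirDeriv_dirDeriv_le {g : E d → ℝ} (hg : ContDiff ℝ (⊤ : ℕ∞) g) {C : ℝ}
    (hC : 0 ≤ C) (h3 : ∀ x v, |dirDeriv v (dirDeriv v (dirDeriv v g)) x| ≤ C * ‖v‖ ^ 3)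
    (i j : Fin d) (x : E d) :
    |dirDeriv (uvec d j) (dirDeriv (uvec d j) (dirDeriv (uvec d i) g)) x| ≤ 3 * C := by
  have h := dirDeriv_polarization hg (uvec d j) (uvec d i) x
  have h1 := h3 x (uvec d j + uvec d i)
  have h2 := h3 x (uvec d j - uvec d i)
  have h4 := h3 x (uvec d i)
  have n1 : ‖uvec d j + uvec d i‖ ≤ 2 := (norm_add_le _ _).trans (by simp only [norm_uvec]; norm_num)
  have n2 : ‖uvec d j - uvec d i‖ ≤ 2 := (norm_sub_le _ _).trans (by simp only [norm_uvec]; norm_num)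
  have m1 : C * ‖uvec d j + uvec d i‖ ^ 3 ≤ C * 2 ^ 3 := by gcongr
  have m2 : C * ‖uvec d j - uvec d i‖ ^ 3 ≤ C * 2 ^ 3 := by gcongr
  rw [norm_uvec, one_pow, mul_one] at h4
  rw [abs_le] at h1 h2 h4 ⊢
  constructor <;> linarith

/-- Periodicity bounds first derivatives by second derivatives in the same direction. -/
theorem abs_dirDeriv_le_of_periodic {g : E d → ℝ} (hg : ContDiff ℝ (⊤ : ℕ∞) g) (hl : 0 < l)
    (hp : HasPeriods (boxPeriods d l) g) {C : ℝ} {j : Fin d}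
    (h2 : ∀ x, |dirDeriv (uvec d j) (dirDeriv (uvec d j) g) x| ≤ C) (x : E d) :
    |dirDeriv (uvec d j) g x| ≤ C * l := by
  set e := uvec d j
  have hline : ∀ {h : E d → ℝ}, ContDiff ℝ (⊤ : ℕ∞) h → ∀ τ : ℝ,
      HasDerivAt (fun τ : ℝ => h (x + τ • e)) (dirDeriv e h (x + τ • e)) τ := fun {h} hh τ => by
    have h1 : HasDerivAt (fun τ : ℝ => x + τ • e) e τ := by
      simpa using ((hasDerivAt_id τ).smul_const e).const_add x
    exact ((hh.differentiable (by simp) (x + τ • e)).hasFDerivAt).comp_hasDerivAt τ h1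
  have hd := contDiff_dirDeriv hg e
  obtain ⟨ξ, hξ, h0⟩ := exists_hasDerivAt_eq_zero (f := fun τ : ℝ => g (x + τ • e)) hl
    (fun τ _ => (hline hg τ).continuousAt.continuousWithinAt)
    (by simpa using ((hasPeriods_boxPeriods.1 hp) x j).symm) (fun τ _ => hline hg τ)
  obtain ⟨η, -, he⟩ := exists_hasDerivAt_eq_slope (fun τ : ℝ => dirDeriv e g (x + τ • e)) _ hξ.1
    (fun τ _ => (hline hd τ).continuousAt.continuousWithinAt) (fun τ _ => hline hd τ)
  simp only [h0, zero_smul, add_zero, sub_zero, zero_sub] at he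
  have hb := h2 (x + η • e)
  rw [he, abs_div, abs_neg, abs_of_pos hξ.1, div_le_iff₀ hξ.1] at hb
  refine hb.trans (mul_le_mul_of_nonneg_left hξ.2.le ((abs_nonneg _).trans (h2 x)))

theorem abs_fderiv_le_of_dirDeriv {g : E d → ℝ} {C : ℝ} {x : E d}
    (h : ∀ j, |dirDeriv (uvec d j) g x| ≤ C) (v : E d) : |fderiv ℝ g x v| ≤ d * C * ‖v‖ := by
  have e : v = ∑ j, v j • uvec d j := by
    ext k
    simp [uvec, Finset.sum_apply, Pi.single_apply]
  have h1 : fderiv ℝ g x v = ∑ j, v j * dirDeriv (uvec d j) g x := by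
    conv_lhs => rw [e]
    simp only [map_sum, map_smul, smul_eq_mul, dirDeriv]
  rw [h1]
  refine (Finset.abs_sum_le_sum_abs _ _).trans ?_
  have h2 : ∀ j ∈ (Finset.univ : Finset (Fin d)), |v j * dirDeriv (uvec d j) g x| ≤ C * ‖v‖ :=
    fun j _ => by
      rw [abs_mul, mul_comm]
      exact mul_le_mul (h j) (PiLp.norm_apply_le v j) (abs_nonneg _) ((abs_nonneg _).trans (h j))
  refine (Finset.sum_le_card_nsmul _ _ _ h2).trans_eq ?_
  rw [Finset.card_univ, Fintype.card_fin, nsmul_eq_mul, mul_assoc]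

theorem abs_sub_le_of_dirDeriv {g : E d → ℝ} (hg : Differentiable ℝ g) {C : ℝ} (hC : 0 ≤ C)
    (h : ∀ j x, |dirDeriv (uvec d j) g x| ≤ C) (x y : E d) : |g x - g y| ≤ d * C * ‖x - y‖ := by
  have := Convex.norm_image_sub_le_of_norm_fderiv_le (f := g) (𝕜 := ℝ) (C := d * C) (s := univ)
    (fun z _ => hg z) (fun z _ => ContinuousLinearMap.opNorm_le_bound _ (by positivity) fun v =>
      abs_fderiv_le_of_dirDeriv (fun j => h j z) v) convex_univ (mem_univ y) (mem_univ x)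
  exact this

/-- Bounds on periodic functions with bounded third directional derivatives. -/
theorem dirDeriv_bounds_of_third {g : E d → ℝ} (hg : ContDiff ℝ (⊤ : ℕ∞) g) (hl : 0 < l)
    (hp : HasPeriods (boxPeriods d l) g) {C : ℝ} (hC : 0 ≤ C)
    (h3 : ∀ x v, |dirDeriv v (dirDeriv v (dirDeriv v g)) x| ≤ C * ‖v‖ ^ 3) (i j : Fin d) (x : E d) :
    |dirDeriv (uvec d j) (dirDeriv (uvec d i) (dirDeriv (uvec d i) g)) x| ≤ 3 * C ∧
    |dirDeriv (uvec d j) (dirDeriv (uvec d i) g) x| ≤ 3 * C * l ∧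
    |dirDeriv (uvec d i) g x| ≤ 3 * C * l * l := by
  have h33 := abs_dirDeriv_dirDeriv_dirDeriv_le hg hC h3
  have s1 := fun i => contDiff_dirDeriv hg (uvec d i)
  have h2 : ∀ i j x, |dirDeriv (uvec d j) (dirDeriv (uvec d i) g) x| ≤ 3 * C * l := fun i j x =>
    abs_dirDeriv_le_of_periodic (s1 i) hl (hp.fderiv_apply _) (fun x => h33 i j x) x
  refine ⟨?_, h2 i j x, abs_dirDeriv_le_of_periodic hg hl hp (fun x => h2 i i x) x⟩
  rw [dirDeriv_comm (s1 i) (uvec d j) (uvec d i), dirDeriv_comm hg (uvec d j) (uvec d i)]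
  exact h33 j i x

end ThirdOrder

section Coordinates

variable {d : ℕ} {l T : ℝ}

theorem gradient_apply (g : E d → ℝ) (x : E d) (i : Fin d) :
    gradient g x i = dirDeriv (uvec d i) g x := by
  have h : inner ℝ (gradient g x) (uvec d i) = fderiv ℝ g x (uvec d i) := by
    rw [gradient, InnerProductSpace.toDual_symm_apply]
  rw [dirDeriv, ← h, uvec, EuclideanSpace.inner_single_right]
  simp

theorem contDiff_gradient {g : E d → ℝ} (hg : ContDiff ℝ (⊤ : ℕ∞) g) :
    ContDiff ℝ (⊤ : ℕ∞) (fun x => gradient g x) := by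
  rw [contDiff_euclidean]
  intro i
  simp only [gradient_apply]
  exact contDiff_dirDeriv hg _

theorem dirDeriv_apply {F : E d → E d} {x : E d} (hF : DifferentiableAt ℝ F x) (v : E d)
    (i : Fin d) : dirDeriv v (fun y => F y i) x = fderiv ℝ F x v i := by
  have h := (EuclideanSpace.proj (𝕜 := ℝ) i).hasFDerivAt.comp x hF.hasFDerivAt
  exact DFunLike.congr_fun h.fderiv v

theorem diverg_eq {F : E d → E d} {x : E d} (hF : DifferentiableAt ℝ F x) :
    diverg F x = ∑ i, dirDeriv (uvec d i) (fun y => F y i) x :=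
  Finset.sum_congr rfl fun i _ => (dirDeriv_apply hF _ i).symm

theorem lap_eq {g : E d → ℝ} (hg : ContDiff ℝ (⊤ : ℕ∞) g) (x : E d) :
    lap g x = ∑ i, dirDeriv (uvec d i) (dirDeriv (uvec d i) g) x := by
  rw [lap, diverg_eq ((contDiff_gradient hg).differentiable (by simp) x)]
  simp only [gradient_apply]

theorem dirDeriv_mul {g h : E d → ℝ} {x : E d} (hg : DifferentiableAt ℝ g x)
    (hh : DifferentiableAt ℝ h x) (v : E d) :
    dirDeriv v (fun y => g y * h y) x = g x * dirDeriv v h x + h x * dirDeriv v g x := by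
  rw [dirDeriv, fderiv_fun_mul hg hh]
  rfl

theorem diverg_smul {g : E d → ℝ} {F : E d → E d} {x : E d} (hg : DifferentiableAt ℝ g x)
    (hF : DifferentiableAt ℝ F x) : diverg (fun y => g y • F y) x =
      g x * ∑ i, dirDeriv (uvec d i) (fun y => F y i) x +
        ∑ i, F x i * dirDeriv (uvec d i) g x := by
  rw [diverg_eq (hg.fun_smul hF), Finset.mul_sum, ← Finset.sum_add_distrib]
  refine Finset.sum_congr rfl fun i _ => ?_
  have hFi : DifferentiableAt ℝ (fun y => F y i) x :=
    (EuclideanSpace.proj (𝕜 := ℝ) i).differentiableAt.comp x hF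
  exact dirDeriv_mul hg hFi _

theorem dirDeriv_log {g : E d → ℝ} {x : E d} (hg : DifferentiableAt ℝ g x) (h0 : g x ≠ 0)
    (v : E d) : dirDeriv v (fun y => Real.log (g y)) x = dirDeriv v g x / g x := by
  rw [dirDeriv, fderiv.log hg h0, div_eq_inv_mul]
  rfl

theorem HasPeriods.norm_iteratedFDeriv_le {F : Type} [NormedAddCommGroup F] [NormedSpace ℝ F]
    {g : E d → F} (hl : 0 < l) (hp : HasPeriods (boxPeriods d l) g) {n : ℕ} {C : ℝ}
    (h : ∀ x ∈ box d l, ‖iteratedFDeriv ℝ n g x‖ ≤ C) (x : E d) : ‖iteratedFDeriv ℝ n g x‖ ≤ C := by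
  obtain ⟨γ, hγ, hm⟩ := exists_sub_mem_box hl x
  have h1 : (fun y => g (y + γ)) = g := funext fun y => hp.closure γ hγ y
  have h2 := iteratedFDeriv_comp_add_right (𝕜 := ℝ) (f := g) n γ (x - γ)
  rw [h1, sub_add_cancel] at h2
  rw [← h2]
  exact h _ hm

theorem TransportedBy.isLogSol {v : ℝ → E d → E d} {α₀ : E d → ℝ} {ρ : ℝ → E d → ℝ}
    (h : TransportedBy d l v α₀ ρ) (hv : ∀ t, ContDiff ℝ (⊤ : ℕ∞) (v t))
    (hvp : ∀ t ∈ Icc 0 T, IsPeriodic l (v t)) {Λ : ℝ} (hΛ : 0 ≤ Λ)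
    (hb : ∀ t ∈ Icc 0 T, ∀ i x, |v t x i| ≤ Λ)
    (hdiv : ∀ t ∈ Icc 0 T, ∀ x, |diverg (v t) x| ≤ Λ) :
    IsLogSol l T Λ (fun t i x => v t x i) (fun t x => Real.log (ρ t x)) := by
  obtain ⟨hs, hpos, hper, -, hd⟩ := h
  refine ⟨hΛ, fun t => (hs t).log fun x => (hpos t x).ne', fun t =>
    (hasPeriods_boxPeriods.2 (hper t)).comp Real.log, fun t i => contDiff_euclidean.1 (hv t) i,
    fun t ht i => (hasPeriods_boxPeriods.2 (hvp t ht)).comp fun y => y i, hb,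
    fun t ht x => ?_, fun t x => ?_⟩
  · have := hdiv t ht x
    rwa [diverg_eq ((hv t).differentiable (by simp) x)] at this
  · have hdiff : DifferentiableAt ℝ (ρ t) x := (hs t).differentiable (by simp) x
    have h1 := (hd t x).log (hpos t x).ne'
    convert h1 using 1
    rw [diverg_smul hdiff ((hv t).differentiable (by simp) x)]
    have e : ∀ i, fderiv ℝ (fun x => Real.log (ρ t x)) x (uvec d i) =
        dirDeriv (uvec d i) (ρ t) x / ρ t x := fun i => dirDeriv_log hdiff (hpos t x).ne' _
    simp only [e]
    rw [eq_div_iff (hpos t x).ne', sub_mul, neg_mul, Finset.sum_mul, neg_add, sub_eq_add_neg,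
      add_comm]
    congr 1
    · rw [mul_comm]; rfl
    · congr 1
      refine Finset.sum_congr rfl fun i _ => ?_
      have := (hpos t x).ne'
      field_simp

end Coordinates

section AuxiliaryBounds

variable {d : ℕ} {l T L₀ Lf Lv : ℝ} {f : ℝ → E d → E d} {V : ℝ → E d → ℝ} {α₀ : E d → ℝ}
  {ρ1 ρ2 : ℝ → E d → ℝ}

theorem InitDensity.isTorusBdd_log (hl : 0 < l) (h : InitDensity d l α₀)
    (hA : RegInit d l L₀ α₀) : IsTorusBdd l L₀ fun x => Real.log (α₀ x) := by
  have hp := (hasPeriods_boxPeriods.2 h.2.2.1).comp Real.log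
  exact ⟨(contDiff_infty.1 h.1 3).log fun x => (h.2.1 x).ne', hp, fun i hi =>
    hp.norm_iteratedFDeriv_le hl fun x hx => (hA x hx).1 i hi⟩

theorem exists_norm_le_of_continuous_uncurry (hl : 0 < l) (hf : Continuous (Function.uncurry f))
    (hp : ∀ t ∈ Icc 0 T, IsPeriodic l (f t)) : ∃ B, 0 ≤ B ∧ ∀ t ∈ Icc 0 T, ∀ x, ‖f t x‖ ≤ B := by
  obtain ⟨B, hB⟩ := (isCompact_Icc.prod (isCompact_box (d := d) (l := l))).exists_bound_of_continuousOn
    (s := Icc 0 T ×ˢ box d l) hf.continuousOn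
  refine ⟨max B 0, le_max_right _ _, fun t ht x => ?_⟩
  obtain ⟨y, hy, he⟩ := exists_mem_box hl x
  rw [he (f t) (hasPeriods_boxPeriods.2 (hp t ht))]
  exact (hB (t, y) ⟨ht, hy⟩).trans (le_max_left _ _)

theorem IsPeriodic.diverg {F : E d → E d} (h : IsPeriodic l F) : IsPeriodic l (diverg F) := by
  intro x i
  simp only [_root_.diverg]
  rw [← fderiv_comp_add_right]
  simp only [h _ i]

theorem norm_fderiv_le_of_regVel (hl : 0 < l) (hA : RegVel d l T Lf f) {t : ℝ}
    (ht : t ∈ Icc 0 T) (x : E d) : ‖fderiv ℝ (f t) x‖ ≤ Lf := by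
  rw [← norm_iteratedFDeriv_one]
  exact (hasPeriods_boxPeriods.2 (hA t ht).1).norm_iteratedFDeriv_le hl
    (fun x hx => ((hA t ht).2 x hx 1 (by decide)).1) x

theorem abs_diverg_le {F : E d → E d} {x : E d} {C : ℝ} (h : ‖fderiv ℝ F x‖ ≤ C) :
    |diverg F x| ≤ d * C := by
  refine (Finset.abs_sum_le_sum_abs _ _).trans ?_
  have h2 : ∀ i ∈ (Finset.univ : Finset (Fin d)), |fderiv ℝ F x (uvec d i) i| ≤ C := fun i _ => by
    refine (PiLp.norm_apply_le (fderiv ℝ F x (uvec d i)) i).trans ?_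
    refine ((fderiv ℝ F x).le_opNorm _).trans ?_
    rwa [norm_uvec, mul_one]
  refine (Finset.sum_le_card_nsmul _ _ _ h2).trans_eq ?_
  rw [Finset.card_univ, Fintype.card_fin, nsmul_eq_mul]

/-- Bounds on third derivatives of the log-density transported by a regular velocity field. -/
theorem TransportedBy.exists_third_deriv_le (hl : 0 < l) (hT : 0 < T)
    (hfs : ∀ t, ContDiff ℝ (⊤ : ℕ∞) (f t)) (hfc : Continuous (Function.uncurry f))
    (hα : InitDensity d l α₀) (hA1 : RegInit d l L₀ α₀) (hA2 : RegVel d l T Lf f)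
    (h : TransportedBy d l f α₀ ρ1) : ∃ C, 0 ≤ C ∧ ∀ t ∈ Icc 0 T, ∀ x v,
      |dirDeriv v (dirDeriv v (dirDeriv v fun y => Real.log (ρ1 t y))) x| ≤ C * ‖v‖ ^ 3 := by
  have hper := fun t ht => (hA2 t ht).1
  have hLf : 0 ≤ Lf := (norm_nonneg _).trans
    (norm_fderiv_le_of_regVel hl hA2 (left_mem_Icc.2 hT.le) 0)
  obtain ⟨B, hB0, hB⟩ := exists_norm_le_of_continuous_uncurry hl hfc hper
  have hd1 : (0 : ℝ) ≤ d * Lf := by positivity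
  have hlog := h.isLogSol (T := T) (Λ := B + d * Lf) hfs hper (by positivity) (fun t ht i x => by
      have h1 := PiLp.norm_apply_le (f t x) i
      have h2 := hB t ht x
      rw [Real.norm_eq_abs] at h1
      linarith)
    (fun t ht x => by linarith [abs_diverg_le (norm_fderiv_le_of_regVel hl hA2 ht x)])
  refine hlog.exists_third_deriv_le hl hLf (fun t ht i => ?_) (fun t ht => ?_)
    (by simpa only [h.2.2.2.1] using hα.isTorusBdd_log hl hA1)
  · refine ⟨contDiff_infty.1 (hlog.smooth_w t i) 3, hlog.per_w t ht i, fun k hk x => ?_⟩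
    have hk4 : k ∈ Finset.Icc 1 4 := by
      simp only [Finset.mem_Icc] at hk ⊢; omega
    have h1 := (EuclideanSpace.proj (𝕜 := ℝ) i : E d →L[ℝ] ℝ).norm_iteratedFDeriv_comp_left
      (f := f t) (x := x) (n := k) (hfs t).contDiffAt (by exact_mod_cast le_top)
    have h2 := (hasPeriods_boxPeriods.2 (hper t ht)).norm_iteratedFDeriv_le hl (n := k)
      (fun x hx => ((hA2 t ht).2 x hx k hk4).1) x
    have h3 : ‖(EuclideanSpace.proj (𝕜 := ℝ) i : E d →L[ℝ] ℝ)‖ ≤ 1 :=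
      ContinuousLinearMap.opNorm_le_bound _ zero_le_one fun y => by
        rw [one_mul]; exact PiLp.norm_apply_le y i
    exact h1.trans ((mul_le_mul h3 h2 (norm_nonneg _) zero_le_one).trans_eq (one_mul _))
  · have e : (fun x => ∑ i, fderiv ℝ (fun y => f t y i) x (uvec d i)) = diverg (f t) :=
      funext fun x => (diverg_eq ((hfs t).differentiable (by simp) x)).symm
    rw [e]
    have hp := hasPeriods_boxPeriods.2 (hper t ht).diverg
    refine ⟨?_, hp, fun k hk => hp.norm_iteratedFDeriv_le hl fun x hx => ?_⟩
    · rw [← e]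
      exact ContDiff.sum fun i _ => contDiff_fderiv_apply_const
        (contDiff_infty.1 (hlog.smooth_w t i) 4) _
    · refine ((hA2 t ht).2 x hx k ?_).2
      simp only [Finset.mem_Icc] at hk ⊢; omega


end AuxiliaryBounds

section AuxiliaryDrift

variable {d : ℕ} {l T L₀ Lf Lv : ℝ} {f : ℝ → E d → E d} {V : ℝ → E d → ℝ} {α₀ : E d → ℝ}
  {ρ1 ρ2 : ℝ → E d → ℝ}

theorem score_apply (g : E d → ℝ) (x : E d) (i : Fin d) :
    score g x i = dirDeriv (uvec d i) (fun y => Real.log (g y)) x := gradient_apply _ _ _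

theorem Avf_apply {t : ℝ} (hV : ContDiff ℝ (⊤ : ℕ∞) (V t))
    (hρ : ContDiff ℝ (⊤ : ℕ∞) fun y => Real.log (ρ1 t y)) (x : E d) (i : Fin d) :
    Avf V ρ1 t x i = -dirDeriv (uvec d i) (fun y => V t y + Real.log (ρ1 t y)) x := by
  rw [dirDeriv_add hV hρ, neg_add, ← score_apply, ← gradient_apply]
  rfl

theorem IsLogSol.mono {Λ Λ' : ℝ} {w : ℝ → Fin d → E d → ℝ} {r : ℝ → E d → ℝ}
    (h : IsLogSol l T Λ w r) (hΛ : Λ ≤ Λ') : IsLogSol l T Λ' w r :=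
  ⟨h.nonneg.trans hΛ, h.smooth, h.per, h.smooth_w, h.per_w, fun t ht i x =>
    (h.w_le t ht i x).trans hΛ, fun t ht x => (h.div_le t ht x).trans hΛ, h.deriv⟩

theorem abs_dirDeriv_le_of_lipschitz {g : E d → ℝ} {C : ℝ} (hC : 0 ≤ C)
    (h : ∀ x y, |g x - g y| ≤ C * ‖x - y‖) (i : Fin d) (x : E d) :
    |dirDeriv (uvec d i) g x| ≤ C := by
  have h1 : LipschitzWith C.toNNReal g := LipschitzWith.of_dist_le_mul fun x y => by
    rw [Real.dist_eq, dist_eq_norm, Real.coe_toNNReal C hC]; exact h x y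
  have h2 := (fderiv ℝ g x).le_of_opNorm_le (norm_fderiv_le_of_lipschitz ℝ h1 (x₀ := x)) (uvec d i)
  rwa [Real.coe_toNNReal C hC, norm_uvec, mul_one] at h2

theorem RegPot.third_deriv_le (hl : 0 < l) (hV : ∀ t, ContDiff ℝ (⊤ : ℕ∞) (V t))
    (h : RegPot d l T Lv V) {t : ℝ} (ht : t ∈ Icc 0 T) (x v : E d) :
    |dirDeriv v (dirDeriv v (dirDeriv v (V t))) x| ≤ Lv * ‖v‖ ^ 3 := by
  rw [← iteratedDeriv_three_line (hV t)]
  exact abs_iteratedDeriv_line_le (contDiff_infty.1 (hV t) 3)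
    ((hasPeriods_boxPeriods.2 (h t ht).1).norm_iteratedFDeriv_le hl
      fun x hx => ((h t ht).2 x hx).2.1) x v 0

/-- Uniform bounds for the scores of the two systems and for the auxiliary drift. -/
theorem exists_score_bounds (hl : 0 < l) (hT : 0 < T)
    (hfs : ∀ t, ContDiff ℝ (⊤ : ℕ∞) (f t)) (hfc : Continuous (Function.uncurry f))
    (hVs : ∀ t, ContDiff ℝ (⊤ : ℕ∞) (V t))
    (hα : InitDensity d l α₀) (hA1 : RegInit d l L₀ α₀) (hA2 : RegVel d l T Lf f)
    (hA3 : RegPot d l T Lv V) (h1 : TransportedBy d l f α₀ ρ1)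
    (h2 : TransportedBy d l (Avf V ρ1) α₀ ρ2) :
    ∃ C, 0 ≤ C ∧ IsLogSol l T C (fun t i x => Avf V ρ1 t x i) (fun t x => Real.log (ρ2 t x)) ∧
      ∀ t ∈ Icc 0 T, ∀ i x, |score (ρ1 t) x i| ≤ C ∧ |score (ρ2 t) x i| ≤ C ∧
        |dirDeriv (uvec d i) (V t) x| ≤ C ∧ |lap (V t) x| ≤ C := by
  obtain ⟨C₁, hC₁, hb₁⟩ := h1.exists_third_deriv_le hl hT hfs hfc hα hA1 hA2
  have hLv : 0 ≤ Lv := (norm_nonneg _).trans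
    (((hA3 0 (left_mem_Icc.2 hT.le)).2 0 (interior_subset (zero_mem_interior_box hl))).1)
  set r1 : ℝ → E d → ℝ := fun t x => Real.log (ρ1 t x) with hr1
  have hr1s : ∀ t, ContDiff ℝ (⊤ : ℕ∞) (r1 t) := fun t => (h1.1 t).log fun x => (h1.2.1 t x).ne'
  have hr1p : ∀ t, HasPeriods (boxPeriods d l) (r1 t) := fun t =>
    (hasPeriods_boxPeriods.2 (h1.2.2.1 t)).comp Real.log
  have hVp : ∀ t ∈ Icc 0 T, HasPeriods (boxPeriods d l) (V t) := fun t ht =>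
    hasPeriods_boxPeriods.2 (hA3 t ht).1
  set Ψ : ℝ → E d → ℝ := fun t x => V t x + r1 t x with hΨ
  have hΨs : ∀ t, ContDiff ℝ (⊤ : ℕ∞) (Ψ t) := fun t => (hVs t).add (hr1s t)
  have hΨp : ∀ t ∈ Icc 0 T, HasPeriods (boxPeriods d l) (Ψ t) := fun t ht =>
    (hVp t ht).comp₂ (hr1p t) (· + ·)
  have hΨ3 : ∀ t ∈ Icc 0 T, ∀ x v,
      |dirDeriv v (dirDeriv v (dirDeriv v (Ψ t))) x| ≤ (Lv + C₁) * ‖v‖ ^ 3 := by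
    intro t ht x v
    have s1 := contDiff_dirDeriv (hVs t) v
    have s2 := contDiff_dirDeriv (hr1s t) v
    rw [hΨ, dirDeriv_add (hVs t) (hr1s t), dirDeriv_add s1 s2,
      dirDeriv_add (contDiff_dirDeriv s1 v) (contDiff_dirDeriv s2 v), add_mul]
    exact (abs_add_le _ _).trans (add_le_add (hA3.third_deriv_le hl hVs ht x v) (hb₁ t ht x v))
  have hC : 0 ≤ Lv + C₁ := by positivity
  have hbd := fun t ht => dirDeriv_bounds_of_third (hΨs t) hl (hΨp t ht) hC (hΨ3 t ht)
  have hbd1 := fun t ht => dirDeriv_bounds_of_third (hr1s t) hl (hr1p t) hC₁ (hb₁ t ht)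
  have hbdV := fun t ht => dirDeriv_bounds_of_third (hVs t) hl (hVp t ht) hLv
    (hA3.third_deriv_le hl hVs ht)
  have hA : ∀ t x i, Avf V ρ1 t x i = -dirDeriv (uvec d i) (Ψ t) x := fun t x i =>
    Avf_apply (hVs t) (hr1s t) x i
  have hAs : ∀ t, ContDiff ℝ (⊤ : ℕ∞) (Avf V ρ1 t) := fun t => by
    rw [contDiff_euclidean]
    intro i
    simp only [hA]
    exact (contDiff_dirDeriv (hΨs t) _).neg
  have hAd : ∀ t v i x, dirDeriv v (fun y => Avf V ρ1 t y i) x =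
      -dirDeriv v (dirDeriv (uvec d i) (Ψ t)) x := fun t v i x => by
    simp only [hA, dirDeriv, fderiv_fun_neg, neg_apply]
    rfl
  have hdiv : ∀ t x, ∑ i, fderiv ℝ (fun y => Avf V ρ1 t y i) x (uvec d i) =
      -∑ i, dirDeriv (uvec d i) (dirDeriv (uvec d i) (Ψ t)) x := fun t x => by
    rw [← Finset.sum_neg_distrib]
    exact Finset.sum_congr rfl fun i _ => hAd t _ i x
  have hsum : ∀ {g : Fin d → ℝ} {B : ℝ}, (∀ i, |g i| ≤ B) → |∑ i, g i| ≤ d * B := by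
    intro g B hg
    refine (Finset.abs_sum_le_sum_abs _ _).trans
      ((Finset.sum_le_card_nsmul _ _ _ fun i _ => hg i).trans_eq ?_)
    rw [Finset.card_univ, Fintype.card_fin, nsmul_eq_mul]
  set B₁ := 3 * (Lv + C₁) * l * l + d * (3 * (Lv + C₁) * l) with hB₁
  have hB₁0 : 0 ≤ 3 * (Lv + C₁) * l * l := by positivity
  have hB₁1 : 0 ≤ d * (3 * (Lv + C₁) * l) := by positivity
  have hlog := h2.isLogSol (T := T) (Λ := B₁) hAs (fun t ht x i => by
      ext k
      rw [hA, hA, dirDeriv, dirDeriv, hasPeriods_boxPeriods.1 (hΨp t ht).fderiv x i])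
    (by positivity) (fun t ht i x => by
      rw [hA, abs_neg]
      have := (hbd t ht i i x).2.2
      linarith) (fun t ht x => by
      rw [diverg_eq ((hAs t).differentiable (by simp) x)]
      rw [show ∑ i, dirDeriv (uvec d i) (fun y => Avf V ρ1 t y i) x = _ from hdiv t x, abs_neg]
      have := hsum fun i => (hbd t ht i i x).2.1
      linarith)
  set L := d * (3 * (Lv + C₁) * l) + d * (d * (3 * (Lv + C₁))) with hL
  have hL0 : 0 ≤ d * (d * (3 * (Lv + C₁))) := by positivity
  obtain ⟨C₂, hC₂, hb₂⟩ := hlog.exists_lipschitz hl (L := L) (M₀ := L₀) (by positivity)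
    (hα.isTorusBdd_log hl hA1).nonneg (fun t ht i x y => by
      have h := abs_sub_le_of_dirDeriv ((hlog.smooth_w t i).differentiable (by simp))
        (by positivity : 0 ≤ 3 * (Lv + C₁) * l) (fun j x => by
          rw [hAd, abs_neg]; exact (hbd t ht i j x).2.1) x y
      refine h.trans (mul_le_mul_of_nonneg_right (by linarith) (norm_nonneg _)))
    (fun t ht x y => by
      have hs : ContDiff ℝ (⊤ : ℕ∞)
          fun x => ∑ i, dirDeriv (uvec d i) (dirDeriv (uvec d i) (Ψ t)) x :=
        ContDiff.sum fun i _ => contDiff_dirDeriv (contDiff_dirDeriv (hΨs t) _) _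
      rw [hdiv, hdiv, neg_sub_neg, abs_sub_comm]
      have h := abs_sub_le_of_dirDeriv (hs.differentiable (by simp))
        (by positivity : 0 ≤ d * (3 * (Lv + C₁))) (fun j x => by
          rw [dirDeriv, fderiv_fun_sum fun i _ => (contDiff_dirDeriv (contDiff_dirDeriv (hΨs t) _)
            _).differentiable (by simp) x, sum_apply]
          exact hsum fun i => (hbd t ht i j x).1) x y
      exact h.trans (mul_le_mul_of_nonneg_right (by linarith) (norm_nonneg _)))
    (by simpa only [h2.2.2.2.1] using (hα.isTorusBdd_log hl hA1).abs_sub_le)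
  set B₂ := 3 * C₁ * l * l with hB₂
  set B₃ := 3 * Lv * l * l with hB₃
  set B₄ := d * (3 * Lv * l) with hB₄
  have p2 : 0 ≤ B₂ := by positivity
  have p3 : 0 ≤ B₃ := by positivity
  have p4 : 0 ≤ B₄ := by positivity
  have p1 := hlog.nonneg
  refine ⟨B₁ + B₂ + B₃ + B₄ + C₂, by positivity, hlog.mono (by linarith), fun t ht i x =>
    ⟨?_, ?_, ?_, ?_⟩⟩
  · rw [score_apply]
    have := (hbd1 t ht i i x).2.2
    linarith
  · rw [score_apply]
    have := abs_dirDeriv_le_of_lipschitz hC₂ (hb₂ t ht) i x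
    linarith
  · have := (hbdV t ht i i x).2.2
    linarith
  · rw [lap_eq (hVs t)]
    have := hsum fun i => (hbdV t ht i i x).2.1
    linarith

end AuxiliaryDrift

section TimeRegularity

variable {d : ℕ} {l T Λ : ℝ} {w : ℝ → Fin d → E d → ℝ} {r : ℝ → E d → ℝ}

theorem IsLogSol.exists_abs_le (h : IsLogSol l T Λ w r) (hl : 0 < l) :
    ∃ M, 0 ≤ M ∧ ∀ t ∈ Icc 0 T, ∀ x, |r t x| ≤ M := by
  obtain ⟨K, hK⟩ := (isCompactCell_box hl).isPeriodCell.bdd (r 0) (h.smooth 0).continuous (h.per 0)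
  have hK0 : 0 ≤ K := (abs_nonneg _).trans (hK 0)
  have := isFiniteMeasure_restrict (isCompact_box (d := d) (l := l))
  have key : ∀ c : ℝ, |c| = 1 → ∀ t ∈ Icc 0 T, ∀ x,
      -((1 + K) * Real.exp (2 * Λ * T)) ≤ c * r t x := fun c hc t ht x => by
    have h1 := (h.isLinSol hl c).exp_neg_le (Φ := fun _ => 1) (κ := Λ) (M := 1 + K)
      contDiff_const (fun _ _ _ => rfl) (fun _ => zero_le_one) h.nonneg (by linarith)
      (fun s _ y => by simpa using h.nonneg)
      (fun s hs y => by rw [abs_mul, abs_neg, hc, one_mul, mul_one]; exact h.div_le s hs y)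
      (fun y => by
        rw [Real.exp_le_exp, mul_one]
        have h2 : |c * r 0 y| ≤ K := by rw [abs_mul, hc, one_mul]; exact hK y
        linarith [(abs_le.1 h2).1]) ht x
    rw [Real.exp_le_exp, mul_one] at h1
    refine le_trans (neg_le_neg ?_) h1
    have := h.nonneg
    gcongr
    exact ht.2
  refine ⟨(1 + K) * Real.exp (2 * Λ * T), by positivity, fun t ht x => abs_le.2 ⟨?_, ?_⟩⟩
  · simpa using key 1 (by simp) t ht x
  · have := key (-1) (by simp) t ht x
    linarith

theorem IsLogSol.exists_abs_exp_sub_le (h : IsLogSol l T Λ w r) (hl : 0 < l) {t : ℝ}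
    (ht : t ∈ Icc 0 T) : ∃ C, 0 ≤ C ∧ ∀ s ∈ Icc t T, ∀ x,
      |Real.exp (r s x) - Real.exp (r t x)| ≤ C * (s - t) := by
  have := isFiniteMeasure_restrict (isCompact_box (d := d) (l := l))
  obtain ⟨M, hM0, hM⟩ := h.exists_abs_le hl
  obtain ⟨C₁, hC₁, h₁⟩ := (h.isLinSol hl 1).exists_sub_le ht
  obtain ⟨C₂, hC₂, h₂⟩ := (h.isLinSol hl (-1)).exists_sub_le ht
  refine ⟨C₁ + C₂ * (Real.exp M * Real.exp M), by positivity, fun s hs x => ?_⟩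
  have hst : 0 ≤ s - t := sub_nonneg.2 hs.1
  have e1 := h₁ s hs x
  have e2 := h₂ s hs x
  simp only [one_mul, neg_one_mul, Real.exp_neg] at e1 e2
  have hle : ∀ s ∈ Icc 0 T, Real.exp (r s x) ≤ Real.exp M := fun s hs =>
    Real.exp_le_exp.2 ((le_abs_self _).trans (hM s hs x))
  have b1 := hle s ⟨ht.1.trans hs.1, hs.2⟩
  have b2 := hle t ht
  have p1 := Real.exp_pos (r s x)
  have p2 := Real.exp_pos (r t x)
  have p3 := Real.exp_pos M
  have e3 : Real.exp (r s x) - Real.exp (r t x) ≤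
      C₂ * (s - t) * (Real.exp (r s x) * Real.exp (r t x)) := by
    have := mul_le_mul_of_nonneg_right e2 (mul_pos p1 p2).le
    rw [sub_mul] at this
    have i1 : (Real.exp (r t x))⁻¹ * (Real.exp (r s x) * Real.exp (r t x)) = Real.exp (r s x) := by
      field_simp
    have i2 : (Real.exp (r s x))⁻¹ * (Real.exp (r s x) * Real.exp (r t x)) = Real.exp (r t x) := by
      field_simp
    rw [i1, i2] at this
    linarith
  have e4 : Real.exp (r s x) * Real.exp (r t x) ≤ Real.exp M * Real.exp M := by gcongr
  have e5 := mul_le_mul_of_nonneg_left e4 (mul_nonneg hC₂ hst)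
  have e6 := mul_nonneg hC₁ hst
  have e7 : 0 ≤ C₂ * (s - t) * (Real.exp M * Real.exp M) := by positivity
  rw [abs_le]
  constructor <;> nlinarith

theorem SolvesFPE.isLinSol {V αs : ℝ → E d → ℝ} {α₀ : E d → ℝ} (h : SolvesFPE d l V α₀ αs)
    (hl : 0 < l) (hV : ∀ t, ContDiff ℝ (⊤ : ℕ∞) (V t)) (hVp : ∀ t ∈ Icc 0 T, IsPeriodic l (V t))
    (hΛ : 0 ≤ Λ) (hb : ∀ t ∈ Icc 0 T, ∀ i x, |dirDeriv (uvec d i) (V t) x| ≤ Λ)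
    (hlap : ∀ t ∈ Icc 0 T, ∀ x, |lap (V t) x| ≤ Λ) :
    IsLinSol (volume.restrict (box d l)) (boxPeriods d l) (uvec d) T 1 Λ
      (fun t i => dirDeriv (uvec d i) (V t)) (fun t => lap (V t)) αs := by
  obtain ⟨hs, hpos, hper, -, hd⟩ := h
  have hp : ∀ t ∈ Icc 0 T, ∀ i, HasPeriods (boxPeriods d l) (dirDeriv (uvec d i) (V t)) :=
    fun t ht i => (hasPeriods_boxPeriods.2 (hVp t ht)).fderiv_apply _
  have hlapeq : ∀ t, lap (V t) =
      fun x => ∑ i, dirDeriv (uvec d i) (dirDeriv (uvec d i) (V t)) x :=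
    fun t => funext fun x => lap_eq (hV t) x
  refine ⟨(isCompactCell_box hl).isPeriodCell, zero_le_one, hΛ,
    fun t _ => contDiff_infty.1 (hs t) 2, fun t _ => hpos t,
    fun t _ => hasPeriods_boxPeriods.2 (hper t),
    fun t _ i => contDiff_infty.1 (contDiff_dirDeriv (hV t) _) 1, hp, hb, fun t ht x => ?_,
    fun t _ => ?_, fun t ht => ?_, hlap, fun t _ x => ?_⟩
  · have := hlap t ht x
    rwa [lap_eq (hV t)] at this
  · rw [hlapeq]
    exact continuous_finsetSum _ fun i _ =>
      (contDiff_dirDeriv (contDiff_dirDeriv (hV t) _) _).continuous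
  · rw [hlapeq]
    exact HasPeriods.sum fun i => (hp t ht i).fderiv_apply _
  · convert hd t x using 1
    rw [diverg_smul ((hs t).differentiable (by simp) x)
      ((contDiff_gradient (hV t)).differentiable (by simp) x), lap_eq (hs t), linOp, hlapeq]
    simp only [gradient_apply, one_mul]
    rw [add_assoc, add_comm (αs t x * _), mul_comm (αs t x)]
    rfl

end TimeRegularity

section DiniIntegral

/-- A continuous function whose upper right Dini derivative is bounded by an integrable function
`φ` grows by at most the integral of `φ`. -/
theorem sub_le_integral_of_eventually_slope_lt {g φ : ℝ → ℝ} {a b : ℝ} (hab : a ≤ b)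
    (hcont : ContinuousOn g (Icc a b)) (φint : IntegrableOn φ (Icc a b))
    (hderiv : ∀ t ∈ Ico a b, ∀ y, φ t < y → ∀ᶠ u in 𝓝[>] t, (u - t)⁻¹ * (g u - g t) < y) :
    g b - g a ≤ ∫ y in a..b, φ y := by
  refine le_of_forall_pos_le_add fun ε εpos => ?_
  rcases exists_lt_lowerSemicontinuous_integral_lt φ φint εpos with
    ⟨G', f_lt_G', G'cont, G'int, G'lt_top, hG'⟩
  set s := {t | g t - g a ≤ ∫ u in a..t, (G' u).toReal} ∩ Icc a b
  have s_closed : IsClosed s := by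
    have : ContinuousOn (fun t => (g t - g a, ∫ u in a..t, (G' u).toReal)) (Icc a b) := by
      rw [← uIcc_of_le hab] at G'int hcont ⊢
      exact (hcont.sub continuousOn_const).prodMk
        (intervalIntegral.continuousOn_primitive_interval G'int)
    simp only [s, inter_comm]
    exact this.preimage_isClosed_of_isClosed isClosed_Icc OrderClosedTopology.isClosed_le'
  have main : Icc a b ⊆ {t | g t - g a ≤ ∫ u in a..t, (G' u).toReal} := by
    refine s_closed.Icc_subset_of_forall_exists_gt
      (by simp only [intervalIntegral.integral_same, mem_ofPred_eq, sub_self, le_rfl])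
      fun t ht v t_lt_v => ?_
    obtain ⟨y, φ_lt_y, y_lt_G'⟩ : ∃ y : ℝ, (φ t : EReal) < y ∧ (y : EReal) < G' t :=
      EReal.lt_iff_exists_real_btwn.1 (f_lt_G' t)
    have I1 : ∀ᶠ u in 𝓝[>] t, (u - t) * y ≤ ∫ w in t..u, (G' w).toReal := by
      have B : ∀ᶠ u in 𝓝 t, (y : EReal) < G' u := G'cont.lowerSemicontinuousAt _ _ y_lt_G'
      rcases mem_nhds_iff_exists_Ioo_subset.1 B with ⟨m, M, ⟨hm, hM⟩, H⟩
      have : Ioo t (min M b) ∈ 𝓝[>] t := Ioo_mem_nhdsGT (lt_min hM ht.right.right)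
      filter_upwards [this] with u hu
      have I : Icc t u ⊆ Icc a b := Icc_subset_Icc ht.2.1 (hu.2.le.trans (min_le_right _ _))
      calc
        (u - t) * y = ∫ _ in Icc t u, y := by
          simp only [MeasureTheory.integral_const, MeasurableSet.univ, measureReal_restrict_apply,
            univ_inter, hu.left.le, Real.volume_real_Icc_of_le, smul_eq_mul]
        _ ≤ ∫ w in t..u, (G' w).toReal := by
          rw [intervalIntegral.integral_of_le hu.1.le, ← integral_Icc_eq_integral_Ioc]
          apply setIntegral_mono_ae_restrict
          · simp
          · exact IntegrableOn.mono_set G'int I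
          · have C1 : ∀ᵐ x : ℝ ∂volume.restrict (Icc t u), G' x < ∞ :=
              ae_mono (Measure.restrict_mono I le_rfl) G'lt_top
            have C2 : ∀ᵐ x : ℝ ∂volume.restrict (Icc t u), x ∈ Icc t u :=
              ae_restrict_mem measurableSet_Icc
            filter_upwards [C1, C2] with x G'x hx
            apply EReal.coe_le_coe_iff.1
            have : x ∈ Ioo m M := by
              simp only [hm.trans_le hx.left,
                (hx.right.trans_lt hu.right).trans_le (min_le_left M b), mem_Ioo, and_self_iff]
            refine (H this).out.le.trans_eq ?_
            exact (EReal.coe_toReal G'x.ne (f_lt_G' x).ne_bot).symm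
    have I2 : ∀ᶠ u in 𝓝[>] t, g u - g t ≤ (u - t) * y := by
      filter_upwards [hderiv t ⟨ht.2.1, ht.2.2⟩ y (EReal.coe_lt_coe_iff.1 φ_lt_y),
        self_mem_nhdsWithin] with u hu t_lt_u
      have h0 : 0 < u - t := sub_pos.2 t_lt_u
      rw [inv_mul_lt_iff₀ h0] at hu
      exact hu.le
    have I4 : ∀ᶠ u in 𝓝[>] t, u ∈ Ioc t (min v b) := Ioc_mem_nhdsGT <| lt_min t_lt_v ht.2.2
    rcases ((I1.and I2).and I4).exists with ⟨x, ⟨hx1, hx2⟩, h'x⟩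
    refine ⟨x, ?_, Ioc_subset_Ioc le_rfl (min_le_left _ _) h'x⟩
    calc
      g x - g a = g t - g a + (g x - g t) := by abel
      _ ≤ (∫ w in a..t, (G' w).toReal) + ∫ w in t..x, (G' w).toReal :=
        add_le_add ht.1 (hx2.trans hx1)
      _ = ∫ w in a..x, (G' w).toReal := by
        apply intervalIntegral.integral_add_adjacent_intervals
        · rw [intervalIntegrable_iff_integrableOn_Ioc_of_le ht.2.1]
          exact IntegrableOn.mono_set G'int
            (Ioc_subset_Icc_self.trans (Icc_subset_Icc le_rfl ht.2.2.le))
        · rw [intervalIntegrable_iff_integrableOn_Ioc_of_le h'x.1.le]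
          apply IntegrableOn.mono_set G'int
          exact Ioc_subset_Icc_self.trans (Icc_subset_Icc ht.2.1 (h'x.2.trans (min_le_right _ _)))
  calc
    g b - g a ≤ ∫ y in a..b, (G' y).toReal := main (right_mem_Icc.2 hab)
    _ ≤ (∫ y in a..b, φ y) + ε := by
      convert! hG'.le <;>
        · rw [intervalIntegral.integral_of_le hab]
          simp only [integral_Icc_eq_integral_Ioc', Real.volume_singleton]

end DiniIntegral

section RegularizedEntropy

/-- A regularization of the integrand `p log (p / q)` of the relative entropy which is Lipschitz
in `p` and in `q`. -/
def relEnt (ε p q : ℝ) : ℝ := p * (Real.log (p + ε * q) - Real.log (q + ε * p))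

/-- The derivative of `relEnt` in its first argument, as a function of the ratio `q / p`. -/
def relEntFst (ε u : ℝ) : ℝ :=
  Real.log (1 + ε * u) - Real.log (u + ε) - u * (ε / (1 + ε * u) - 1 / (u + ε))

/-- The derivative of `relEnt` in its second argument, as a function of the ratio `q / p`. -/
def relEntSnd (ε u : ℝ) : ℝ := ε / (1 + ε * u) - 1 / (u + ε)

/-- The curvature of the perspective function `relEnt`, as a function of the ratio `q / p`. -/
def relEntCurv (ε u : ℝ) : ℝ := 1 / (u + ε) ^ 2 - ε ^ 2 / (1 + ε * u) ^ 2

variable {ε p q p' q' u D : ℝ}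

theorem relEnt_self (ε p : ℝ) : relEnt ε p p = 0 := by simp [relEnt]

theorem hasDerivAt_relEntSnd (hε : 0 < ε) (hu : 0 < u) :
    HasDerivAt (relEntSnd ε) (relEntCurv ε u) u := by
  have h1 : (1 + ε * u) ≠ 0 := by positivity
  have h2 : u + ε ≠ 0 := by positivity
  have d1 : HasDerivAt (fun u => 1 + ε * u) (ε * 1) u := ((hasDerivAt_id u).const_mul ε).const_add 1
  have d2 : HasDerivAt (fun u => u + ε) 1 u := (hasDerivAt_id u).add_const ε
  refine (((hasDerivAt_const u ε).fun_div d1 h1).fun_sub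
    ((hasDerivAt_const u 1).fun_div d2 h2)).congr_deriv ?_
  rw [relEntCurv]
  field_simp
  ring

theorem hasDerivAt_relEntFst (hε : 0 < ε) (hu : 0 < u) :
    HasDerivAt (relEntFst ε) (-(u * relEntCurv ε u)) u := by
  have h1 : (1 + ε * u) ≠ 0 := by positivity
  have h2 : u + ε ≠ 0 := by positivity
  have d1 : HasDerivAt (fun u => 1 + ε * u) (ε * 1) u := ((hasDerivAt_id u).const_mul ε).const_add 1
  have d2 : HasDerivAt (fun u => u + ε) 1 u := (hasDerivAt_id u).add_const ε
  refine (((d1.log h1).fun_sub (d2.log h2)).fun_sub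
    ((hasDerivAt_id' u).fun_mul (hasDerivAt_relEntSnd hε hu))).congr_deriv ?_
  rw [relEntSnd]
  ring

theorem mul_sq_relEntCurv_mem (hε : 0 < ε) (h1 : ε < 1) (hu : 0 < u) :
    u ^ 2 * relEntCurv ε u ∈ Icc 0 1 := by
  have i1 : 0 < 1 + ε * u := by positivity
  have i2 : 0 < u + ε := by positivity
  have e : u ^ 2 * relEntCurv ε u = (u / (u + ε)) ^ 2 - (ε * u / (1 + ε * u)) ^ 2 := by
    rw [relEntCurv]; field_simp
  have b1 : u / (u + ε) ≤ 1 := by rw [div_le_one i2]; linarith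
  have b2 : ε * u / (1 + ε * u) ≤ u / (u + ε) := by
    rw [div_le_div_iff₀ i1 i2]
    nlinarith [mul_pos hε hu, mul_pos (mul_pos hε hu) hε, mul_pos (mul_pos hu hu) hε]
  have b0 : 0 ≤ ε * u / (1 + ε * u) := by positivity
  have b3 : 0 ≤ u / (u + ε) := by positivity
  rw [e]
  constructor
  · nlinarith
  · nlinarith

theorem hasDerivAt_relEnt {ρ α : ℝ → ℝ} {ρ' α' t : ℝ} (hε : 0 < ε) (hρ : 0 < ρ t) (hα : 0 < α t)
    (dρ : HasDerivAt ρ ρ' t) (dα : HasDerivAt α α' t) :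
    HasDerivAt (fun s => relEnt ε (ρ s) (α s))
      (relEntFst ε (α t / ρ t) * ρ' + relEntSnd ε (α t / ρ t) * α') t := by
  have h1 : 0 < ρ t + ε * α t := by positivity
  have h2 : 0 < α t + ε * ρ t := by positivity
  refine (dρ.fun_mul (((dρ.fun_add (dα.const_mul ε)).log h1.ne').fun_sub
    ((dα.fun_add (dρ.const_mul ε)).log h2.ne'))).congr_deriv ?_
  simp only [relEntFst, relEntSnd]
  have e1 : 1 + ε * (α t / ρ t) = (ρ t + ε * α t) / ρ t := by field_simp
  have e2 : α t / ρ t + ε = (α t + ε * ρ t) / ρ t := by field_simp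
  rw [e1, e2, Real.log_div h1.ne' hρ.ne', Real.log_div h2.ne' hρ.ne']
  field_simp
  ring

theorem abs_log_sub_log_le (hε : 0 < ε) (h1 : ε < 1) (hp : 0 < p) (hq : 0 < q) :
    |Real.log (p + ε * q) - Real.log (q + ε * p)| ≤ -Real.log ε := by
  have key : ∀ {p q : ℝ}, 0 < p → 0 < q →
      Real.log (p + ε * q) - Real.log (q + ε * p) ≤ -Real.log ε := fun {p q} hp hq => by
    have i1 : 0 < p + ε * q := by positivity
    have i2 : ε * (p + ε * q) ≤ q + ε * p := by nlinarith [mul_pos hε hq]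
    have := Real.log_le_log (by positivity) i2
    rw [Real.log_mul hε.ne' i1.ne'] at this
    linarith
  rw [abs_le]
  constructor
  · linarith [key hq hp]
  · exact key hp hq

theorem abs_relEnt_le (hε : 0 < ε) (h1 : ε < 1) (hp : 0 < p) (hq : 0 < q) :
    |relEnt ε p q| ≤ p * -Real.log ε := by
  rw [relEnt, abs_mul, abs_of_pos hp]
  gcongr
  exact abs_log_sub_log_le hε h1 hp hq

theorem log_sub_log_le_div (hp : 0 < p) (hq : 0 < q) : Real.log p - Real.log q ≤ (p - q) / q := by
  have := Real.log_le_sub_one_of_pos (div_pos hp hq)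
  rw [Real.log_div hp.ne' hq.ne'] at this
  rwa [sub_div, div_self hq.ne']

theorem relEnt_sub_le_snd (hε : 0 < ε) (h1 : ε < 1) (hp : 0 < p) (hq : 0 < q) (hq' : 0 < q')
    (hD : 0 ≤ D) (h : q - q' ≤ D) : relEnt ε p q' - relEnt ε p q ≤ D / ε := by
  have i1 : 0 < p + ε * q := by positivity
  have i2 : 0 < q + ε * p := by positivity
  have i3 : 0 < p + ε * q' := by positivity
  have i4 : 0 < q' + ε * p := by positivity
  have e : relEnt ε p q' - relEnt ε p q = p * (Real.log (p + ε * q') - Real.log (p + ε * q) +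
      (Real.log (q + ε * p) - Real.log (q' + ε * p))) := by rw [relEnt, relEnt]; ring
  rw [e]
  rcases le_total q q' with hle | hle
  · have : Real.log ((p + ε * q') * (q + ε * p)) ≤ Real.log ((p + ε * q) * (q' + ε * p)) := by
      apply Real.log_le_log (by positivity)
      have : 0 ≤ (1 - ε * ε) * p * (q' - q) :=
        mul_nonneg (mul_nonneg (by nlinarith) hp.le) (sub_nonneg.2 hle)
      nlinarith
    rw [Real.log_mul i3.ne' i2.ne', Real.log_mul i1.ne' i4.ne'] at this
    refine (mul_nonpos_of_nonneg_of_nonpos hp.le (by linarith)).trans (by positivity)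
  · have a1 : Real.log (p + ε * q') ≤ Real.log (p + ε * q) :=
      Real.log_le_log i3 (by nlinarith)
    have a2 := log_sub_log_le_div i2 i4
    have a3 : (q + ε * p - (q' + ε * p)) / (q' + ε * p) ≤ D / (ε * p) := by
      rw [add_sub_add_right_eq_sub]
      exact div_le_div₀ hD h (by positivity) (by linarith)
    calc _ ≤ p * (D / (ε * p)) := mul_le_mul_of_nonneg_left (by linarith) hp.le
      _ = D / ε := by field_simp

theorem relEnt_sub_le_fst (hε : 0 < ε) (h1 : ε < 1) (hp : 0 < p) (hp' : 0 < p') (hq : 0 < q)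
    (h : |p' - p| ≤ D) : relEnt ε p' q - relEnt ε p q ≤ (1 - Real.log ε) * D := by
  have i1 : 0 < p + ε * q := by positivity
  have i2 : 0 < q + ε * p := by positivity
  have i3 : 0 < p' + ε * q := by positivity
  have i4 : 0 < q + ε * p' := by positivity
  have hlog : 0 ≤ -Real.log ε := by linarith [Real.log_neg hε h1]
  have a0 : ∀ z, |z| ≤ -Real.log ε → (p' - p) * z ≤ -Real.log ε * D := fun z hz => by
    refine (le_abs_self _).trans ?_
    rw [abs_mul, mul_comm]
    exact mul_le_mul hz h (abs_nonneg _) hlog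
  rcases le_total p p' with hle | hle
  · have e : relEnt ε p' q - relEnt ε p q =
        (p' - p) * (Real.log (p' + ε * q) - Real.log (q + ε * p')) +
        p * (Real.log (p' + ε * q) - Real.log (p + ε * q) +
          (Real.log (q + ε * p) - Real.log (q + ε * p'))) := by rw [relEnt, relEnt]; ring
    have a1 : Real.log (q + ε * p) ≤ Real.log (q + ε * p') := Real.log_le_log i2 (by nlinarith)
    have a2 := log_sub_log_le_div i3 i1
    have a3 : (p' + ε * q - (p + ε * q)) / (p + ε * q) ≤ (p' - p) / p := by
      rw [add_sub_add_right_eq_sub]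
      exact div_le_div_of_nonneg_left (by linarith) hp (by nlinarith)
    have a4 : p * (Real.log (p' + ε * q) - Real.log (p + ε * q) +
          (Real.log (q + ε * p) - Real.log (q + ε * p'))) ≤ p * ((p' - p) / p) :=
      mul_le_mul_of_nonneg_left (by linarith) hp.le
    rw [mul_div_cancel₀ _ hp.ne'] at a4
    linarith [a0 _ (abs_log_sub_log_le hε h1 hp' hq), le_abs_self (p' - p)]
  · have e : relEnt ε p' q - relEnt ε p q =
        (p' - p) * (Real.log (p + ε * q) - Real.log (q + ε * p)) +
        p' * (Real.log (p' + ε * q) - Real.log (p + ε * q) +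
          (Real.log (q + ε * p) - Real.log (q + ε * p'))) := by rw [relEnt, relEnt]; ring
    have a1 : Real.log (p' + ε * q) ≤ Real.log (p + ε * q) := Real.log_le_log i3 (by nlinarith)
    have a2 := log_sub_log_le_div i2 i4
    have a3 : (q + ε * p - (q + ε * p')) / (q + ε * p') ≤ (p - p') / p' := by
      rw [add_sub_add_left_eq_sub, ← mul_sub, div_le_div_iff₀ i4 hp']
      nlinarith [mul_nonneg (sub_nonneg.2 hle) hq.le]
    have a4 : p' * (Real.log (p' + ε * q) - Real.log (p + ε * q) +
          (Real.log (q + ε * p) - Real.log (q + ε * p'))) ≤ p' * ((p - p') / p') :=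
      mul_le_mul_of_nonneg_left (by linarith) hp'.le
    rw [mul_div_cancel₀ _ hp'.ne'] at a4
    linarith [a0 _ (abs_log_sub_log_le hε h1 hp hq), neg_abs_le (p' - p)]

end RegularizedEntropy

section SpatialEstimate

variable {d : ℕ} {l ε : ℝ}

theorem integrable_box {g : E d → ℝ} (hg : Continuous g) :
    Integrable g (volume.restrict (box d l)) :=
  hg.continuousOn.integrableOn_compact isCompact_box

theorem continuous_diverg {F : E d → E d} (hF : ContDiff ℝ (⊤ : ℕ∞) F) : Continuous (diverg F) := by
  rw [show diverg F = _ from funext fun x => diverg_eq (hF.differentiable (by simp) x)]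
  exact continuous_finsetSum _ fun i _ =>
    (contDiff_dirDeriv (contDiff_euclidean.1 hF i) _).continuous

theorem IsPeriodic.gradient {g : E d → ℝ} (hg : IsPeriodic l g) :
    IsPeriodic l (_root_.gradient g) := fun x i => by
  ext j
  rw [gradient_apply, gradient_apply]
  exact hasPeriods_boxPeriods.1 ((hasPeriods_boxPeriods.2 hg).fderiv_apply (uvec d j)) x i

theorem IsPeriodic.score {g : E d → ℝ} (hg : IsPeriodic l g) : IsPeriodic l (_root_.score g) :=
  IsPeriodic.gradient fun x i => by rw [hg]

theorem contDiff_score {g : E d → ℝ} (hg : ContDiff ℝ (⊤ : ℕ∞) g) (h0 : ∀ x, 0 < g x) :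
    ContDiff ℝ (⊤ : ℕ∞) (score g) :=
  contDiff_gradient (hg.log fun x => (h0 x).ne')

theorem integral_mul_diverg {P : E d → ℝ} {F : E d → E d} (hl : 0 < l)
    (hP : ContDiff ℝ (⊤ : ℕ∞) P) (hPp : IsPeriodic l P) (hF : ContDiff ℝ (⊤ : ℕ∞) F)
    (hFp : IsPeriodic l F) :
    ∫ x in box d l, P x * diverg F x =
      -∫ x in box d l, ∑ i, F x i * dirDeriv (uvec d i) P x := by
  have hFi : ∀ i, ContDiff ℝ (⊤ : ℕ∞) fun y => F y i := fun i => contDiff_euclidean.1 hF i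
  have hPd := hP.differentiable (by simp)
  have c1 : ∀ i, Continuous fun x => P x * dirDeriv (uvec d i) (fun y => F y i) x := fun i =>
    hP.continuous.mul (contDiff_dirDeriv (hFi i) _).continuous
  have c2 : ∀ i, Continuous fun x => F x i * dirDeriv (uvec d i) P x := fun i =>
    (hFi i).continuous.mul (contDiff_dirDeriv hP _).continuous
  have key : ∀ i, (∫ x in box d l, P x * dirDeriv (uvec d i) (fun y => F y i) x) +
      ∫ x in box d l, F x i * dirDeriv (uvec d i) P x = 0 := fun i => by
    rw [← integral_add (integrable_box (c1 i)) (integrable_box (c2 i))]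
    have h1 : ContDiff ℝ 1 fun y => P y * F y i :=
      contDiff_infty.1 (hP.mul (hFi i)) 1
    rw [← setIntegral_box_fderiv h1 hl (fun x j => by rw [hPp, hFp]) i]
    exact integral_congr_ae <| .of_forall fun x =>
      (dirDeriv_mul (hPd x) ((hFi i).differentiable (by simp) x) (uvec d i)).symm
  simp only [diverg_eq (hF.differentiable (by simp) _), Finset.mul_sum]
  rw [integral_finsetSum _ fun i _ => integrable_box (c1 i),
    integral_finsetSum _ fun i _ => integrable_box (c2 i), ← Finset.sum_neg_distrib]
  exact Finset.sum_congr rfl fun i _ => eq_neg_of_add_eq_zero_left (key i)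

theorem dirDeriv_comp {φ : ℝ → ℝ} {φ' : ℝ} {u : E d → ℝ} {x : E d} (hφ : HasDerivAt φ φ' (u x))
    (hu : DifferentiableAt ℝ u x) (v : E d) :
    dirDeriv v (fun y => φ (u y)) x = φ' * dirDeriv v u x := by
  have := (hφ.comp_hasFDerivAt x hu.hasFDerivAt).fderiv
  exact DFunLike.congr_fun this v

theorem contDiff_relEntSnd {u : E d → ℝ} (hε : 0 < ε) (hu : ContDiff ℝ (⊤ : ℕ∞) u)
    (h0 : ∀ x, 0 < u x) : ContDiff ℝ (⊤ : ℕ∞) fun x => relEntSnd ε (u x) := by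
  have h1 : ∀ x, 1 + ε * u x ≠ 0 := fun x => by have := h0 x; positivity
  have h2 : ∀ x, u x + ε ≠ 0 := fun x => by have := h0 x; positivity
  exact (contDiff_const.div (contDiff_const.add (contDiff_const.mul hu)) h1).sub
    (contDiff_const.div (hu.add contDiff_const) h2)

theorem contDiff_relEntFst {u : E d → ℝ} (hε : 0 < ε) (hu : ContDiff ℝ (⊤ : ℕ∞) u)
    (h0 : ∀ x, 0 < u x) : ContDiff ℝ (⊤ : ℕ∞) fun x => relEntFst ε (u x) := by
  have h1 : ∀ x, 1 + ε * u x ≠ 0 := fun x => by have := h0 x; positivity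
  have h2 : ∀ x, u x + ε ≠ 0 := fun x => by have := h0 x; positivity
  exact (((contDiff_const.add (contDiff_const.mul hu)).log h1).sub
    ((hu.add contDiff_const).log h2)).sub (hu.mul (contDiff_relEntSnd hε hu h0))

/-- The entropy dissipation inequality at a fixed time. -/
theorem integral_relEnt_deriv_le {V ρ α σ : E d → ℝ} {A : E d → E d} (hl : 0 < l) (hε : 0 < ε)
    (h1 : ε < 1) (hV : ContDiff ℝ (⊤ : ℕ∞) V) (hVp : IsPeriodic l V)
    (hσ : ContDiff ℝ (⊤ : ℕ∞) σ) (hσ0 : ∀ x, 0 < σ x) (hσp : IsPeriodic l σ)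
    (hρ : ContDiff ℝ (⊤ : ℕ∞) ρ) (hρ0 : ∀ x, 0 < ρ x) (hρp : IsPeriodic l ρ)
    (hα : ContDiff ℝ (⊤ : ℕ∞) α) (hα0 : ∀ x, 0 < α x) (hαp : IsPeriodic l α)
    (hA : ∀ x, A x = -gradient V x - score σ x) :
    ∫ x in box d l, (relEntFst ε (α x / ρ x) * -diverg (fun y => ρ y • A y) x +
        relEntSnd ε (α x / ρ x) * (lap α x + diverg (fun y => α y • gradient V y) x)) ≤
      ∫ x in box d l, 1 / 4 * (‖score σ x - score ρ x‖ ^ 2 * ρ x) := by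
  have hlog : ∀ {g : E d → ℝ}, ContDiff ℝ (⊤ : ℕ∞) g → (∀ x, 0 < g x) →
      ContDiff ℝ (⊤ : ℕ∞) (score g) := contDiff_score
  obtain rfl : A = fun x => -gradient V x - score σ x := funext hA
  set u : E d → ℝ := fun x => α x / ρ x with hu_def
  have hu : ContDiff ℝ (⊤ : ℕ∞) u := hα.div hρ fun x => (hρ0 x).ne'
  have hu0 : ∀ x, 0 < u x := fun x => div_pos (hα0 x) (hρ0 x)
  have hup : IsPeriodic l u := fun x i => by rw [hu_def]; simp only [hαp x i, hρp x i]
  set F : E d → E d := fun y => ρ y • (-gradient V y - score σ y) with hF_def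
  set G : E d → E d := fun y => gradient α y + α y • gradient V y with hG_def
  have hF : ContDiff ℝ (⊤ : ℕ∞) F := hρ.smul ((contDiff_gradient hV).neg.sub (hlog hσ hσ0))
  have hG : ContDiff ℝ (⊤ : ℕ∞) G := (contDiff_gradient hα).add (hα.smul (contDiff_gradient hV))
  have hFp : IsPeriodic l F := fun x i => by
    simp only [hF_def]; rw [hρp, hσp.score, hVp.gradient]
  have hGp : IsPeriodic l G := fun x i => by
    simp only [hG_def]; rw [hαp, hαp.gradient, hVp.gradient]
  have hP := contDiff_relEntFst hε hu hu0
  have hQ := contDiff_relEntSnd hε hu hu0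
  have hdG : ∀ x, lap α x + diverg (fun y => α y • gradient V y) x = diverg G x := fun x => by
    simp only [lap, diverg, ← Finset.sum_add_distrib]
    refine Finset.sum_congr rfl fun i _ => ?_
    rw [hG_def, fderiv_fun_add ((contDiff_gradient hα).differentiable (by simp) x)
      (g := fun y => α y • gradient V y)
      ((hα.smul (contDiff_gradient hV)).differentiable (by simp) x)]
    rfl
  have hcF : ∀ {F : E d → E d} {P : E d → ℝ}, ContDiff ℝ (⊤ : ℕ∞) F → ContDiff ℝ (⊤ : ℕ∞) P →
      Continuous fun x => ∑ i, F x i * dirDeriv (uvec d i) P x := fun hF hP =>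
    continuous_finsetSum _ fun i _ =>
      (contDiff_euclidean.1 hF i).continuous.mul (contDiff_dirDeriv hP _).continuous
  have i1 : Integrable (fun x => relEntFst ε (u x) * diverg F x) (volume.restrict (box d l)) :=
    integrable_box (hP.continuous.mul (continuous_diverg hF))
  have i2 : Integrable (fun x => relEntSnd ε (u x) * diverg G x) (volume.restrict (box d l)) :=
    integrable_box (hQ.continuous.mul (continuous_diverg hG))
  have i3 := integrable_box (l := l) (hcF hF hP)
  have i4 := integrable_box (l := l) (hcF hG hQ)
  have e0 : (∫ x in box d l, (relEntFst ε (u x) * -diverg F x + relEntSnd ε (u x) *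
      (lap α x + diverg (fun y => α y • gradient V y) x))) =
      ∫ x in box d l, (∑ i, F x i * dirDeriv (uvec d i) (fun y => relEntFst ε (u y)) x -
        ∑ i, G x i * dirDeriv (uvec d i) (fun y => relEntSnd ε (u y)) x) := by
    rw [integral_sub i3 i4]
    simp only [hdG, mul_neg]
    rw [integral_add i1.fun_neg i2, integral_neg,
      integral_mul_diverg hl hP (fun x i => by rw [hup]) hF hFp,
      integral_mul_diverg hl hQ (fun x i => by rw [hup]) hG hGp, neg_neg, sub_eq_add_neg]
  refine e0.le.trans ?_
  refine integral_mono (integrable_box ((hcF hF hP).sub (hcF hG hQ))) (integrable_box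
    (continuous_const.mul ((((hlog hσ hσ0).continuous.sub (hlog hρ hρ0).continuous).norm.pow 2).mul
      hρ.continuous))) fun x => ?_
  simp only []
  rw [← Finset.sum_sub_distrib, EuclideanSpace.norm_sq_eq, Finset.sum_mul, Finset.mul_sum]
  refine Finset.sum_le_sum fun i _ => ?_
  have dρ := hρ.differentiable (by simp) x
  have dα := hα.differentiable (by simp) x
  have du := hu.differentiable (by simp) x
  have eP := dirDeriv_comp (hasDerivAt_relEntFst hε (hu0 x)) du (uvec d i)
  have eQ := dirDeriv_comp (hasDerivAt_relEntSnd hε (hu0 x)) du (uvec d i)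
  have es : score ρ x i = dirDeriv (uvec d i) ρ x / ρ x := by
    rw [score_apply, dirDeriv_log dρ (hρ0 x).ne']
  have hρx := hρ0 x
  have hαx := hα0 x
  have eα : dirDeriv (uvec d i) α x =
      u x * dirDeriv (uvec d i) ρ x + ρ x * dirDeriv (uvec d i) u x := by
    rw [← dirDeriv_mul du dρ]
    congr 1
    funext y
    exact (div_mul_cancel₀ _ (hρ0 y).ne').symm
  obtain ⟨k0, k1⟩ := mul_sq_relEntCurv_mem hε h1 (hu0 x)
  rw [eP, eQ, Real.norm_eq_abs, sq_abs]
  have eF : F x i = ρ x * (-dirDeriv (uvec d i) V x - score σ x i) := by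
    rw [← gradient_apply]; rfl
  have eG : G x i = dirDeriv (uvec d i) α x + α x * dirDeriv (uvec d i) V x := by
    rw [← gradient_apply, ← gradient_apply]; rfl
  have es' : (score σ x - score ρ x) i = score σ x i - score ρ x i := rfl
  rw [es', eF, eG]
  set κ := relEntCurv ε (u x)
  set a := dirDeriv (uvec d i) α x / α x with ha
  have hα' : α x = u x * ρ x := (div_mul_cancel₀ _ hρx.ne').symm
  have ea : dirDeriv (uvec d i) α x = u x * ρ x * a := by rw [← hα', ha]; field_simp
  have er : dirDeriv (uvec d i) ρ x = ρ x * score ρ x i := by rw [es]; field_simp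
  have eu : dirDeriv (uvec d i) u x = u x * (a - score ρ x i) := by
    apply mul_left_cancel₀ hρx.ne'
    rw [ea, er] at eα
    linarith
  rw [ea, eu, hα']
  have e : ρ x * (-dirDeriv (uvec d i) V x - score σ x i) *
        (-(u x * κ) * (u x * (a - score ρ x i))) -
      (u x * ρ x * a + u x * ρ x * dirDeriv (uvec d i) V x) *
        (κ * (u x * (a - score ρ x i))) =
      u x ^ 2 * κ * ((a - score ρ x i) * (score σ x i - a) * ρ x) := by ring
  rw [e]
  have hy : (a - score ρ x i) * (score σ x i - a) * ρ x ≤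
      1 / 4 * ((score σ x i - score ρ x i) ^ 2 * ρ x) := by
    nlinarith [mul_nonneg (sq_nonneg (2 * a - score ρ x i - score σ x i)) hρx.le]
  have hy0 : 0 ≤ 1 / 4 * ((score σ x i - score ρ x i) ^ 2 * ρ x) := by positivity
  calc _ ≤ u x ^ 2 * κ * (1 / 4 * ((score σ x i - score ρ x i) ^ 2 * ρ x)) :=
        mul_le_mul_of_nonneg_left hy k0
    _ ≤ 1 * (1 / 4 * ((score σ x i - score ρ x i) ^ 2 * ρ x)) :=
        mul_le_mul_of_nonneg_right k1 hy0
    _ = _ := one_mul _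

end SpatialEstimate

section RelativeFisherInformation

variable {d : ℕ} {l T C M : ℝ} {ρ σ : ℝ → E d → ℝ}

theorem stronglyMeasurable_score_apply (hs : ∀ t, ContDiff ℝ (⊤ : ℕ∞) (ρ t)) (h0 : ∀ t x, 0 < ρ t x)
    (hc : ∀ x, Continuous fun t => ρ t x) (i : Fin d) :
    StronglyMeasurable (Function.uncurry fun t x => score (ρ t) x i) := by
  have hlog : ∀ t, ContDiff ℝ (⊤ : ℕ∞) fun x => Real.log (ρ t x) := fun t =>
    (hs t).log fun x => (h0 t x).ne'
  have hm : ∀ n : ℕ, StronglyMeasurable (Function.uncurry fun t x => (n : ℝ) •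
      (Real.log (ρ t (x + (n : ℝ)⁻¹ • uvec d i)) - Real.log (ρ t x))) := fun n => by
    refine stronglyMeasurable_uncurry_of_continuous_of_stronglyMeasurable (fun x => ?_) fun t => ?_
    · have h1 := (hc (x + (n : ℝ)⁻¹ • uvec d i)).log fun t => (h0 t _).ne'
      have h2 := (hc x).log fun t => (h0 t _).ne'
      exact (h1.sub h2).const_smul (n : ℝ)
    · have h1 := (hlog t).continuous
      have h2 : Continuous fun x : E d => x + (n : ℝ)⁻¹ • uvec d i := by fun_prop
      exact (((h1.comp h2).sub h1).const_smul (n : ℝ)).stronglyMeasurable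
  refine stronglyMeasurable_of_tendsto atTop hm (tendsto_pi_nhds.2 fun z => ?_)
  simp only [Function.uncurry, score_apply]
  exact (((hlog z.1).differentiable (by simp) z.2).hasFDerivAt.lim_real (uvec d i)).comp
    tendsto_natCast_atTop_atTop

theorem integrableOn_relFisher (hσ : ∀ t, ContDiff ℝ (⊤ : ℕ∞) (σ t)) (hσ0 : ∀ t x, 0 < σ t x)
    (hσc : ∀ x, Continuous fun t => σ t x) (hρ : ∀ t, ContDiff ℝ (⊤ : ℕ∞) (ρ t))
    (hρ0 : ∀ t x, 0 < ρ t x) (hρc : ∀ x, Continuous fun t => ρ t x)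
    (hbσ : ∀ t ∈ Icc 0 T, ∀ i x, |score (σ t) x i| ≤ C)
    (hbρ : ∀ t ∈ Icc 0 T, ∀ i x, |score (ρ t) x i| ≤ C) (hM : ∀ t ∈ Icc 0 T, ∀ x, ρ t x ≤ M) :
    IntegrableOn (fun s => ∫ x in box d l, ‖score (σ s) x - score (ρ s) x‖ ^ 2 * ρ s x)
      (Icc 0 T) := by
  have e : ∀ s x, ‖score (σ s) x - score (ρ s) x‖ ^ 2 * ρ s x =
      (∑ i, (score (σ s) x i - score (ρ s) x i) ^ 2) * ρ s x := fun s x => by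
    rw [EuclideanSpace.norm_sq_eq]
    simp only [Real.norm_eq_abs, sq_abs]
    rfl
  have hm : StronglyMeasurable (Function.uncurry fun s x =>
      (∑ i, (score (σ s) x i - score (ρ s) x i) ^ 2) * ρ s x) := by
    refine StronglyMeasurable.mul ?_ (stronglyMeasurable_uncurry_of_continuous_of_stronglyMeasurable
      hρc fun t => (hρ t).continuous.stronglyMeasurable)
    exact Finset.stronglyMeasurable_fun_sum _ fun i _ =>
      ((stronglyMeasurable_score_apply hσ hσ0 hσc i).sub
        (stronglyMeasurable_score_apply hρ hρ0 hρc i)).pow 2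
  simp only [e]
  refine Measure.integrableOn_of_bounded (M := (∑ _i : Fin d, (C + C) ^ 2) * M *
    volume.real (box d l)) isCompact_Icc.measure_ne_top
    hm.integral_prod_right.aestronglyMeasurable ?_
  filter_upwards [ae_restrict_mem measurableSet_Icc] with s hs
  refine norm_setIntegral_le_of_norm_le_const isCompact_box.measure_lt_top fun x _ => ?_
  have h1 : 0 ≤ ∑ i, (score (σ s) x i - score (ρ s) x i) ^ 2 :=
    Finset.sum_nonneg fun i _ => sq_nonneg _
  rw [Real.norm_eq_abs, abs_mul, abs_of_nonneg h1, abs_of_pos (hρ0 s x)]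
  refine mul_le_mul (Finset.sum_le_sum fun i _ => ?_) (hM s hs x) (hρ0 s x).le
    (Finset.sum_nonneg fun i _ => sq_nonneg _)
  rw [← sq_abs]
  exact pow_le_pow_left₀ (abs_nonneg _)
    ((abs_sub _ _).trans (add_le_add (hbσ s hs i x) (hbρ s hs i x))) 2

/-- Removing the regularization of the relative entropy. -/
theorem KLdiv_le_of_relEnt_le {p q : E d → ℝ} {B : ℝ} (hp : Continuous p) (hq : Continuous q)
    (hp0 : ∀ x, 0 < p x) (hq0 : ∀ x, 0 < q x)
    (h : ∀ ε ∈ Ioo (0 : ℝ) 1, ∫ x in box d l, relEnt ε (p x) (q x) ≤ B) : KLdiv d l p q ≤ B := by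
  have hc : Continuous fun ε : ℝ => ∫ x in box d l, relEnt |ε| (p x) (q x) := by
    refine continuous_parametric_integral_of_continuous ?_ isCompact_box
    have hp' := hp.comp (continuous_snd (X := ℝ))
    have hq' := hq.comp (continuous_snd (X := ℝ))
    have ha := continuous_abs.comp (continuous_fst (X := ℝ) (Y := E d))
    refine hp'.mul (((hp'.add (ha.mul hq')).log fun z => ?_).sub
      ((hq'.add (ha.mul hp')).log fun z => ?_))
    · have := hp0 z.2
      have := hq0 z.2
      change p z.2 + |z.1| * q z.2 ≠ 0
      positivity
    · have := hp0 z.2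
      have := hq0 z.2
      change q z.2 + |z.1| * p z.2 ≠ 0
      positivity
  have h0 : KLdiv d l p q = ∫ x in box d l, relEnt |0| (p x) (q x) := by
    refine integral_congr_ae (.of_forall fun x => ?_)
    simp only [relEnt, abs_zero, zero_mul, add_zero]
    rw [Real.log_div (hp0 x).ne' (hq0 x).ne']
  rw [h0]
  refine le_of_tendsto ((hc.tendsto 0).mono_left (nhdsWithin_le_nhds (s := Ioi 0))) ?_
  filter_upwards [Ioo_mem_nhdsGT (zero_lt_one' ℝ)] with ε hε
  rw [abs_of_pos hε.1]
  exact h ε hε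

end RelativeFisherInformation

section EntropyDissipation

variable {d : ℕ} {l T C ε : ℝ} {V ρ1 ρ2 αs : ℝ → E d → ℝ} {α₀ : E d → ℝ}

/-- The rate of change of the regularized relative entropy is bounded. -/
theorem exists_abs_relEnt_deriv_le {V ρ α : E d → ℝ} {A : E d → E d} (hl : 0 < l) (hε : 0 < ε)
    (hV : ContDiff ℝ (⊤ : ℕ∞) V) (hVp : IsPeriodic l V)
    (hA : ContDiff ℝ (⊤ : ℕ∞) A) (hAp : IsPeriodic l A)
    (hρ : ContDiff ℝ (⊤ : ℕ∞) ρ) (hρ0 : ∀ x, 0 < ρ x) (hρp : IsPeriodic l ρ)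
    (hα : ContDiff ℝ (⊤ : ℕ∞) α) (hα0 : ∀ x, 0 < α x) (hαp : IsPeriodic l α) :
    ∃ K, ∀ x, |relEntFst ε (α x / ρ x) * -diverg (fun y => ρ y • A y) x +
        relEntSnd ε (α x / ρ x) * (lap α x + diverg (fun y => α y • gradient V y) x)| ≤ K := by
  have hu : ContDiff ℝ (⊤ : ℕ∞) fun x => α x / ρ x := hα.div hρ fun x => (hρ0 x).ne'
  have hu0 : ∀ x, 0 < α x / ρ x := fun x => div_pos (hα0 x) (hρ0 x)
  refine (isCompactCell_box hl).isPeriodCell.bdd _ ?_ (hasPeriods_boxPeriods.2 fun x i => ?_)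
  · exact ((contDiff_relEntFst hε hu hu0).continuous.mul (continuous_diverg (hρ.smul hA)).neg).add
      ((contDiff_relEntSnd hε hu hu0).continuous.mul
        ((continuous_diverg (contDiff_gradient hα)).add
          (continuous_diverg (hα.smul (contDiff_gradient hV)))))
  · have p1 : IsPeriodic l fun y => ρ y • A y := fun x i => by simp only [hρp x i, hAp x i]
    have p2 : IsPeriodic l fun y => α y • gradient V y := fun x i => by
      simp only [hαp x i, hVp.gradient x i]
    have p3 : IsPeriodic l (lap α) := hαp.gradient.diverg
    simp only [hαp x i, hρp x i, p1.diverg x i, p2.diverg x i, p3 x i]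

/-- The regularized relative entropy of the auxiliary system with respect to the Fokker–Planck
solution is controlled by the relative Fisher information. -/
theorem integral_relEnt_le (hl : 0 < l) (hd : 0 < d) (hV : ∀ t, ContDiff ℝ (⊤ : ℕ∞) (V t))
    (hVp : ∀ t ∈ Icc 0 T, IsPeriodic l (V t))
    (h1s : ∀ t, ContDiff ℝ (⊤ : ℕ∞) (ρ1 t)) (h10 : ∀ t x, 0 < ρ1 t x)
    (h1p : ∀ t, IsPeriodic l (ρ1 t)) (h2 : TransportedBy d l (Avf V ρ1) α₀ ρ2)
    (hα : SolvesFPE d l V α₀ αs)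
    (hlog : IsLogSol l T C (fun t i x => Avf V ρ1 t x i) fun t x => Real.log (ρ2 t x))
    (hb : ∀ t ∈ Icc 0 T, ∀ i x, |dirDeriv (uvec d i) (V t) x| ≤ C ∧ |lap (V t) x| ≤ C)
    (hint : IntegrableOn (fun s => ∫ x in box d l, ‖score (ρ1 s) x - score (ρ2 s) x‖ ^ 2 * ρ2 s x)
      (Icc 0 T)) (hε : ε ∈ Ioo (0 : ℝ) 1) {t : ℝ} (ht : t ∈ Icc 0 T) :
    ∫ x in box d l, relEnt ε (ρ2 t x) (αs t x) ≤
      1 / 4 * ∫ s in (0 : ℝ)..t, ∫ x in box d l,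
        ‖score (ρ1 s) x - score (ρ2 s) x‖ ^ 2 * ρ2 s x := by
  obtain ⟨h2s, h20, h2p, h2i, h2d⟩ := h2
  have hsub : Icc 0 t ⊆ Icc 0 T := Icc_subset_Icc_right ht.2
  have hfin := isFiniteMeasure_restrict (isCompact_box (d := d) (l := l))
  have hlin := hα.isLinSol hl hV hVp hlog.nonneg (fun s hs i x => (hb s hs i x).1)
    fun s hs x => (hb s hs ⟨0, hd⟩ x).2
  obtain ⟨hαs, hα0, hαp, hαi, hαd⟩ := hα
  obtain ⟨M, -, hM⟩ := hlog.exists_abs_le hl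
  have hexp : ∀ s x, Real.exp (Real.log (ρ2 s x)) = ρ2 s x := fun s x => Real.exp_log (h20 s x)
  have hcont : ∀ s, Continuous fun x => relEnt ε (ρ2 s x) (αs s x) := fun s => by
    have c2 := (h2s s).continuous
    have ca := (hαs s).continuous
    exact c2.mul (((c2.add (ca.const_mul ε)).log fun x =>
      (add_pos (h20 s x) (mul_pos hε.1 (hα0 s x))).ne').sub
        ((ca.add (c2.const_mul ε)).log fun x =>
          (add_pos (hα0 s x) (mul_pos hε.1 (h20 s x))).ne'))
  have hder : ∀ s x, HasDerivAt (fun s => relEnt ε (ρ2 s x) (αs s x)) _ s := fun s x =>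
    hasDerivAt_relEnt hε.1 (h20 s x) (hα0 s x) (h2d s x) (hαd s x)
  have hF0 : ∫ x in box d l, relEnt ε (ρ2 0 x) (αs 0 x) = 0 := by
    simp only [h2i, hαi, relEnt_self, integral_zero]
  have hFc : ContinuousOn (fun s => ∫ x in box d l, relEnt ε (ρ2 s x) (αs s x)) (Icc 0 t) := by
    refine continuousOn_of_dominated (bound := fun _ => Real.exp M * -Real.log ε)
      (fun s _ => (hcont s).aestronglyMeasurable) (fun s hs => .of_forall fun x => ?_)
      (integrable_const _) (.of_forall fun x s _ => (hder s x).continuousAt.continuousWithinAt)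
    refine (abs_relEnt_le hε.1 hε.2 (h20 s x) (hα0 s x)).trans ?_
    have := Real.log_neg hε.1 hε.2
    refine mul_le_mul_of_nonneg_right ?_ (by linarith)
    rw [← hexp s x, Real.exp_le_exp]
    exact (le_abs_self _).trans (hM s (hsub hs) x)
  have key := sub_le_integral_of_eventually_slope_lt ht.1 hFc
    ((hint.mono_set hsub).const_mul (1 / 4)) fun s hs y hy => ?_
  · rwa [hF0, sub_zero, intervalIntegral.integral_const_mul] at key
  have hsT : s ∈ Icc 0 T := hsub (Ico_subset_Icc_self hs)
  obtain ⟨C₁, hC₁, hb₁⟩ := hlog.exists_abs_exp_sub_le hl hsT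
  simp only [hexp] at hb₁
  obtain ⟨C₂, hC₂, hb₂⟩ := hlin.exists_sub_le hsT
  have hAp : IsPeriodic l (Avf V ρ1 s) := fun x i => by
    simp only [Avf, (hVp s hsT).gradient x i, (h1p s).score x i]
  obtain ⟨Q, hQ⟩ := exists_abs_relEnt_deriv_le hl hε.1 (hV s) (hVp s hsT)
    ((contDiff_gradient (hV s)).neg.sub (contDiff_score (h1s s) (h10 s))) hAp
    (h2s s) (h20 s) (h2p s) (hαs s) (hα0 s) (hαp s)
  refine eventually_slope_integral_lt (K := (1 - Real.log ε) * C₁ + C₂ / ε) hs.2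
    (fun u _ => integrable_box (hcont u)) hQ (fun u hu x => ?_)
    (fun x => (hder s x).hasDerivWithinAt) (lt_of_le_of_lt ?_ hy)
  · have huT : u ∈ Icc s T := ⟨hu.1.le, hu.2.le.trans ht.2⟩
    have hst : 0 ≤ u - s := sub_nonneg.2 hu.1.le
    have e1 := relEnt_sub_le_fst hε.1 hε.2 (h20 s x) (h20 u x) (hα0 u x) (hb₁ u huT x)
    have e2 := relEnt_sub_le_snd hε.1 hε.2 (h20 s x) (hα0 s x) (hα0 u x) (mul_nonneg hC₂ hst)
      (by linarith [hb₂ u huT x])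
    calc _ ≤ (1 - Real.log ε) * (C₁ * (u - s)) + C₂ * (u - s) / ε := by linarith
      _ = _ := by ring
  · rw [← integral_const_mul]
    exact integral_relEnt_deriv_le hl hε.1 hε.2 (hV s) (hVp s hsT) (h1s s) (h10 s) (h1p s)
      (h2s s) (h20 s) (h2p s) (hαs s) (hα0 s) (hαp s) fun _ => rfl

end EntropyDissipation

/-- under assumptions (A1)–(A3), with `ρ²` the density of the
auxiliary system driven by `A[f]` and `α` the Fokker–Planck solution, and `C₂` the
constant of the score-difference lemma (i.e. `∫₀ᵗ ∫_𝒳 ‖∇log ρ¹_s - ∇log ρ²_s‖² ρ²_s ≤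
C₂ R(f)` for all `t ∈ [0,T]`), we have `KL(ρ²_t, α_t) ≤ (C₂/2) R(f)` for every
`t ∈ [0,T]`. -/
theorem kl_bound_auxiliary_system
    (d : ℕ) (hd : 0 < d) (l T L₀ Lf Lv : ℝ) (hl : 0 < l) (hT : 0 < T)
    (f : ℝ → E d → E d) (K : NNReal) (V : ℝ → E d → ℝ)
    (α₀ : E d → ℝ) (ρ1 ρ2 αs : ℝ → E d → ℝ)
    (hfsmooth : ∀ t, ContDiff ℝ (⊤ : ℕ∞) (f t))
    (hfcont : Continuous (Function.uncurry f))
    (hfLip : ∀ t, LipschitzWith K (f t))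
    (hVsmooth : ∀ t, ContDiff ℝ (⊤ : ℕ∞) (V t))
    (hα₀ : InitDensity d l α₀) (hA1 : RegInit d l L₀ α₀)
    (hA2 : RegVel d l T Lf f) (hA3 : RegPot d l T Lv V)
    (hρ1 : TransportedBy d l f α₀ ρ1)
    (hρ2 : TransportedBy d l (Avf V ρ1) α₀ ρ2)
    (hFPE : SolvesFPE d l V α₀ αs)
    (C₂ : ℝ) (hC₂pos : 0 < C₂)
    (hC₂ : ∀ t ∈ Icc (0 : ℝ) T,
      (∫ s in (0 : ℝ)..t, ∫ x in box d l,
          ‖score (ρ1 s) x - score (ρ2 s) x‖ ^ 2 * ρ2 s x) ≤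
        C₂ * Rloss d l T f V ρ1) :
    ∀ t ∈ Icc (0 : ℝ) T,
      KLdiv d l (ρ2 t) (αs t) ≤ C₂ / 2 * Rloss d l T f V ρ1 := by
  obtain ⟨C, -, hlog, hb⟩ := exists_score_bounds hl hT hfsmooth hfcont hVsmooth hα₀ hA1 hA2 hA3
    hρ1 hρ2
  obtain ⟨M, -, hM⟩ := hlog.exists_abs_le hl
  obtain ⟨h1s, h10, h1p, -, h1d⟩ := hρ1
  have h1c : ∀ x, Continuous fun t => ρ1 t x := fun x =>
    continuous_iff_continuousAt.2 fun t => (h1d t x).continuousAt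
  have h2c : ∀ x, Continuous fun t => ρ2 t x := fun x =>
    continuous_iff_continuousAt.2 fun t => (hρ2.2.2.2.2 t x).continuousAt
  have hint := integrableOn_relFisher (l := l) h1s h10 h1c hρ2.1 hρ2.2.1 h2c
    (fun t ht i x => (hb t ht i x).1) (fun t ht i x => (hb t ht i x).2.1) (M := Real.exp M)
    fun t ht x => by
      rw [← Real.log_le_iff_le_exp (hρ2.2.1 t x)]
      exact (le_abs_self _).trans (hM t ht x)
  intro t ht
  have hKL := KLdiv_le_of_relEnt_le (l := l) (hρ2.1 t).continuous (hFPE.1 t).continuous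
    (hρ2.2.1 t) (hFPE.2.1 t) fun ε hε => integral_relEnt_le hl hd hVsmooth
      (fun s hs => (hA3 s hs).1) h1s h10 h1p hρ2 hFPE hlog
      (fun s hs i x => (hb s hs i x).2.2) hint hε ht
  have hnonneg : 0 ≤ ∫ s in (0 : ℝ)..t, ∫ x in box d l,
      ‖score (ρ1 s) x - score (ρ2 s) x‖ ^ 2 * ρ2 s x :=
    intervalIntegral.integral_nonneg ht.1 fun s _ => integral_nonneg fun x =>
      mul_nonneg (sq_nonneg _) (hρ2.2.1 s x).le
  linarith [hC₂ t ht]
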